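/- If G is a bridgeless cubic graph satisfying μ_3(G) ≤ |E(G)|/5, then G has a proper 5-edge-coloring in which at least (4/5)|E(G)| edges are normal. -/

import Mathlib

open Finset

def IsPerfectMatchingFinset {V : Type*} [Fintype V] [DecidableEq V]
    (G : SimpleGraph V) (M : Finset (Sym2 V)) : Prop :=
  (∀ e ∈ M, e ∈ G.edgeSet) ∧ ∀ v : V, (M.filter (fun e => v ∈ e)).card = 1

def edgeMult {V : Type*} [DecidableEq V] (M : Fin 3 → Finset (Sym2 V)) (e : Sym2 V) : ℕ :=
  (Finset.univ.filter fun i => e ∈ M i).card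

/-- The set of edges of `G` contained in exactly `i` of the three matchings. -/
def matchClass {V : Type*} [Fintype V] [DecidableEq V]
    (G : SimpleGraph V) [DecidableRel G.Adj] (M : Fin 3 → Finset (Sym2 V)) (i : ℕ) :
    Finset (Sym2 V) :=
  G.edgeFinset.filter fun e => edgeMult M e = i

/-- A proper edge coloring with `n` colors: distinct adjacent edges get
distinct colors. -/
def IsProperEdgeColoring {V : Type*} (G : SimpleGraph V) {n : ℕ} (c : Sym2 V → Fin n) : Prop :=
  ∀ e ∈ G.edgeSet, ∀ f ∈ G.edgeSet, e ≠ f → (∃ v, v ∈ e ∧ v ∈ f) → c e ≠ c f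

/-- The closed neighbourhood of an edge: the edge together with all edges
adjacent to it. -/
def edgeNbhd {V : Type*} [Fintype V] [DecidableEq V]
    (G : SimpleGraph V) [DecidableRel G.Adj] (e : Sym2 V) : Finset (Sym2 V) :=
  G.edgeFinset.filter fun f => ∃ v, v ∈ e ∧ v ∈ f

/-- An edge is poor if it and its adjacent edges use exactly 3 colors. -/
def IsPoorEdge {V : Type*} [Fintype V] [DecidableEq V]
    (G : SimpleGraph V) [DecidableRel G.Adj] {n : ℕ} (c : Sym2 V → Fin n) (e : Sym2 V) : Prop :=
  ((edgeNbhd G e).image c).card = 3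

/-- An edge is rich if it and its adjacent edges use exactly 5 colors. -/
def IsRichEdge {V : Type*} [Fintype V] [DecidableEq V]
    (G : SimpleGraph V) [DecidableRel G.Adj] {n : ℕ} (c : Sym2 V → Fin n) (e : Sym2 V) : Prop :=
  ((edgeNbhd G e).image c).card = 5

/-- An edge is normal if it is poor or rich. -/
def IsNormalEdge {V : Type*} [Fintype V] [DecidableEq V]
    (G : SimpleGraph V) [DecidableRel G.Adj] {n : ℕ} (c : Sym2 V → Fin n) (e : Sym2 V) : Prop :=
  IsPoorEdge G c e ∨ IsRichEdge G c e

/-- The set of colors appearing on the edges incident with a vertex. -/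
def vertexColors {V : Type*} [Fintype V] [DecidableEq V]
    (G : SimpleGraph V) [DecidableRel G.Adj] {n : ℕ} (c : Sym2 V → Fin n) (u : V) :
    Finset (Fin n) :=
  (G.incidenceFinset u).image c

/-! ## Words around a cycle -/

/-- an edge with neighbours `a,t` at one end and `t',c` at the other is not normal -/
def badN (a t t' c : ℕ) : ℕ :=
  bif (Bool.xor (Nat.beq a t' || Nat.beq a c) (Nat.beq t t' || Nat.beq t c)) then 1 else 0
def mixN (a b : ℕ) : ℕ := bif (Bool.xor (Nat.ble 3 a) (Nat.ble 3 b)) then 1 else 0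

/-- a cycle of length `n` with third colours `th` can be coloured at cost `N`;
`x j` is the colour of the edge entering vertex `j`. -/
def Cyc (n : ℕ) (th : ℕ → ℕ) (N : ℕ) : Prop :=
  ∃ x : ℕ → ℕ, (∀ j, x (j + n) = x j) ∧
    (∀ j, x j < 5 ∧ x j ≠ th j ∧ x (j + 1) ≠ th j ∧ x j ≠ x (j + 1)) ∧
    ∑ j ∈ Finset.range n,
      (badN (x j) (th j) (th (j + 1)) (x (j + 2)) + mixN (x (j + 1)) (x (j + 2))) ≤ N

theorem Cyc.mono {n : ℕ} {th : ℕ → ℕ} {N N' : ℕ} (h : Cyc n th N) (hN : N ≤ N') : Cyc n th N' := by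
  obtain ⟨x, h1, h2, h3⟩ := h
  exact ⟨x, h1, h2, h3.trans hN⟩

theorem sum_periodic_shift (n : ℕ) (F : ℕ → ℕ) (hF : ∀ j, F (j + n) = F j) (s : ℕ) :
    ∑ j ∈ Finset.range n, F (j + s) = ∑ j ∈ Finset.range n, F j := by
  induction s with
  | zero => simp
  | succ s ih =>
    rw [← ih]
    have h1 := Finset.sum_range_succ (fun j => F (j + s)) n
    have h2 := Finset.sum_range_succ' (fun j => F (j + s)) n
    have h3 : F (n + s) = F (0 + s) := by rw [← hF (0 + s)]; congr 1; omega
    have h4 : ∀ j, F (j + 1 + s) = F (j + (s + 1)) := fun j => by congr 1; omega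
    simp only [h4] at h2
    simp only [h3] at h1
    omega

theorem per_mul {α : Type*} {n : ℕ} {f : ℕ → α} (hf : ∀ j, f (j + n) = f j) (j k : ℕ) :
    f (j + n * k) = f j := by
  induction k with
  | zero => simp
  | succ k ih => rw [Nat.mul_succ, ← Nat.add_assoc, hf, ih]

theorem Cyc.rot {n : ℕ} (hn : 0 < n) {th : ℕ → ℕ} (hth : ∀ j, th (j + n) = th j) {N : ℕ} (r : ℕ)
    (h : Cyc n (fun j => th (j + r)) N) : Cyc n th N := by
  obtain ⟨x, h1, h2, h3⟩ := h
  have hr : r ≤ n * r := Nat.le_mul_of_pos_left r hn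
  have hs : ∀ j, th (j + (n * r - r) + r) = th j := fun j => by
    rw [← per_mul hth j r]; congr 1; omega
  refine ⟨fun j => x (j + (n * r - r)), fun j => ?_, fun j => ?_, ?_⟩
  · have := h1 (j + (n * r - r))
    show x _ = x _
    rw [← this]; congr 1; omega
  · have := h2 (j + (n * r - r))
    simp only [hs] at this
    have e : j + 1 + (n * r - r) = j + (n * r - r) + 1 := by omega
    simpa only [e] using this
  · refine le_trans (le_of_eq ?_) h3
    have key := sum_periodic_shift n (fun j => badN (x j) (th (j + r)) (th (j + 1 + r)) (x (j + 2)) + mixN (x (j + 1)) (x (j + 2)))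
      (fun j => ?_) (n * r - r)
    · rw [← key]
      refine Finset.sum_congr rfl fun j _ => ?_
      have e1 : j + 1 + (n * r - r) = j + (n * r - r) + 1 := by omega
      have e2 : j + 2 + (n * r - r) = j + (n * r - r) + 2 := by omega
      have t2 := hs (j + 1)
      rw [e1] at t2
      simp only [hs, e1, e2, t2]
    · have p1 : th (j + n + r) = th (j + r) := by rw [← hth (j + r)]; congr 1; omega
      have p2 : th (j + n + 1 + r) = th (j + 1 + r) := by rw [← hth (j + 1 + r)]; congr 1; omega
      have q1 : x (j + n + 1) = x (j + 1) := by rw [← h1 (j + 1)]; congr 1; omega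
      have q2 : x (j + n + 2) = x (j + 2) := by rw [← h1 (j + 2)]; congr 1; omega
      simp only [p1, p2, q1, q2, h1]

/-- net cost of a step -/
def stc (a t b t' c : ℕ) (f : Bool) : ℤ :=
  (badN a t t' c : ℤ) + (mixN b c : ℤ) - (bif f then 0 else 1)

inductive Run : ℕ → ℕ → ℕ → List (ℕ × Bool) → ℕ → ℕ → ℕ → ℤ → Prop
  | nil (a t b : ℕ) (K : ℤ) : 0 ≤ K → Run a t b [] a t b K
  | cons (a t b t' c : ℕ) (f : Bool) (ws : List (ℕ × Bool)) (a1 t1 b1 : ℕ) (K : ℤ) :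
      b ≠ t' → b ≠ c → c ≠ t' → c < 5 → Run b t' c ws a1 t1 b1 (K - stc a t b t' c f) →
      Run a t b ((t', f) :: ws) a1 t1 b1 K

theorem Run.mono {a t b : ℕ} {ws : List (ℕ × Bool)} {a1 t1 b1 : ℕ} {K : ℤ}
    (h : Run a t b ws a1 t1 b1 K) : ∀ {K' : ℤ}, K ≤ K' → Run a t b ws a1 t1 b1 K' := by
  induction h with
  | nil a t b K h0 => intro K' h; exact Run.nil _ _ _ _ (h0.trans h)
  | cons a t b t' c f ws a1 t1 b1 K h1 h2 h3 h4 _ ih =>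
    intro K' h
    exact Run.cons _ _ _ _ _ _ _ _ _ _ _ h1 h2 h3 h4 (ih (by linarith))

theorem Run.append {a t b : ℕ} {ws : List (ℕ × Bool)} {a1 t1 b1 : ℕ} {K : ℤ}
    (h : Run a t b ws a1 t1 b1 K) : ∀ {ws' : List (ℕ × Bool)} {a2 t2 b2 : ℕ} {K' : ℤ},
    Run a1 t1 b1 ws' a2 t2 b2 K' → Run a t b (ws ++ ws') a2 t2 b2 (K + K') := by
  induction h with
  | nil a t b K h0 => intro ws' a2 t2 b2 K' h; exact h.mono (by linarith)
  | cons a t b t' c f ws a1 t1 b1 K h1 h2 h3 h4 _ ih =>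
    intro ws' a2 t2 b2 K' h
    exact Run.cons _ _ _ _ _ _ _ _ _ _ _ h1 h2 h3 h4 ((ih h).mono (by linarith))

theorem Run.first {t b t' c : ℕ} {ws : List (ℕ × Bool)} {a1 t1 b1 : ℕ} {K : ℤ} (a : ℕ)
    (h1 : b ≠ t') (h2 : b ≠ c) (h3 : c ≠ t') (h4 : c < 5)
    (h : Run b t' c ws a1 t1 b1 (K - mixN b c)) : Run a t b ((t', false) :: ws) a1 t1 b1 K := by
  refine Run.cons _ _ _ _ _ _ _ _ _ _ _ h1 h2 h3 h4 (h.mono ?_)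
  have : badN a t t' c ≤ 1 := by
    unfold badN; cases (Bool.xor (Nat.beq a t' || Nat.beq a c) (Nat.beq t t' || Nat.beq t c)) <;> simp
  simp only [stc, cond_false]
  have : (badN a t t' c : ℤ) ≤ 1 := by exact_mod_cast this
  linarith

theorem Run.toFun {a t b : ℕ} {ws : List (ℕ × Bool)} {a1 t1 b1 : ℕ} {K : ℤ}
    (h : Run a t b ws a1 t1 b1 K) : ∀ (th : ℕ → ℕ) (P : ℕ → Bool) (n : ℕ), th 0 = t →
    ws = (List.range n).map (fun j => (th (j + 1), P j)) →
    ∃ x : ℕ → ℕ, x 0 = a ∧ x 1 = b ∧ x n = a1 ∧ x (n + 1) = b1 ∧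
      (∀ j < n, x (j + 2) < 5 ∧ x (j + 1) ≠ th (j + 1) ∧ x (j + 2) ≠ th (j + 1) ∧ x (j + 1) ≠ x (j + 2)) ∧
      ((∑ j ∈ Finset.range n,
      (badN (x j) (th j) (th (j + 1)) (x (j + 2)) + mixN (x (j + 1)) (x (j + 2))) : ℕ) : ℤ) ≤
        K + ((∑ j ∈ Finset.range n, (bif P j then 0 else 1) : ℕ) : ℤ) := by
  induction h with
  | nil a t b K h0 =>
    intro th P n ht hw
    have hn : n = 0 := by
      have := congrArg List.length hw
      simpa using this.symm
    subst hn
    exact ⟨fun j => if j = 0 then a else b, by simp, by simp, by simp, by simp, by simp, by simpa using h0⟩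
  | cons a t b t' c f ws a1 t1 b1 K h1 h2 h3 h4 _ ih =>
    intro th P n ht hw
    obtain _ | n := n
    · simp at hw
    rw [List.range_succ_eq_map, List.map_cons, List.map_map] at hw
    simp only [List.cons.injEq, Prod.mk.injEq] at hw
    obtain ⟨⟨e1, e2⟩, e3⟩ := hw
    obtain ⟨x, x0, x1, xn, xn1, hx, hs⟩ := ih (fun j => th (j + 1)) (fun j => P (j + 1)) n (by simpa using e1.symm) (by
      rw [e3]; rfl)
    refine ⟨fun j => if j = 0 then a else x (j - 1), by simp, by simp [x0], by simpa using xn, by simpa using xn1, ?_, ?_⟩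
    · intro j hj
      obtain _ | j := j
      · simp only [x0, x1]
        simp [← e1]
        exact ⟨h4, h1, h3, h2⟩
      · have := hx j (by omega)
        simpa using this
    · rw [Finset.sum_range_succ', Finset.sum_range_succ' (fun j => bif P j then 0 else 1)]
      have z : th 1 = t' := by simpa using e1.symm
      simp [x0, x1, ht, z] at hs ⊢
      simp only [stc, e2] at hs
      have q : (((bif P 0 then 0 else 1 : ℕ)) : ℤ) = (bif P 0 then 0 else 1 : ℤ) := by cases P 0 <;> rfl
      have q2 := hs
      have hc : ∀ (A B : ℤ), (cond (P 0) (0:ℤ) 1) = (((cond (P 0) (0:ℕ) 1) : ℕ) : ℤ) := by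
        intro _ _; cases P 0 <;> rfl
      linarith [hc 0 0]

/-- closed runs give colourings of the cycle -/
theorem Run.toCyc {n : ℕ} (hn : 0 < n) {th : ℕ → ℕ} (hth : ∀ j, th (j + n) = th j) {P : ℕ → Bool} {a b : ℕ} {K : ℕ}
    (h : Run a (th 0) b ((List.range n).map (fun j => (th (j + 1), P j))) a (th 0) b K) :
    Cyc n th ((∑ j ∈ Finset.range n, (bif P j then 0 else 1)) + K) := by
  obtain ⟨x, x0, x1, xn, xn1, hx, hs⟩ := h.toFun th P n rfl rfl
  have hm : ∀ j, x (j % n + 1) = x ((j + 1) % n) := by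
    intro j
    by_cases hj : j % n + 1 < n
    · rw [Nat.add_mod j 1 n, Nat.mod_eq_of_lt (a := j % n + 1 % n)]
      · obtain rfl | h1 : n = 1 ∨ 1 < n := by omega
        · omega
        · rw [Nat.mod_eq_of_lt h1]
      · exact lt_of_le_of_lt (Nat.add_le_add_left (Nat.mod_le 1 n) _) hj
    · have e : j % n + 1 = n := by have := Nat.mod_lt j hn; omega
      have : (j + 1) % n = 0 := by
        rw [← Nat.mod_add_mod, e, Nat.mod_self]
      rw [e, this, xn, x0]
  have hm2 : ∀ j, x (j % n + 2) = x ((j + 2) % n) := by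
    intro j
    by_cases hj : j % n + 1 < n
    · have := hm (j + 1)
      rw [← this]
      congr 1
      have : (j + 1) % n = j % n + 1 := by
        rw [← Nat.mod_add_mod]; exact Nat.mod_eq_of_lt hj
      omega
    · have e : j % n + 1 = n := by have := Nat.mod_lt j hn; omega
      have : (j + 1) % n = 0 := by
        rw [← Nat.mod_add_mod, e, Nat.mod_self]
      rw [← hm (j + 1), this, show j % n + 2 = n + 1 by omega, xn1, x1]
  have ht : ∀ j, th (j % n) = th j := by
    intro j
    rw [← per_mul hth (j % n) (j / n), Nat.mod_add_div]
  have ht1 : ∀ j, th (j % n + 1) = th (j + 1) := by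
    intro j
    rw [← per_mul hth (j % n + 1) (j / n)]
    congr 1
    have := Nat.mod_add_div j n
    omega
  have hall : ∀ j < n, x (j + 1) < 5 ∧ x j ≠ th j ∧ x (j + 1) ≠ th j ∧ x j ≠ x (j + 1) := by
    intro j hj
    obtain _ | j := j
    · have h := hx (n - 1) (by omega)
      have e1 : n - 1 + 1 = n := by omega
      have e2 : n - 1 + 2 = n + 1 := by omega
      rw [e1, e2, xn, xn1] at h
      have e3 : th n = th 0 := by simpa using hth 0
      rw [e3] at h
      simpa only [x0, x1, zero_add] using h
    · exact hx j (by omega)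
  refine ⟨fun j => x (j % n), fun j => by simp, fun j => ?_, ?_⟩
  · have h := hall (j % n) (Nat.mod_lt j hn)
    rw [hm, ht] at h
    refine ⟨?_, h.2⟩
    show x (j % n) < 5
    by_cases h0 : j % n = 0
    · have h' := hall (n - 1) (by omega)
      rw [show n - 1 + 1 = n by omega, xn, ← x0] at h'
      rw [h0]; exact h'.1
    · have h' := hall (j % n - 1) (by have := Nat.mod_lt j hn; omega)
      rw [show j % n - 1 + 1 = j % n by omega] at h'
      exact h'.1
  · have : ∑ j ∈ Finset.range n, (badN (x (j % n)) (th j) (th (j + 1)) (x ((j + 2) % n)) + mixN (x ((j + 1) % n)) (x ((j + 2) % n)))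
      = ∑ j ∈ Finset.range n, (badN (x j) (th j) (th (j + 1)) (x (j + 2)) + mixN (x (j + 1)) (x (j + 2))) := by
      refine Finset.sum_congr rfl fun j hj => ?_
      have hj' : j % n = j := Nat.mod_eq_of_lt (Finset.mem_range.1 hj)
      rw [← hm2, ← hm, hj']
    rw [this]
    have := hs
    omega

def anyB (p : ℕ → Bool) : ℕ → Bool
  | 0 => false
  | n + 1 => p n || anyB p n

theorem anyB_spec {p : ℕ → Bool} {n : ℕ} (h : anyB p n = true) : ∃ i < n, p i = true := by
  induction n with
  | zero => simp [anyB] at h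
  | succ n ih =>
    simp only [anyB, Bool.or_eq_true] at h
    rcases h with h | h
    · exact ⟨n, by omega, h⟩
    · obtain ⟨i, hi, h⟩ := ih h
      exact ⟨i, by omega, h⟩

def lw (l : Bool × ℕ) : List (ℕ × Bool) :=
  bif l.1 then [(l.2, false), (l.2, true)] else [(l.2, false)]

def rchk (fin : ℕ → ℕ → ℕ → Bool) : ℕ → ℕ → ℕ → List (ℕ × Bool) → List ℕ → ℕ → ℕ → Bool
  | a, t, b, [], _, u, v => fin a t b && Nat.ble u v
  | _, _, _, _ :: _, [], _, _ => false
  | a, t, b, (t', f) :: ws, c :: cs, u, v =>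
    !(Nat.beq b t') && !(Nat.beq b c) && !(Nat.beq c t') && Nat.ble c 4 &&
      rchk fin b t' c ws cs (badN a t t' c + mixN b c + u) (bif f then v else v + 1)

theorem rchk_sound {fin : ℕ → ℕ → ℕ → Bool} {ws : List (ℕ × Bool)} : ∀ {a t b : ℕ} {cs : List ℕ} {u v : ℕ},
    rchk fin a t b ws cs u v = true →
    ∃ a1 t1 b1, fin a1 t1 b1 = true ∧ Run a t b ws a1 t1 b1 ((v : ℤ) - u) := by
  induction ws with
  | nil =>
    intro a t b cs u v h
    simp only [rchk, Bool.and_eq_true] at h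
    exact ⟨a, t, b, h.1, Run.nil _ _ _ _ (by have := Nat.le_of_ble_eq_true h.2; omega)⟩
  | cons w ws ih =>
    intro a t b cs u v h
    obtain ⟨t', f⟩ := w
    obtain _ | ⟨c, cs⟩ := cs
    · simp [rchk] at h
    simp only [rchk, Bool.and_eq_true, Bool.not_eq_true'] at h
    obtain ⟨⟨⟨⟨h1, h2⟩, h3⟩, h4⟩, h5⟩ := h
    obtain ⟨a1, t1, b1, hf, hr⟩ := ih h5
    refine ⟨a1, t1, b1, hf, Run.cons _ _ _ _ _ _ _ _ _ _ _ ?_ ?_ ?_ ?_ (hr.mono ?_)⟩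
    · rintro rfl; simp at h1
    · rintro rfl; simp at h2
    · rintro rfl; simp at h3
    · have := Nat.le_of_ble_eq_true h4; omega
    · cases f <;> simp [stc] <;> linarith

/-- forced continuation with colours 0,1,2 -/
def genF : List (ℕ × Bool) → ℕ → List ℕ
  | [], _ => []
  | (t, _) :: ws, b => (3 - t - b) :: genF ws (3 - t - b)

/-- alternate `s` times, then `z`, then forced -/
def genL : List (ℕ × Bool) → ℕ → ℕ → ℕ → List ℕ
  | [], _, _, _ => []
  | _ :: ws, b, s + 1, z => (7 - b) :: genL ws (7 - b) s z
  | _ :: ws, _, 0, z => z :: genF ws z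

/-- forced `i` times, then `o`, then as in `genL` -/
def genR : List (ℕ × Bool) → ℕ → ℕ → ℕ → ℕ → ℕ → List ℕ
  | [], _, _, _, _, _ => []
  | (t, _) :: ws, b, i + 1, o, s, z => (3 - t - b) :: genR ws (3 - t - b) i o s z
  | _ :: ws, _, 0, o, s, z => o :: genL ws o s z

/-- alternate `s` times, then `z`, then forced `k` times, then `o`, then alternate -/
def genA : List (ℕ × Bool) → ℕ → ℕ → ℕ → ℕ → ℕ → List ℕ
  | [], _, _, _, _, _ => []
  | _ :: ws, b, s + 1, z, k, o => (7 - b) :: genA ws (7 - b) s z k o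
  | _ :: ws, _, 0, z, k, o => z :: genR ws z k o 100 0

def clchk (ws : List (ℕ × Bool)) (d K b : ℕ) (cs : List ℕ) : Bool :=
    Nat.beq (cs.getD (ws.length - 1) 0) b &&
    let a := (b :: cs).getD (ws.length - 1) 0
    rchk (fun a' t' b' => Nat.beq a' a && Nat.beq b' b && Nat.beq t' d) a d b ws cs 0 K

def cls (ws : List (ℕ × Bool)) (d K : ℕ) : Bool :=
  ([(0,0,4),(4,0,4),(0,4,4),(2,0,4),(3,0,3),(0,2,4),(2,2,4),(1,0,3),(1,2,3)] : List (ℕ × ℕ × ℕ)).any (fun q =>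
    anyB (fun z => clchk ws d K 3 (genA ws 3 q.1 z q.2.1 q.2.2)) 3) ||
  ([(0,3),(0,1),(1,1),(2,1)] : List (ℕ × ℕ)).any (fun q =>
    anyB (fun b => anyB (fun z => clchk ws d K b (genR ws b q.1 3 q.2 z)) 3) 3)

theorem cls_sound {ws : List (ℕ × Bool)} {d K : ℕ} (h : cls ws d K = true) :
    ∃ a b, Run a d b ws a d b K := by
  have key : ∀ b cs, clchk ws d K b cs = true → ∃ a b, Run a d b ws a d b K := by
    intro b cs h
    simp only [clchk, Bool.and_eq_true] at h
    obtain ⟨a1, t1, b1, hf, hr⟩ := rchk_sound h.2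
    simp only [Bool.and_eq_true] at hf
    obtain ⟨⟨h1, h2⟩, h3⟩ := hf
    have h1 := Nat.eq_of_beq_eq_true h1
    have h2 := Nat.eq_of_beq_eq_true h2
    have h3 := Nat.eq_of_beq_eq_true h3
    subst h1 h2 h3
    exact ⟨_, _, by simpa using hr⟩
  simp only [cls, Bool.or_eq_true] at h
  rcases h with h | h
  · obtain ⟨_, _, h⟩ := List.any_eq_true.1 h
    obtain ⟨_, _, h⟩ := anyB_spec h
    exact key _ _ h
  · obtain ⟨_, _, h⟩ := List.any_eq_true.1 h
    obtain ⟨_, _, h⟩ := anyB_spec h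
    obtain ⟨_, _, h⟩ := anyB_spec h
    exact key _ _ h

theorem cls3 : ∀ k1 k2 k3 : Bool, (Bool.xor (Bool.xor k1 k2) k3) = true → ∀ a b c : Fin 3,
    (∃ g : Fin 3, ∀ d : Fin 3, d ≠ g →
      cls (lw (k1, a) ++ lw (k2, b) ++ lw (k3, c) ++ [((d : ℕ), false)]) d 0 = true) ∧
    ∀ d : Fin 3, cls (lw (k1, a) ++ lw (k2, b) ++ lw (k3, c) ++ [((d : ℕ), false)]) d 1 = true := by
  decide +kernel

theorem cls2 : ∀ k : Bool, ∀ a b : Fin 3,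
    (∃ g : Fin 3, ∀ d : Fin 3, d ≠ g →
      cls (lw (k, a) ++ lw (k, b) ++ [((d : ℕ), false)]) d 0 = true) ∧
    ∀ d : Fin 3, cls (lw (k, a) ++ lw (k, b) ++ [((d : ℕ), false)]) d 2 = true ∧
    (¬ (a = d ∧ b = d) → cls (lw (k, a) ++ lw (k, b) ++ [((d : ℕ), false)]) d 1 = true) := by
  decide +kernel

/-- check of a window whose first edge is not special; the cost of the first edge is free -/
def chkF (fin : ℕ → ℕ → ℕ → Bool) (o : ℕ) (ws : List (ℕ × Bool)) (cs : List ℕ) (K : ℕ) : Bool :=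
  match ws, cs with
  | (t', f) :: ws, c :: cs => !f && !(Nat.beq o t') && !(Nat.beq o c) && !(Nat.beq c t') && Nat.ble c 4 &&
      rchk fin o t' c ws cs (mixN o c) K
  | _, _ => false

theorem chkF_sound {fin : ℕ → ℕ → ℕ → Bool} {o : ℕ} {ws : List (ℕ × Bool)} {cs : List ℕ} {K : ℕ}
    (h : chkF fin o ws cs K = true) (a t : ℕ) :
    ∃ a1 t1 b1, fin a1 t1 b1 = true ∧ Run a t o ws a1 t1 b1 K := by
  obtain _ | ⟨⟨t', f⟩, ws⟩ := ws
  · simp [chkF] at h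
  obtain _ | ⟨c, cs⟩ := cs
  · simp [chkF] at h
  simp only [chkF, Bool.and_eq_true, Bool.not_eq_true'] at h
  obtain ⟨⟨⟨⟨⟨h0, h1⟩, h2⟩, h3⟩, h4⟩, h5⟩ := h
  subst h0
  obtain ⟨a1, t1, b1, hf, hr⟩ := rchk_sound h5
  refine ⟨a1, t1, b1, hf, Run.first a ?_ ?_ ?_ ?_ hr⟩
  · rintro rfl; simp at h1
  · rintro rfl; simp at h2
  · rintro rfl; simp at h3
  · have := Nat.le_of_ble_eq_true h4; omega

theorem right2 : ∀ k1 k2 : Bool, ∀ c f x d : Fin 3, x ≠ d → x ≠ c →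
    anyB (fun i => anyB (fun q =>
      rchk (fun _ t' b' => Nat.beq t' f && Nat.beq b' 3) (3 - d - x) d x (lw (k1, c) ++ lw (k2, f))
        (genR (lw (k1, c) ++ lw (k2, f)) x i (q + 3) 100 0) 0 0) 2) 4 = true := by
  decide +kernel

theorem left2 : ∀ k2 k1 : Bool, ∀ f c y d : Fin 3, y ≠ d → y ≠ c → ∀ o : Fin 2,
    anyB (fun s => anyB (fun z =>
      chkF (fun a' t' b' => Nat.beq a' y && Nat.beq t' d && Nat.beq b' (3 - d - y)) (o + 3)
        (lw (k2, f) ++ lw (k1, c) ++ [((d : ℕ), false)])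
        (genL (lw (k2, f) ++ lw (k1, c) ++ [((d : ℕ), false)]) (o + 3) s z) 0) 3) 4 = true := by
  decide +kernel

def r3chk (k2 k3 : Bool) (a f g d y o K : ℕ) : Bool :=
  anyB (fun i => anyB (fun q =>
      rchk (fun _ t' b' => Nat.beq t' g && Nat.beq b' o) y d (3 - d - a) (lw (true, a) ++ lw (k2, f) ++ lw (k3, g))
        (genR (lw (true, a) ++ lw (k2, f) ++ lw (k3, g)) (3 - d - a) i (q + 3) 100 0) 0 K) 2) 6

theorem right3 : ∀ k2 k3 : Bool, ∀ a f g : Fin 3,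
    (∃ d : Fin 3, d ≠ a ∧ ∀ o : Fin 2, r3chk k2 k3 a f g d 3 (o + 3) 0 = true) ∧
    (∀ d : Fin 3, d ≠ a → ∀ o : Fin 2, r3chk k2 k3 a f g d 3 (o + 3) 1 = true) := by
  decide +kernel

def lws (L : List (Bool × ℕ)) : List (ℕ × Bool) := L.flatMap lw

theorem lws_nil : lws [] = [] := rfl
theorem lws_cons (l : Bool × ℕ) (L : List (Bool × ℕ)) : lws (l :: L) = lw l ++ lws L := rfl
theorem lws_append (L L' : List (Bool × ℕ)) : lws (L ++ L') = lws L ++ lws L' := by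
  simp [lws]

theorem badN_le (a t t' c : ℕ) : badN a t t' c ≤ 1 := by
  unfold badN; cases (Bool.xor (Nat.beq a t' || Nat.beq a c) (Nat.beq t t' || Nat.beq t c)) <;> simp

theorem badN_same (o t : ℕ) : badN o t t o = 0 := by
  simp [badN]

theorem letter_run (l : Bool × ℕ) (hl : l.2 < 3) (a t o : ℕ) (ho : o = 3 ∨ o = 4) :
    Run a t o (lw l) (bif l.1 then 7 - o else o) l.2 (bif l.1 then o else 7 - o) 0 := by
  obtain ⟨k, c⟩ := l
  have h1 : o ≠ c := by rintro rfl; rcases ho with h | h <;> simp_all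
  have h2 : o ≠ 7 - o := by omega
  have h3 : 7 - o ≠ c := by simp at hl; omega
  have hm : mixN o (7 - o) = 0 := by rcases ho with rfl | rfl <;> rfl
  have hm' : mixN (7 - o) o = 0 := by rcases ho with rfl | rfl <;> rfl
  cases k
  · refine Run.first a h1 h2 h3 (by omega) (Run.nil _ _ _ _ (by simp [hm]))
  · refine Run.first a h1 h2 h3 (by omega) ?_
    refine Run.cons _ _ _ _ _ _ _ _ _ _ _ h3 h2.symm h1 (by omega) (Run.nil _ _ _ _ ?_)
    simp [stc, badN_same, hm', hm]

/-- middle part -/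
theorem middle (L : List (Bool × ℕ)) : (∀ l ∈ L, l.2 < 3) → ∀ (a t o : ℕ), (o = 3 ∨ o = 4) →
    ∃ a1 t1, (L ≠ [] → a1 = 3 ∨ a1 = 4) ∧ (∀ l, L.getLast? = some l → t1 = l.2) ∧
      Run a t o (lws L) a1 t1 (if (lws L).length % 2 = 0 then o else 7 - o) 0 := by
  induction L with
  | nil =>
    intro _ a t o _
    exact ⟨a, t, by simp, by simp, by simpa [lws] using Run.nil a t o 0 le_rfl⟩
  | cons l L ih =>
    intro hL a t o ho
    have h1 := letter_run l (hL l (by simp)) a t o ho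
    set o1 := (bif l.1 then o else 7 - o) with ho1
    have ho1' : o1 = 3 ∨ o1 = 4 := by
      rw [ho1]; cases l.1 <;> simp <;> omega
    obtain ⟨a1, t1, h2, h3, h4⟩ := ih (fun l hl => hL l (by simp [hl])) (bif l.1 then 7 - o else o) l.2 o1 ho1'
    by_cases hLn : L = []
    · subst hLn
      refine ⟨(bif l.1 then 7 - o else o), l.2, ?_, by simp, ?_⟩
      · intro _; exact (show (bif l.1 then 7 - o else o) = 3 ∨ (bif l.1 then 7 - o else o) = 4 by
          cases l.1 <;> simp <;> omega)
      · rw [lws_cons, lws_nil, List.append_nil]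
        convert h1 using 1
        obtain ⟨k, c⟩ := l
        cases k <;> simp [lw, ho1]
    · refine ⟨a1, t1, fun _ => h2 hLn, ?_, ?_⟩
      · intro l' hl'
        apply h3
        rwa [List.getLast?_cons, Option.some_inj, List.getLast?_eq_some_getLast hLn, Option.getD_some, ← Option.some_inj, ← List.getLast?_eq_some_getLast hLn] at hl'
      · rw [lws_cons]
        have := h1.append h4
        rw [add_zero] at this
        convert this using 1
        rw [List.length_append]
        obtain ⟨k, c⟩ := l
        rcases Nat.mod_two_eq_zero_or_one (lws L).length with h | h
        · have e1 : (0 + 1 + (lws L).length) % 2 = 1 := by omega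
          have e2 : (0 + 1 + 1 + (lws L).length) % 2 = 0 := by omega
          cases k <;> simp only [lw, ho1, cond_true, cond_false, List.length_cons, List.length_nil, h, e1, e2] <;> simp
        · have e1 : (0 + 1 + (lws L).length) % 2 = 0 := by omega
          have e2 : (0 + 1 + 1 + (lws L).length) % 2 = 1 := by omega
          cases k <;> simp only [lw, ho1, cond_true, cond_false, List.length_cons, List.length_nil, h, e1, e2] <;> simp
          omega

def GoodAt (L : List (Bool × ℕ)) (d : ℕ) (K : ℤ) : Prop :=
  ∃ a b, Run a d b (lws L ++ [(d, false)]) a d b K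

/-- case I : `p` is interior -/
theorem caseI (r1 r2 l2 l1 : Bool × ℕ) (M : List (Bool × ℕ)) (hM : ∀ l ∈ M, l.2 < 3)
    (h1 : r1.2 < 3) (h2 : r2.2 < 3) (h3 : l2.2 < 3) (h4 : l1.2 < 3) (d x y : ℕ) (hd : d < 3) (hx : x < 3) (hy : y < 3)
    (hxy : x ≠ y) (hxd : x ≠ d) (hyd : y ≠ d) (hx1 : x ≠ r1.2) (hy1 : y ≠ l1.2) :
    GoodAt (r1 :: r2 :: M ++ [l2, l1]) d 0 := by
  obtain ⟨k1, c1⟩ := r1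
  obtain ⟨k2, c2⟩ := r2
  obtain ⟨k3, c3⟩ := l2
  obtain ⟨k4, c4⟩ := l1
  have R := right2 k1 k2 ⟨c1, h1⟩ ⟨c2, h2⟩ ⟨x, hx⟩ ⟨d, hd⟩ (by simpa using hxd) (by simpa using hx1)
  obtain ⟨_, _, R⟩ := anyB_spec R
  obtain ⟨_, _, R⟩ := anyB_spec R
  obtain ⟨a1, t1, b1, hf, R⟩ := rchk_sound R
  simp only [Bool.and_eq_true] at hf
  have hb1 := Nat.eq_of_beq_eq_true hf.2
  subst hb1
  obtain ⟨a2, t2, -, -, Mr⟩ := middle M hM a1 t1 3 (Or.inl rfl)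
  have hoo : (if (lws M).length % 2 = 0 then 3 else 7 - 3) = 3 ∨ (if (lws M).length % 2 = 0 then 3 else 7 - 3) = 4 := by
    split_ifs <;> simp
  generalize (if (lws M).length % 2 = 0 then 3 else 7 - 3) = o2 at Mr hoo
  have Lf := left2 k3 k4 ⟨c3, h3⟩ ⟨c4, h4⟩ ⟨y, hy⟩ ⟨d, hd⟩ (by simpa using hyd) (by simpa using hy1) ⟨o2 - 3, by omega⟩
  obtain ⟨_, _, Lf⟩ := anyB_spec Lf
  obtain ⟨_, _, Lf⟩ := anyB_spec Lf
  obtain ⟨a3, t3, b3, hf3, Lf⟩ := chkF_sound Lf a2 t2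
  simp only [Bool.and_eq_true] at hf3
  obtain ⟨⟨e1, e2⟩, e3⟩ := hf3
  have e1 := Nat.eq_of_beq_eq_true e1
  have e2 := Nat.eq_of_beq_eq_true e2
  have e3 := Nat.eq_of_beq_eq_true e3
  rw [show a3 = y from e1, show t3 = d from e2, show b3 = 3 - d - y from e3] at Lf
  have o2e : o2 - 3 + 3 = o2 := by omega
  simp only [o2e] at Lf
  have tot := (R.append Mr).append Lf
  have ea : 3 - d - x = y := by omega
  have eb : 3 - d - y = x := by omega
  refine ⟨y, x, ?_⟩
  simp only [ea, eb] at tot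
  simpa [lws] using tot

/-- case II : both neighbours are pairs of the same colour -/
theorem caseII (r2 r3 : Bool × ℕ) (a : ℕ) (M : List (Bool × ℕ)) (hM : ∀ l ∈ M, l.2 < 3)
    (h2 : r2.2 < 3) (h3 : r3.2 < 3) (ha : a < 3) :
    (∃ d < 3, d ≠ a ∧ GoodAt ((true, a) :: r2 :: r3 :: M ++ [(true, a)]) d 0) ∧
    (∀ d < 3, d ≠ a → GoodAt ((true, a) :: r2 :: r3 :: M ++ [(true, a)]) d 1) := by
  obtain ⟨k2, c2⟩ := r2
  obtain ⟨k3, c3⟩ := r3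
  have key : ∀ (d : Fin 3) (K : ℕ), (d : ℕ) ≠ a → (∀ o : Fin 2, r3chk k2 k3 a c2 c3 d 3 (o + 3) K = true) →
      GoodAt ((true, a) :: (k2, c2) :: (k3, c3) :: M ++ [(true, a)]) d K := by
    intro d K hda hK
    have : ∃ o : Fin 2, (if (lws M).length % 2 = 0 then (o : ℕ) + 3 else 7 - (o + 3)) = 3 := by
      by_cases h : (lws M).length % 2 = 0
      · exact ⟨0, by simp [h]⟩
      · exact ⟨1, by simp [h]⟩
    obtain ⟨o, ho⟩ := this
    have R := hK o
    obtain ⟨_, _, R⟩ := anyB_spec R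
    obtain ⟨_, _, R⟩ := anyB_spec R
    obtain ⟨a1, t1, b1, hf, R⟩ := rchk_sound R
    simp only [Bool.and_eq_true] at hf
    have hb1 := Nat.eq_of_beq_eq_true hf.2
    subst hb1
    obtain ⟨a2, t2, -, -, Mr⟩ := middle M hM a1 t1 (o + 3) (by omega)
    rw [ho] at Mr
    have l1 := letter_run (true, a) ha a2 t2 3 (Or.inl rfl)
    simp only [cond_true] at l1
    have hd := d.2
    have l2 : Run (7 - 3) a 3 [((d : ℕ), false)] 3 d (3 - d - a) 0 := by
      refine Run.cons _ _ _ _ _ _ _ _ _ _ _ (by omega) (by omega) (by omega) (by omega) (Run.nil _ _ _ _ ?_)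
      have : ∀ a d : Fin 3, d ≠ a → (0:ℤ) ≤ 0 - stc (7 - 3) a 3 d (3 - d - a) false := by decide
      exact this ⟨a, ha⟩ d (fun h => hda (congrArg Fin.val h))
    have tot := (R.append Mr).append (l1.append l2)
    refine ⟨3, 3 - d - a, ?_⟩
    have tot := tot.mono (K' := K) (by simp)
    simpa [lws] using tot
  have := right3 k2 k3 ⟨a, ha⟩ ⟨c2, h2⟩ ⟨c3, h3⟩
  refine ⟨?_, fun d hd hda => ?_⟩
  · obtain ⟨d, hd, h⟩ := this.1
    have hd' : (d : ℕ) ≠ a := fun h => hd (Fin.ext h)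
    exact ⟨d, d.2, hd', key d 0 hd' h⟩
  · exact key ⟨d, hd⟩ 1 hda (this.2 ⟨d, hd⟩ (fun h => hda (congrArg Fin.val h)))

/-- case III -/
theorem caseIII (k : Bool) (a : ℕ) (M : List (Bool × ℕ)) (hM : ∀ l ∈ M, l.2 < 3) (ha : a < 3)
    (hpar : (lws ((false, a) :: M ++ [(k, a)])).length % 2 = 0) (d : ℕ) (hd : d < 3) (hda : d ≠ a) :
    GoodAt ((false, a) :: M ++ [(k, a)]) d 0 := by
  refine ⟨3, 3 - d - a, ?_⟩
  have s1 : Run 3 d (3 - d - a) [(a, false)] (3 - d - a) a 4 0 := by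
    refine Run.cons _ _ _ _ _ _ _ _ _ _ _ (by omega) (by omega) (by omega) (by omega) (Run.nil _ _ _ _ ?_)
    have : ∀ a d : Fin 3, d ≠ a → (0:ℤ) ≤ 0 - stc 3 d (3 - d - a) a 4 false := by decide
    exact this ⟨a, ha⟩ ⟨d, hd⟩ (by simpa using hda)
  obtain ⟨a1, t1, h1, h2, h3⟩ := middle (M ++ [(k, a)]) (by
    intro l hl; simp at hl; rcases hl with hl | rfl; exact hM l hl; exact ha) (3 - d - a) a 4 (Or.inr rfl)
  have h2 := h2 (k, a) (by simp)
  have h1 := h1 (by simp)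
  have hl : ¬ (lws (M ++ [(k, a)])).length % 2 = 0 := by
    simp [lws_append, lws_cons, lws_nil, lw] at hpar ⊢
    omega
  rw [if_neg hl] at h3
  simp only at h2
  subst h2
  have s2 : Run a1 t1 3 [(d, false)] 3 d (3 - d - t1) 0 := by
    refine Run.cons _ _ _ _ _ _ _ _ _ _ _ (by omega) (by omega) (by omega) (by omega) (Run.nil _ _ _ _ ?_)
    have : ∀ a d : Fin 3, d ≠ a → ∀ o : Fin 2, (0:ℤ) ≤ 0 - stc (o + 3) a 3 d (3 - d - a) false := by decide
    have := this ⟨t1, ha⟩ ⟨d, hd⟩ (by simpa using hda) ⟨a1 - 3, by omega⟩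
    simpa [show a1 - 3 + 3 = a1 by omega] using this
  have tot := (s1.append h3).append s2
  simpa [lws, lw] using tot

/-- case III, second form -/
theorem caseIII' (k : Bool) (a : ℕ) (M : List (Bool × ℕ)) (hM : ∀ l ∈ M, l.2 < 3) (ha : a < 3)
    (hpar : (lws ((k, a) :: M ++ [(false, a)])).length % 2 = 0) (d : ℕ) (hd : d < 3) (hda : d ≠ a) :
    GoodAt ((k, a) :: M ++ [(false, a)]) d 0 := by
  refine ⟨3 - d - a, 3, ?_⟩
  have s1 : Run (3 - d - a) d 3 (lw (k, a)) (bif k then 4 else 3) a (bif k then 3 else 4) (-1) := by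
    have : ∀ a d : Fin 3, d ≠ a → (0:ℤ) ≤ -1 - stc (3 - d - a) d 3 a 4 false := by decide
    have t := this ⟨a, ha⟩ ⟨d, hd⟩ (by simpa using hda)
    cases k
    · show Run (3 - d - a) d 3 [(a, false)] 3 a 4 (-1)
      exact Run.cons _ _ _ _ _ _ _ _ _ _ _ (by omega) (by omega) (by omega) (by omega) (Run.nil _ _ _ _ t)
    · show Run (3 - d - a) d 3 [(a, false), (a, true)] 4 a 3 (-1)
      refine Run.cons _ _ _ _ 4 _ _ _ _ _ _ (by omega) (by omega) (by omega) (by omega) ?_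
      refine Run.cons _ _ _ _ _ _ _ _ _ _ _ (by omega) (by omega) (by omega) (by omega) (Run.nil _ _ _ _ ?_)
      have : stc 3 a 4 a 3 true = 0 := by simp [stc, badN_same]; rfl
      rw [this]
      simpa using t
  obtain ⟨a1, t1, -, -, h3⟩ := middle M hM (bif k then 4 else 3) a (bif k then 3 else 4) (by cases k <;> simp)
  have hl : (if (lws M).length % 2 = 0 then (bif k then 3 else 4) else 7 - (bif k then 3 else 4)) = 4 := by
    simp [lws_append, lws_cons, lws_nil, lw] at hpar
    cases k <;> simp at hpar ⊢ <;> omega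
  rw [hl] at h3
  have s2 : Run a1 t1 4 [(a, false), (d, false)] (3 - d - a) d 3 1 := by
    refine Run.first a1 (c := 3 - d - a) (by omega) (by omega) (by omega) (by omega) ?_
    refine Run.cons _ _ _ _ _ _ _ _ _ _ _ (by omega) (by omega) (by omega) (by omega) (Run.nil _ _ _ _ ?_)
    have : ∀ a d : Fin 3, d ≠ a → (0:ℤ) ≤ 1 - mixN 4 (3 - d - a) - stc 4 a (3 - d - a) d 3 false := by decide
    exact this ⟨a, ha⟩ ⟨d, hd⟩ (by simpa using hda)
  have tot := (s1.append h3).append s2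
  simpa [lws, lw] using tot

theorem lw_length (l : Bool × ℕ) : (lw l).length = bif l.1 then 2 else 1 := by
  obtain ⟨k, c⟩ := l; cases k <;> rfl

theorem letters_main (L : List (Bool × ℕ)) (hL : ∀ l ∈ L, l.2 < 3) (h2 : 2 ≤ L.length)
    (hpar : (lws L).length % 2 = 0) :
    (∃ g, ∀ d < 3, d ≠ g → GoodAt L d 0) ∧ (∀ d < 3, GoodAt L d 2) ∧
    (∀ d < 3, (∃ l ∈ L, l.2 ≠ d) → GoodAt L d 1) := by
  have mono : ∀ {L : List (Bool × ℕ)} {d : ℕ} {K K' : ℤ}, K ≤ K' → GoodAt L d K → GoodAt L d K' := by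
    rintro L d K K' h ⟨a, b, h'⟩
    exact ⟨a, b, h'.mono h⟩
  match L, hL, h2, hpar with
  | [l1, l2], hL, _, hpar =>
    obtain ⟨k1, a⟩ := l1
    obtain ⟨k2, b⟩ := l2
    have ha : a < 3 := hL (k1, a) (by simp)
    have hb : b < 3 := hL (k2, b) (by simp)
    have hk : k1 = k2 := by
      revert hpar; cases k1 <;> cases k2 <;> simp [lws, lw]
    subst hk
    obtain ⟨⟨g, hg⟩, hall⟩ := cls2 k1 ⟨a, ha⟩ ⟨b, hb⟩
    have key : ∀ d K : ℕ, cls (lw (k1, a) ++ lw (k1, b) ++ [(d, false)]) d K = true → GoodAt [(k1, a), (k1, b)] d K := by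
      intro d K h
      obtain ⟨x, y, h⟩ := cls_sound h
      exact ⟨x, y, by simpa [lws] using h⟩
    refine ⟨⟨g, fun d hd hdg => key d 0 (hg ⟨d, hd⟩ (fun h => hdg (by rw [← h])))⟩, fun d hd => key d 2 (hall ⟨d, hd⟩).1, ?_⟩
    intro d hd hex
    refine key d 1 ((hall ⟨d, hd⟩).2 ?_)
    rintro ⟨h1, h2⟩
    simp only [Fin.mk.injEq] at h1 h2
    subst h1; subst h2
    simp at hex
  | [l1, l2, l3], hL, _, hpar =>
    obtain ⟨k1, a⟩ := l1
    obtain ⟨k2, b⟩ := l2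
    obtain ⟨k3, c⟩ := l3
    have ha : a < 3 := hL (k1, a) (by simp)
    have hb : b < 3 := hL (k2, b) (by simp)
    have hc : c < 3 := hL (k3, c) (by simp)
    have hk : (Bool.xor (Bool.xor k1 k2) k3) = true := by
      revert hpar; cases k1 <;> cases k2 <;> cases k3 <;> simp [lws, lw]
    obtain ⟨⟨g, hg⟩, hall⟩ := cls3 k1 k2 k3 hk ⟨a, ha⟩ ⟨b, hb⟩ ⟨c, hc⟩
    have key : ∀ d K : ℕ, cls (lw (k1, a) ++ lw (k2, b) ++ lw (k3, c) ++ [(d, false)]) d K = true →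
        GoodAt [(k1, a), (k2, b), (k3, c)] d K := by
      intro d K h
      obtain ⟨x, y, h⟩ := cls_sound h
      exact ⟨x, y, by simpa [lws] using h⟩
    exact ⟨⟨g, fun d hd hdg => key d 0 (hg ⟨d, hd⟩ (fun h => hdg (by rw [← h])))⟩,
      fun d hd => mono (by norm_num) (key d 1 (hall ⟨d, hd⟩)), fun d hd _ => key d 1 (hall ⟨d, hd⟩)⟩
  | r1 :: r2 :: r3 :: r4 :: rest, hL, _, hpar =>
    suffices h : (∃ g, ∀ d < 3, d ≠ g → GoodAt (r1 :: r2 :: r3 :: r4 :: rest) d 0) ∧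
        (∀ d < 3, GoodAt (r1 :: r2 :: r3 :: r4 :: rest) d 1) from
      ⟨h.1, fun d hd => mono (by norm_num) (h.2 d hd), fun d hd _ => h.2 d hd⟩
    obtain ⟨M', l1, e1⟩ : ∃ M' l1, r4 :: rest = M' ++ [l1] :=
      ⟨_, _, (List.dropLast_append_getLast (List.cons_ne_nil r4 rest)).symm⟩
    obtain ⟨M, l2, e2⟩ : ∃ M l2, r3 :: M' = M ++ [l2] :=
      ⟨_, _, (List.dropLast_append_getLast (List.cons_ne_nil r3 M')).symm⟩
    have E1 : r1 :: r2 :: r3 :: r4 :: rest = r1 :: r2 :: r3 :: M' ++ [l1] := by simp [e1]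
    have E2 : r1 :: r2 :: r3 :: r4 :: rest = r1 :: r2 :: M ++ [l2, l1] := by
      rw [E1]; simp only [List.cons_append, ← List.cons_append, e2]; simp
    have c1 : r1.2 < 3 := hL r1 (by simp)
    have c2 : r2.2 < 3 := hL r2 (by simp)
    have c3 : r3.2 < 3 := hL r3 (by simp)
    have d1 : l1.2 < 3 := hL l1 (by rw [E1]; simp)
    have d2 : l2.2 < 3 := hL l2 (by rw [E2]; simp)
    have hM : ∀ l ∈ M, l.2 < 3 := fun l hl => hL l (by rw [E2]; simp [hl])
    have hM' : ∀ l ∈ M', l.2 < 3 := fun l hl => hL l (by rw [E1]; simp [hl])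
    have cI : ∀ d < 3, ∀ x < 3, ∀ y < 3, x ≠ y → x ≠ d → y ≠ d → x ≠ r1.2 → y ≠ l1.2 →
        GoodAt (r1 :: r2 :: r3 :: r4 :: rest) d 0 := by
      intro d hd x hx y hy q1 q2 q3 q4 q5
      rw [E2]
      exact caseI r1 r2 l2 l1 M hM c1 c2 d2 d1 d x y hd hx hy q1 q2 q3 q4 q5
    by_cases hne : r1.2 = l1.2
    · have gooda : GoodAt (r1 :: r2 :: r3 :: r4 :: rest) r1.2 0 := by
        have : ∀ a : Fin 3, ∃ x y : Fin 3, x ≠ y ∧ x ≠ a ∧ y ≠ a := by decide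
        obtain ⟨x, y, q1, q2, q3⟩ := this ⟨r1.2, c1⟩
        have q1' : (x : ℕ) ≠ y := fun h => q1 (Fin.ext h)
        have q2' : (x : ℕ) ≠ r1.2 := fun h => q2 (Fin.ext h)
        have q3' : (y : ℕ) ≠ r1.2 := fun h => q3 (Fin.ext h)
        exact cI r1.2 c1 x x.2 y y.2 q1' q2' q3' q2' (hne ▸ q3')
      obtain ⟨k, a⟩ := r1
      obtain ⟨k', a'⟩ := l1
      simp only at hne c1 d1 gooda
      subst hne
      suffices h : (∃ g, ∀ d < 3, d ≠ g → d ≠ a → GoodAt ((k, a) :: r2 :: r3 :: r4 :: rest) d 0) ∧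
        (∀ d < 3, d ≠ a → GoodAt ((k, a) :: r2 :: r3 :: r4 :: rest) d 1) by
        refine ⟨?_, fun d hd => ?_⟩
        · obtain ⟨g, hg⟩ := h.1
          refine ⟨g, fun d hd hdg => ?_⟩
          by_cases hda : d = a
          · subst hda; exact gooda
          · exact hg d hd hdg hda
        · by_cases hda : d = a
          · subst hda; exact mono (by norm_num) gooda
          · exact h.2 d hd hda
      have hMM : ∀ l ∈ r2 :: r3 :: M', l.2 < 3 := by
        intro l hl; exact hL l (by rw [E1]; simp at hl ⊢; tauto)
      rw [E1] at hpar ⊢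
      cases k
      · have := caseIII k' a (r2 :: r3 :: M') hMM c1 hpar
        exact ⟨⟨0, fun d hd _ hda => this d hd hda⟩, fun d hd hda => mono (by norm_num) (this d hd hda)⟩
      · cases k'
        · have := caseIII' true a (r2 :: r3 :: M') hMM c1 hpar
          exact ⟨⟨0, fun d hd _ hda => this d hd hda⟩, fun d hd hda => mono (by norm_num) (this d hd hda)⟩
        · have := caseII r2 r3 a M' hM' c2 c3 c1
          refine ⟨?_, this.2⟩
          obtain ⟨d, hd, hda, hg⟩ := this.1
          refine ⟨3 - d - a, fun d' hd' h1 h2 => ?_⟩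
          have : d' = d := by omega
          rw [this]; exact hg
    · have all : ∀ d < 3, GoodAt (r1 :: r2 :: r3 :: r4 :: rest) d 0 := by
        intro d hd
        have : ∀ d a b : Fin 3, a ≠ b → ∃ x y : Fin 3, x ≠ y ∧ x ≠ d ∧ y ≠ d ∧ x ≠ a ∧ y ≠ b := by decide
        obtain ⟨x, y, q1, q2, q3, q4, q5⟩ := this ⟨d, hd⟩ ⟨r1.2, c1⟩ ⟨l1.2, d1⟩ (by simpa using hne)
        exact cI d hd x x.2 y y.2 (fun h => q1 (Fin.ext h)) (fun h => q2 (Fin.ext h)) (fun h => q3 (Fin.ext h))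
          (fun h => q4 (Fin.ext h)) (fun h => q5 (Fin.ext h))
      exact ⟨⟨3, fun d hd _ => all d hd⟩, fun d hd => mono (by norm_num) (all d hd)⟩

theorem parse (th : ℕ → ℕ) (P : ℕ → Bool) (hPP : ∀ j, P j = true → P (j + 1) = false)
    (k : ℕ) : ∀ s, (P s = false ∨ k = 0) → P (s + k) = false →
    (∀ j, s < j → j < s + k → P j = true → th j = th (j + 1)) →
    ∃ L : List (Bool × ℕ), lws L = (List.range k).map (fun j => (th (s + j + 1), P (s + j))) := by
  induction k using Nat.strong_induction_on with
  | _ k ih =>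
    intro s h1 h2 h3
    obtain rfl | hk := Nat.eq_zero_or_pos k
    · exact ⟨[], rfl⟩
    have hs : P s = false := by rcases h1 with h | h; exact h; omega
    by_cases hp : P (s + 1) = true
    · have hk1 : k ≠ 1 := by rintro rfl; simp [hp] at h2
      obtain ⟨k, rfl⟩ : ∃ k', k = k' + 2 := ⟨k - 2, by omega⟩
      obtain ⟨L, hL⟩ := ih k (by omega) (s + 2) (Or.inl (hPP _ hp)) (by rw [← h2]; congr 1; omega)
        (fun j a b c => h3 j (by omega) (by omega) c)
      refine ⟨(true, th (s + 1)) :: L, ?_⟩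
      rw [lws_cons, hL, List.range_succ_eq_map, List.range_succ_eq_map]
      have := h3 (s + 1) (by omega) (by omega) hp
      simp only [lw, cond_true, List.map_cons, List.map_map, List.cons_append, List.nil_append]
      congr 1
      · simp [hs]
      congr 1
      · simp [hp, this]
      apply List.map_congr_left
      intro j _
      simp only [Function.comp]
      rw [show s + 2 + j = s + (j + 1 + 1) by omega]
    · obtain ⟨k, rfl⟩ : ∃ k', k = k' + 1 := ⟨k - 1, by omega⟩
      obtain ⟨L, hL⟩ := ih k (by omega) (s + 1) (Or.inl (by simpa using hp)) (by rw [← h2]; congr 1; omega)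
        (fun j a b c => h3 j (by omega) (by omega) c)
      refine ⟨(false, th (s + 1)) :: L, ?_⟩
      rw [lws_cons, hL, List.range_succ_eq_map]
      simp only [lw, cond_false, List.map_cons, List.map_map, List.cons_append, List.nil_append]
      congr 1
      · simp [hs]
      apply List.map_congr_left
      intro j _
      simp only [Function.comp]
      rw [show s + 1 + j = s + (j + 1) by omega]

theorem lws_len (L : List (Bool × ℕ)) : (lws L).length ≤ 2 * L.length := by
  induction L with
  | nil => simp [lws]
  | cons l L ih =>
    rw [lws_cons, List.length_append, lw_length, List.length_cons]
    cases l.1 <;> simp <;> omega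

theorem mem_lws {L : List (Bool × ℕ)} {l : Bool × ℕ} (h : l ∈ L) : (l.2, false) ∈ lws L := by
  rw [lws, List.mem_flatMap]
  refine ⟨l, h, ?_⟩
  obtain ⟨k, c⟩ := l; cases k <;> simp [lw]

theorem of_mem_lws {L : List (Bool × ℕ)} {t : ℕ} {f : Bool} (h : (t, f) ∈ lws L) : ∃ l ∈ L, l.2 = t := by
  rw [lws, List.mem_flatMap] at h
  obtain ⟨l, h1, h2⟩ := h
  refine ⟨l, h1, ?_⟩
  obtain ⟨k, c⟩ := l
  cases k <;> simp [lw] at h2 <;> aesop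

/-- the number of unflagged edges -/
def bcount (n : ℕ) (P : ℕ → Bool) : ℕ := ∑ j ∈ Finset.range n, (bif P j then 0 else 1)

theorem word_base (n : ℕ) (hn : n % 2 = 1) (h3 : 3 ≤ n) (th : ℕ → ℕ) (hth : ∀ j, th (j + n) = th j)
    (hlt : ∀ j, th j < 3) (P : ℕ → Bool) (hPP : ∀ j, P j = true → P (j + 1) = false)
    (hPt : ∀ j, P j = true → th j = th (j + 1)) (h0 : P 0 = false) (h1 : P (n - 1) = false)
    (hT : n = 3 → P 1 = false) :
    (∃ g, ∀ th' : ℕ → ℕ, (∀ j, th' (j + n) = th' j) → (∀ j, ¬ (n ∣ j) → th' j = th j) → th' 0 < 3 → th' 0 ≠ g →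
      Cyc n th' (bcount n P)) ∧ Cyc n th (bcount n P + 2) ∧
    ((∃ j, th j ≠ th 0) → Cyc n th (bcount n P + 1)) := by
  obtain ⟨L, hL⟩ := parse th P hPP (n - 1) 0 (Or.inl h0) (by simpa using h1) (fun j _ _ h => hPt j h)
  simp only [zero_add] at hL
  have hlen : (lws L).length = n - 1 := by rw [hL]; simp
  have hL3 : ∀ l ∈ L, l.2 < 3 := by
    intro l hl
    have := mem_lws hl
    rw [hL, List.mem_map] at this
    obtain ⟨j, _, hj⟩ := this
    have := congrArg Prod.fst hj
    simp only at this
    rw [← this]; exact hlt _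
  have hL2 : 2 ≤ L.length := by
    have h := lws_len L
    by_contra hc
    have hn3 : n = 3 := by omega
    have hL1 : L.length = 1 := by omega
    obtain ⟨l, rfl⟩ := List.length_eq_one_iff.1 hL1
    obtain ⟨k, c⟩ := l
    have := hT hn3
    subst hn3
    simp [lws, List.range_succ] at hL
    cases k <;> simp [lw] at hL
    simp [this] at hL
  obtain ⟨⟨g, hg⟩, H2, H1⟩ := letters_main L hL3 hL2 (by omega)
  have key : ∀ th' : ℕ → ℕ, (∀ j, th' (j + n) = th' j) → (∀ j, ¬ (n ∣ j) → th' j = th j) → ∀ K : ℕ,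
      GoodAt L (th' 0) K → Cyc n th' (bcount n P + K) := by
    intro th' hp' hs K ⟨a, b, hr⟩
    refine Run.toCyc (a := a) (b := b) (by omega) hp' ?_
    convert hr using 1
    rw [hL]
    conv_lhs => rw [show n = (n - 1) + 1 by omega]
    rw [List.range_succ, List.map_append]
    congr 1
    · apply List.map_congr_left
      intro j hj
      rw [List.mem_range] at hj
      rw [hs (j + 1) (fun h => by have := Nat.le_of_dvd (by omega) h; omega)]
    · simp only [List.map_cons, List.map_nil]
      rw [show n - 1 + 1 = 0 + n by omega, hp', h1]
  refine ⟨⟨g, fun th' a b c d => ?_⟩, key th hth (fun _ _ => rfl) 2 (H2 _ (hlt 0)), ?_⟩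
  · have := key th' a b 0 (hg _ c d); simpa using this
  · rintro ⟨j, hj⟩
    refine key th hth (fun _ _ => rfl) 1 (H1 _ (hlt 0) ?_)
    have hj' : th (j % n) = th j := by
      conv_rhs => rw [← Nat.mod_add_div j n]
      rw [per_mul hth]
    have hj0 : j % n ≠ 0 := by intro h; rw [h] at hj'; exact hj hj'.symm
    have hjn := Nat.mod_lt j (show 0 < n by omega)
    have : (th (j % n), P (j % n - 1)) ∈ lws L := by
      rw [hL, List.mem_map]
      exact ⟨j % n - 1, by rw [List.mem_range]; omega, by rw [show j % n - 1 + 1 = j % n by omega]⟩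
    obtain ⟨l, hl, e⟩ := of_mem_lws this
    exact ⟨l, hl, by rw [e, hj']; exact hj⟩

theorem bcount_rot (n : ℕ) (P : ℕ → Bool) (hP : ∀ j, P (j + n) = P j) (p : ℕ) :
    bcount n (fun j => P (j + p)) = bcount n P := by
  unfold bcount
  exact sum_periodic_shift n (fun j => (bif P j then 0 else 1)) (fun j => by simp [hP]) p

theorem word_at (n : ℕ) (hn : n % 2 = 1) (h3 : 3 ≤ n) (th : ℕ → ℕ) (hth : ∀ j, th (j + n) = th j)
    (hlt : ∀ j, th j < 3) (P : ℕ → Bool) (hP : ∀ j, P (j + n) = P j)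
    (hPP : ∀ j, P j = true → P (j + 1) = false)
    (hPt : ∀ j, P j = true → th j = th (j + 1)) (p : ℕ) (h0 : P p = false) (h1 : P (p + (n - 1)) = false)
    (hT : n = 3 → ∀ j, P j = false) :
    (∃ g, ∀ th' : ℕ → ℕ, (∀ j, th' (j + n) = th' j) → (∀ j, ¬ (j ≡ p [MOD n]) → th' j = th j) → th' p < 3 → th' p ≠ g →
      Cyc n th' (bcount n P)) ∧ Cyc n th (bcount n P + 2) ∧
    ((∃ j, th j ≠ th p) → Cyc n th (bcount n P + 1)) := by
  have := word_base n hn h3 (fun j => th (j + p)) (fun j => by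
      show th (j + n + p) = th (j + p); rw [← hth (j + p)]; congr 1; omega) (fun j => hlt _)
    (fun j => P (j + p)) (fun j h => by show P (j + 1 + p) = _; rw [← hPP (j + p) h]; congr 1; omega)
    (fun j h => by show th _ = th _; rw [hPt (j + p) h]; congr 1; omega) (by simpa using h0)
    (by show P _ = _; rw [← h1]; congr 1; omega) (fun h => hT h _)
  rw [bcount_rot n P hP] at this
  obtain ⟨⟨g, hg⟩, h2, h4⟩ := this
  refine ⟨⟨g, fun th' a b c d => ?_⟩, Cyc.rot (by omega) hth p h2, ?_⟩
  · refine Cyc.rot (by omega) a p (hg _ (fun j => ?_) (fun j hj => ?_) (by simpa using c) (by simpa using d))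
    · show th' _ = th' _; rw [← a (j + p)]; congr 1; omega
    · refine b _ (fun h => hj ?_)
      have h' : j + p ≡ 0 + p [MOD n] := by simpa using h
      exact (Nat.modEq_zero_iff_dvd).1 (Nat.ModEq.add_right_cancel' p h')
  · rintro ⟨j, hj⟩
    refine Cyc.rot (by omega) hth p (h4 ?_)
    refine ⟨j + (n * p - p), ?_⟩
    have : p ≤ n * p := Nat.le_mul_of_pos_left p (by omega)
    simp only [zero_add]
    rwa [show j + (n * p - p) + p = j + n * p by omega, per_mul hth]

theorem exists_gap (n : ℕ) (hn : n % 2 = 1) (P : ℕ → Bool) (hP : ∀ j, P (j + n) = P j)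
    (hPP : ∀ j, P j = true → P (j + 1) = false) : ∃ p, P p = false ∧ P (p + (n - 1)) = false := by
  by_contra hc
  push Not at hc
  have h1 : ∀ j, P (j + 1) = !P j := by
    intro j
    cases h : P j
    · have := hc (j + 1)
      rw [show j + 1 + (n - 1) = j + n by omega, hP, h] at this
      cases h' : P (j + 1)
      · exact absurd rfl (this h')
      · rfl
    · simpa using hPP j h
  have h2 : ∀ k, P (2 * k) = P 0 := by
    intro k
    induction k with
    | zero => rfl
    | succ k ih => rw [show 2 * (k + 1) = 2 * k + 1 + 1 by ring, h1, h1, ih]; simp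
  have h3 := hP 0
  rw [show 0 + n = 2 * (n / 2) + 1 by omega, h1, h2] at h3
  cases h : P 0 <;> simp [h] at h3

def discount (n : ℕ) (P : ℕ → Bool) (th : ℕ → ℕ) : ℕ :=
  ∑ j ∈ Finset.range n, (bif P j && !(Nat.beq (th j) (th (j + 1))) then 1 else 0)

theorem word_dis (n : ℕ) (hn : n % 2 = 1) (h3 : 3 ≤ n) (th : ℕ → ℕ) (hth : ∀ j, th (j + n) = th j)
    (hlt : ∀ j, th j < 3) (P : ℕ → Bool) (hP : ∀ j, P (j + n) = P j)
    (hPP : ∀ j, P j = true → P (j + 1) = false)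
    (hT : n = 3 → ∀ j, P j = false) (β : ℕ) (hb1 : 2 * discount n P th + bcount n P ≤ β)
    (hb2 : bcount n P + 2 ≤ β) : Cyc n th β := by
  set P' : ℕ → Bool := fun j => P j && Nat.beq (th j) (th (j + 1)) with hP'
  have hth1 : ∀ j, th (j + n + 1) = th (j + 1) := fun j => by rw [← hth (j + 1)]; congr 1; omega
  have a1 : ∀ j, P' (j + n) = P' j := fun j => by simp only [hP', hP, hth, hth1]
  have a2 : ∀ j, P' j = true → P' (j + 1) = false := by
    intro j h
    simp only [hP', Bool.and_eq_true] at h ⊢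
    rw [hPP j h.1]; simp
  have a3 : ∀ j, P' j = true → th j = th (j + 1) := by
    intro j h
    simp only [hP', Bool.and_eq_true] at h
    exact Nat.eq_of_beq_eq_true h.2
  obtain ⟨p, p1, p2⟩ := exists_gap n hn P' a1 a2
  obtain ⟨-, h2, h1⟩ := word_at n hn h3 th hth hlt P' a1 a2 a3 p p1 p2 (fun h j => by simp [hP', hT h])
  have hb : bcount n P' = bcount n P + discount n P th := by
    unfold bcount discount
    rw [← Finset.sum_add_distrib]
    refine Finset.sum_congr rfl fun j _ => ?_
    simp only [hP']
    cases P j <;> cases Nat.beq (th j) (th (j + 1)) <;> rfl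
  rcases Nat.eq_zero_or_pos (discount n P th) with h0 | h0
  · exact h2.mono (by omega)
  · by_cases hm : ∃ j, th j ≠ th p
    · exact (h1 hm).mono (by omega)
    · push Not at hm
      exfalso
      have : discount n P th = 0 := by
        unfold discount
        refine Finset.sum_eq_zero fun j _ => ?_
        rw [hm j, hm (j + 1)]
        simp
      omega

theorem tri_any (th : ℕ → ℕ) (hth : ∀ j, th (j + 3) = th j) (hlt : ∀ j, th j < 3) : Cyc 3 th 5 :=
  word_dis 3 rfl le_rfl th hth hlt (fun _ => false) (by simp) (by simp) (by simp) 5 (by simp [discount, bcount]) (by simp [bcount])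

theorem tri_dec : ∀ a b c : Fin 3, ¬ (a = b ∧ b = c) → ∃ x y z : Fin 5,
    (x : ℕ) ≠ a ∧ (y : ℕ) ≠ a ∧ (y : ℕ) ≠ b ∧ (z : ℕ) ≠ b ∧ (z : ℕ) ≠ c ∧ (x : ℕ) ≠ c ∧ x ≠ y ∧ y ≠ z ∧ x ≠ z ∧
    badN x a b z + mixN y z + (badN y b c x + mixN z x) + (badN z c a y + mixN x y) ≤ 3 := by
  decide +kernel

theorem tri_nonmono (th : ℕ → ℕ) (hth : ∀ j, th (j + 3) = th j) (hlt : ∀ j, th j < 3)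
    (h : ¬ (th 0 = th 1 ∧ th 1 = th 2)) : Cyc 3 th 3 := by
  obtain ⟨x, y, z, h1, h2, h3, h4, h5, h6, h7, h8, h9, h10⟩ := tri_dec ⟨th 0, hlt 0⟩ ⟨th 1, hlt 1⟩ ⟨th 2, hlt 2⟩ (by simpa using h)
  simp only at h1 h2 h3 h4 h5 h6 h10
  have hm : ∀ j, th j = th (j % 3) := fun j => by
    conv_lhs => rw [← Nat.mod_add_div j 3]
    rw [per_mul hth]
  set X : ℕ → ℕ := fun j => if j % 3 = 0 then (x : ℕ) else if j % 3 = 1 then y else z with hX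
  have h7' : (x : ℕ) ≠ y := fun h => h7 (Fin.ext h)
  have h8' : (y : ℕ) ≠ z := fun h => h8 (Fin.ext h)
  have h9' : (x : ℕ) ≠ z := fun h => h9 (Fin.ext h)
  refine ⟨X, fun j => by simp [hX], fun j => ?_, ?_⟩
  · have hj := Nat.mod_lt j (show 0 < 3 by omega)
    rw [hm j]
    have hx := x.2
    have hy := y.2
    have hz := z.2
    simp only [hX]
    rcases (by omega : j % 3 = 0 ∨ j % 3 = 1 ∨ j % 3 = 2) with e | e | e
    · have e' : (j + 1) % 3 = 1 := by omega
      simp [e, e']; exact ⟨h1, h2, h7'⟩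
    · have e' : (j + 1) % 3 = 2 := by omega
      simp [e, e']; exact ⟨h3, h4, h8'⟩
    · have e' : (j + 1) % 3 = 0 := by omega
      simp [e, e']; exact ⟨h5, h6, h9'.symm⟩
  · simp only [Finset.sum_range_succ, Finset.sum_range_zero]
    have e3 : th 3 = th 0 := hth 0
    simp only [hX, Nat.reduceAdd, Nat.reduceMod, zero_add, e3]
    simpa using h10

theorem even_word (n : ℕ) (hn : n % 2 = 0) (h3 : 3 ≤ n) (th : ℕ → ℕ)
    (hlt : ∀ j, th j < 3) (P : ℕ → Bool) (β : ℕ) (hb : bcount n P + discount n P th ≤ β) : Cyc n th β := by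
  refine ⟨fun j => 3 + j % 2, fun j => by simp only; omega, fun j => ?_, le_trans ?_ hb⟩
  · have := hlt j
    simp only
    omega
  · unfold bcount discount
    rw [← Finset.sum_add_distrib]
    refine Finset.sum_le_sum fun j _ => ?_
    have h1 : 3 + (j + 2) % 2 = 3 + j % 2 := by omega
    have m : mixN (3 + (j + 1) % 2) (3 + (j + 2) % 2) = 0 := by
      unfold mixN
      have a : Nat.ble 3 (3 + (j + 1) % 2) = true := by rw [Nat.ble_eq]; omega
      have b : Nat.ble 3 (3 + (j + 2) % 2) = true := by rw [Nat.ble_eq]; omega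
      rw [a, b]; rfl
    rw [m]
    have e1 : Nat.beq (3 + j % 2) (3 + (j + 2) % 2) = true := by rw [Nat.beq_eq]; exact h1.symm
    have e2 : Nat.beq (th j) (3 + (j + 2) % 2) = false := by
      rw [Bool.eq_false_iff]
      intro h
      have := Nat.eq_of_beq_eq_true h
      have := hlt j
      omega
    unfold badN
    rw [e1, e2]
    cases P j <;> cases Nat.beq (th j) (th (j + 1)) <;> simp

theorem discount_zero {n : ℕ} {P : ℕ → Bool} {th : ℕ → ℕ} (h : ∀ j, P j = true → th j = th (j + 1)) :
    discount n P th = 0 := by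
  unfold discount
  refine Finset.sum_eq_zero fun j _ => ?_
  cases hp : P j
  · rfl
  · rw [h j hp]; simp

theorem word_one (n : ℕ) (h3 : 3 ≤ n) (th : ℕ → ℕ) (hth : ∀ j, th (j + n) = th j)
    (hlt : ∀ j, th j < 3) (P : ℕ → Bool) (hP : ∀ j, P (j + n) = P j)
    (hPP : ∀ j, P j = true → P (j + 1) = false)
    (hPt : ∀ j, P j = true → th j = th (j + 1)) (p : ℕ) (h0 : P p = false) (h1 : P (p + (n - 1)) = false)
    (hT : n = 3 → ∀ j, P j = false) :
    ∃ g, ∀ th' : ℕ → ℕ, (∀ j, th' (j + n) = th' j) → (∀ j, ¬ (j ≡ p [MOD n]) → th' j = th j) → th' p < 3 → th' p ≠ g →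
      Cyc n th' (bcount n P) := by
  rcases Nat.mod_two_eq_zero_or_one n with hn | hn
  · refine ⟨0, fun th' a b d e => even_word n hn h3 th' ?_ P _ ?_⟩
    · intro j
      by_cases hj : j ≡ p [MOD n]
      · have : ∀ j, th' j = th' (j % n) := fun j => by
          conv_lhs => rw [← Nat.mod_add_div j n]
          rw [per_mul a]
        rw [this, hj, ← this]; exact d
      · rw [b j hj]; exact hlt j
    · have pm : ∀ j, P j = P (j % n) := fun j => by
          conv_lhs => rw [← Nat.mod_add_div j n]
          rw [per_mul hP]
      rw [discount_zero, add_zero]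
      intro j hj
      rw [b, b, hPt j hj]
      · intro h
        have : j + 1 + (n - 1) ≡ p + (n - 1) [MOD n] := h.add_right _
        rw [pm, ← this, ← pm, show j + 1 + (n - 1) = j + n by omega, hP, hj] at h1
        cases h1
      · intro h
        rw [pm, ← h, ← pm, hj] at h0; cases h0
  · exact (word_at n hn h3 th hth hlt P hP hPP hPt p h0 h1 hT).1

theorem word_all (n : ℕ) (h3 : 3 ≤ n) (th : ℕ → ℕ) (hth : ∀ j, th (j + n) = th j)
    (hlt : ∀ j, th j < 3) (P : ℕ → Bool) (hP : ∀ j, P (j + n) = P j)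
    (hPP : ∀ j, P j = true → P (j + 1) = false)
    (hT : n = 3 → ∀ j, P j = false) (β : ℕ) (hb1 : 2 * discount n P th + bcount n P ≤ β)
    (hb2 : bcount n P + 2 ≤ β) : Cyc n th β := by
  rcases Nat.mod_two_eq_zero_or_one n with hn | hn
  · exact even_word n hn h3 th hlt P β (by omega)
  · exact word_dis n hn h3 th hth hlt P hP hPP hT β hb1 hb2

theorem discount_le {n : ℕ} {P : ℕ → Bool} {th th' : ℕ → ℕ} (hP : ∀ j, P (j + n) = P j)
    (hPP : ∀ j, P j = true → P (j + 1) = false) (q : ℕ)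
    (h : ∀ j, P j = true → ¬ j ≡ q [MOD n] → ¬ (j + 1) ≡ q [MOD n] → th' j = th j ∧ th' (j + 1) = th (j + 1)) :
    discount n P th' ≤ discount n P th + 1 := by
  have pm : ∀ j, P j = P (j % n) := fun j => by
    conv_lhs => rw [← Nat.mod_add_div j n]
    rw [per_mul hP]
  have key : ((Finset.range n).filter fun j => P j = true ∧ (j ≡ q [MOD n] ∨ (j + 1) ≡ q [MOD n])).card ≤ 1 := by
    rw [Finset.card_le_one]
    intro j hj k hk
    simp only [Finset.mem_filter, Finset.mem_range] at hj hk
    have lt : j ≡ k [MOD n] → j = k := fun h => Nat.ModEq.eq_of_lt_of_lt h hj.1 hk.1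
    rcases hj.2.2 with a | a <;> rcases hk.2.2 with b | b
    · exact lt (a.trans b.symm)
    · exfalso
      have := hPP k hk.2.1
      rw [pm, b.trans a.symm, ← pm, hj.2.1] at this; cases this
    · exfalso
      have := hPP j hj.2.1
      rw [pm, a.trans b.symm, ← pm, hk.2.1] at this; cases this
    · exact lt (Nat.ModEq.add_right_cancel' 1 (a.trans b.symm))
  rw [Finset.card_filter] at key
  refine le_trans ?_ (Nat.add_le_add_left key _)
  unfold discount
  rw [← Finset.sum_add_distrib]
  refine Finset.sum_le_sum fun j _ => ?_
  cases hp : P j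
  · simp
  · by_cases h1 : j ≡ q [MOD n]
    · cases Nat.beq (th' j) (th' (j + 1)) <;> simp [h1]
    · by_cases h2 : (j + 1) ≡ q [MOD n]
      · cases Nat.beq (th' j) (th' (j + 1)) <;> simp [h2]
      · obtain ⟨e1, e2⟩ := h j hp h1 h2
        rw [e1, e2]; simp

section PetersenSec
open scoped Classical

theorem cut_odd {V : Type*} [Fintype V] (G : SimpleGraph V) (hcubic : ∀ v : V, G.degree v = 3)
    (hb : ∀ e ∈ G.edgeSet, ¬ G.IsBridge e) (S : Finset V) (hS : S.card % 2 = 1) :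
    3 ≤ (Finset.univ.filter fun p : V × V => p.1 ∈ S ∧ p.2 ∉ S ∧ G.Adj p.1 p.2).card := by
  set D := (Finset.univ.filter fun p : V × V => p.1 ∈ S ∧ p.2 ∉ S ∧ G.Adj p.1 p.2) with hD
  have e1 : D.card = ∑ a ∈ S, ((G.neighborFinset a).filter (· ∉ S)).card := by
    rw [← Finset.card_sigma]
    refine Finset.card_nbij' (fun p => ⟨p.1, p.2⟩) (fun p => (p.1, p.2)) ?_ ?_ ?_ ?_
    · rintro ⟨a, b⟩; simp [hD]; tauto
    · rintro ⟨a, b⟩; simp [hD]; tauto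
    · rintro ⟨a, b⟩; simp
    · rintro ⟨a, b⟩; simp
  have e2 : ∑ a ∈ S, ((G.neighborFinset a).filter (· ∈ S)).card = ∑ a : S, (G.induce (S : Set V)).degree a := by
    rw [← Finset.sum_coe_sort S]
    refine Finset.sum_congr rfl fun a _ => ?_
    rw [← SimpleGraph.card_neighborFinset_eq_degree]
    symm
    refine Finset.card_bij (fun x _ => x.1) ?_ ?_ ?_
    · intro x hx; simp at hx ⊢; exact hx
    · intro x _ y _ h; exact Subtype.ext h
    · intro x hx; simp at hx ⊢; exact ⟨hx.1, hx.2⟩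
  have e3 := (G.induce (S : Set V)).sum_degrees_eq_twice_card_edges
  have e4 : D.card + ∑ a ∈ S, ((G.neighborFinset a).filter (· ∈ S)).card = 3 * S.card := by
    rw [e1, ← Finset.sum_add_distrib, Finset.sum_congr rfl (g := fun _ => 3)]
    · simp; ring
    · intro a _
      rw [← hcubic a, ← SimpleGraph.card_neighborFinset_eq_degree, Nat.add_comm]
      exact Finset.card_filter_add_card_filter_not (s := G.neighborFinset a) (· ∈ S)
  have e5 : D.card % 2 = 1 := by
    rw [e2] at e4
    have e3' : ∑ a : S, (G.induce (S : Set V)).degree a = 2 * (G.induce (S : Set V)).edgeFinset.card := by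
      convert e3
    omega
  by_contra hlt
  have h1 : D.card = 1 := by omega
  obtain ⟨⟨a, b⟩, hab⟩ := Finset.card_eq_one.1 h1
  have hm : ∀ x y, x ∈ S → y ∉ S → G.Adj x y → x = a ∧ y = b := by
    intro x y hx hy h
    have : (x, y) ∈ D := by simp [hD, hx, hy, h]
    rw [hab] at this
    simpa using this
  have hmem : (a, b) ∈ D := by rw [hab]; simp
  simp [hD] at hmem
  refine hb s(a, b) hmem.2.2 ?_
  rw [SimpleGraph.isBridge_iff]
  have key : ∀ x y, (G \ SimpleGraph.fromEdgeSet {s(a, b)}).Reachable x y → x ∈ S → y ∈ S := by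
    rintro x y ⟨w⟩
    induction w with
    | nil => exact id
    | cons h w ih =>
      intro hx
      apply ih
      by_contra hc
      rw [SimpleGraph.sdiff_adj] at h
      obtain ⟨rfl, rfl⟩ := hm _ _ hx hc h.1
      simp at h
      exact h.1.ne h.2
  first
  | exact fun h => hmem.2.1 (key a b h hmem.1)
  | exact ⟨hmem.2.2, fun h => hmem.2.1 (key a b h hmem.1)⟩

theorem petersen {V : Type*} [Fintype V] (G : SimpleGraph V) (hcubic : ∀ v : V, G.degree v = 3)
    (hb : ∀ e ∈ G.edgeSet, ¬ G.IsBridge e) : ∃ M : G.Subgraph, M.IsPerfectMatching := by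
  rw [SimpleGraph.tutte]
  intro u hu
  rw [SimpleGraph.IsTutteViolator] at hu
  set H := ((⊤ : G.Subgraph).deleteVerts u).coe with hH
  have hsupp : ∀ c : H.ConnectedComponent, ∃ S : Finset V, S.card = c.supp.ncard ∧
      ∀ a, a ∈ S ↔ ∃ h : a ∈ ((⊤ : G.Subgraph).deleteVerts u).verts, H.connectedComponentMk ⟨a, h⟩ = c := by
    intro c
    refine ⟨(Subtype.val '' c.supp).toFinset, ?_, ?_⟩
    · rw [← Set.ncard_eq_toFinset_card', Set.ncard_image_of_injective _ Subtype.val_injective]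
    · intro a; simp [SimpleGraph.ConnectedComponent.mem_supp_iff]
  choose S hS1 hS2 using hsupp
  set D : H.ConnectedComponent → Finset (V × V) := fun c =>
    (Finset.univ.filter fun p : V × V => p.1 ∈ S c ∧ p.2 ∉ S c ∧ G.Adj p.1 p.2) with hD
  set O := H.oddComponents.toFinset with hO
  have hOc : H.oddComponents.ncard = O.card := by rw [hO, ← Set.ncard_eq_toFinset_card']
  have h3 : ∀ c ∈ O, 3 ≤ (D c).card := by
    intro c hc
    refine cut_odd G hcubic hb (S c) ?_
    rw [hS1]
    simp [hO, SimpleGraph.oddComponents] at hc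
    exact Nat.odd_iff.1 hc
  have hdis : ∀ c ∈ O, ∀ c' ∈ O, c ≠ c' → Disjoint (D c) (D c') := by
    intro c _ c' _ hne
    rw [Finset.disjoint_left]
    rintro ⟨a, b⟩ h1 h2
    simp [hD] at h1 h2
    obtain ⟨x, hx⟩ := (hS2 _ _).1 h1.1
    obtain ⟨y, hy⟩ := (hS2 _ _).1 h2.1
    exact hne (hx.symm.trans hy)
  have hcard := Finset.card_biUnion hdis
  have hsub : O.biUnion D ⊆ (u.toFinset.sigma fun b => G.neighborFinset b).image (fun p => (p.2, p.1)) := by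
    intro p hp
    rw [Finset.mem_biUnion] at hp
    obtain ⟨c, _, hp⟩ := hp
    obtain ⟨a, b⟩ := p
    simp [hD] at hp
    rw [Finset.mem_image]
    refine ⟨⟨b, a⟩, ?_, rfl⟩
    simp only [Finset.mem_sigma, SimpleGraph.mem_neighborFinset, Set.mem_toFinset]
    refine ⟨?_, hp.2.2.symm⟩
    by_contra hbu
    apply hp.2.1
    obtain ⟨x, hx⟩ := (hS2 _ _).1 hp.1
    have hbv : b ∈ ((⊤ : G.Subgraph).deleteVerts u).verts := by simp [hbu]
    refine (hS2 _ _).2 ⟨hbv, ?_⟩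
    rw [← hx]
    refine (SimpleGraph.ConnectedComponent.sound (SimpleGraph.Adj.reachable ?_)).symm
    rw [hH]
    simp at x
    simp [hp.2.2, hbu, x]
  have h4 := (Finset.card_le_card hsub).trans Finset.card_image_le
  have h6 : ∑ a ∈ u.toFinset, (G.neighborFinset a).card = ∑ a ∈ u.toFinset, 3 :=
    Finset.sum_congr rfl (fun b _ => by rw [SimpleGraph.card_neighborFinset_eq_degree, hcubic])
  rw [hcard, Finset.card_sigma, h6] at h4
  have h5 := Finset.sum_le_sum h3
  simp at h4 h5
  rw [hOc, Set.ncard_eq_toFinset_card'] at hu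
  simp at hu
  omega

theorem petersen' {V : Type*} [Fintype V] (G : SimpleGraph V) (hcubic : ∀ v : V, G.degree v = 3)
    (hb : ∀ e ∈ G.edgeSet, ¬ G.IsBridge e) : ∃ M : Finset (Sym2 V), (∀ e ∈ M, e ∈ G.edgeSet) ∧
      ∀ v : V, (M.filter (fun e => v ∈ e)).card = 1 := by
  obtain ⟨M, hM⟩ := petersen G hcubic hb
  refine ⟨M.edgeSet.toFinset, fun e he => M.edgeSet_subset (by simpa using he), fun v => ?_⟩
  rw [SimpleGraph.Subgraph.isPerfectMatching_iff] at hM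
  obtain ⟨w, hw, hu⟩ := hM v
  rw [Finset.card_eq_one]
  refine ⟨s(v, w), ?_⟩
  ext e
  induction e with
  | _ a b =>
    simp only [Finset.mem_filter, Set.mem_toFinset, SimpleGraph.Subgraph.mem_edgeSet, Sym2.mem_iff, Finset.mem_singleton]
    constructor
    · rintro ⟨h, rfl | rfl⟩
      · rw [hu _ h]
      · rw [hu _ h.symm, Sym2.eq_swap]
    · intro h
      rw [Sym2.eq_iff] at h
      rcases h with ⟨rfl, rfl⟩ | ⟨rfl, rfl⟩
      · exact ⟨hw, Or.inl rfl⟩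
      · exact ⟨hw.symm, Or.inr rfl⟩

end PetersenSec

/-- both or one common -/
def Nrm (S S' : Finset (Fin 5)) : Prop := (S ∪ S').card = 3 ∨ (S ∪ S').card = 5
def Pur (S : Finset (Fin 5)) : Prop := S.card = 3 ∧ (3 ∈ S ↔ 4 ∈ S)
instance (S S' : Finset (Fin 5)) : Decidable (Nrm S S') := inferInstanceAs (Decidable (_ ∨ _))
instance (S : Finset (Fin 5)) : Decidable (Pur S) := inferInstanceAs (Decidable (_ ∧ _))

theorem pur_cases : ∀ S : Finset (Fin 5), Pur S → S = {0, 1, 2} ∨ ∃ t : Fin 5, t.val < 3 ∧ S = {t, 3, 4} := by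
  decide +kernel

theorem nrm_of_pur : ∀ S S' : Finset (Fin 5), Pur S → Pur S' → ∀ t : Fin 5, t.val < 3 → t ∈ S → t ∈ S' → Nrm S S' := by
  have key : ∀ t t' s : Fin 5, t.val < 3 → t'.val < 3 → s.val < 3 →
     Nrm {0, 1, 2} {0, 1, 2} ∧ Nrm {0, 1, 2} {t, 3, 4} ∧ Nrm {t, 3, 4} {0, 1, 2} ∧ (s ∈ ({t, 3, 4} : Finset (Fin 5)) → s ∈ ({t', 3, 4} : Finset (Fin 5)) → Nrm {t, 3, 4} {t', 3, 4}) := by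
    decide +kernel
  intro S S' h1 h2 s hs hs1 hs2
  rcases pur_cases S h1 with rfl | ⟨t, ht, rfl⟩ <;> rcases pur_cases S' h2 with rfl | ⟨t', ht', rfl⟩
  · exact (key 0 0 0 (by decide) (by decide) (by decide)).1
  · exact (key t' 0 0 ht' (by decide) (by decide)).2.1
  · exact (key t 0 0 ht (by decide) (by decide)).2.2.1
  · exact (key t t' s ht ht' hs).2.2.2 hs1 hs2

theorem nrm_of_bad : ∀ a t m t' c : Fin 5, a ≠ t → a ≠ m → t ≠ m → m ≠ t' → m ≠ c → t' ≠ c →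
    badN a t t' c = 0 → Nrm {a, m, t} {m, c, t'} := by
  have : ∀ a t m t' c : Fin 5, (decide (a ≠ t) && decide (a ≠ m) && decide (t ≠ m) && decide (m ≠ t') && decide (m ≠ c) && decide (t' ≠ c) &&
    decide (badN a t t' c = 0)) = true → Nrm {a, m, t} {m, c, t'} := by decide +kernel
  intro a t m t' c h1 h2 h3 h4 h5 h6 h7
  exact this a t m t' c (by simp [h1, h2, h3, h4, h5, h6, h7])

theorem pur_of_mix : ∀ a b t : Fin 5, a ≠ b → a ≠ t → b ≠ t → t.val < 3 → mixN a b = 0 → Pur {a, b, t} := by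
  have : ∀ a b t : Fin 5, (decide (a ≠ b) && decide (a ≠ t) && decide (b ≠ t) && decide (t.val < 3) &&
    decide (mixN a b = 0)) = true → Pur {a, b, t} := by decide +kernel
  intro a t m h1 h2 h3 h4 h5
  exact this a t m (by simp [h1, h2, h3, h4, h5])

structure CS {V ι : Type*} (G : SimpleGraph V) (n : ι → ℕ) (v : ι → ℕ → V) (nb : V → V) (P : ι → ℕ → Bool) : Prop where
  hn : ∀ i, 3 ≤ n i
  inj : ∀ {i j i' j'}, v i j = v i' j' → i = i' ∧ j ≡ j' [MOD n i]
  per : ∀ i j, v i (j + n i) = v i j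
  adj : ∀ i j w, G.Adj (v i (j+1)) w ↔ w = v i j ∨ w = v i (j+2) ∨ w = nb (v i (j+1))
  nb1 : ∀ i j, nb (v i (j+1)) ≠ v i j
  nb2 : ∀ i j, nb (v i (j+1)) ≠ v i (j+2)
  Pper : ∀ i j, P i (j + n i) = P i j
  PP : ∀ i j, P i j = true → P i (j+1) = false
  E3 : ∀ i j, P i j = false → P i (j+1) = false → ∃ i' j', nb (v i (j+1)) = v i' (j'+1) ∧ P i' j' = false ∧ P i' (j'+1) = false

open scoped Classical in
noncomputable def Sc {V : Type*} (G : SimpleGraph V) (c : Sym2 V → Fin 5) (u : V) : Finset (Fin 5) :=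
  Finset.univ.filter fun k => ∃ w, G.Adj u w ∧ c s(u, w) = k

theorem mem_Sc {V : Type*} {G : SimpleGraph V} {c : Sym2 V → Fin 5} {u : V} {k : Fin 5} :
    k ∈ Sc G c u ↔ ∃ w, G.Adj u w ∧ c s(u, w) = k := by simp [Sc]

def VO {V ι : Type*} (v : ι → ℕ → V) (live : Finset ι) (u : V) : Prop := ∃ i ∈ live, ∃ j, u = v i j

def thc {V ι : Type*} (v : ι → ℕ → V) (nb : V → V) (c : Sym2 V → Fin 5) (i : ι) (j : ℕ) : ℕ :=
  (c s(v i j, nb (v i j))).val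

theorem per_modEq {α : Type*} {n : ℕ} {f : ℕ → α} (hf : ∀ j, f (j + n) = f j) {j k : ℕ} (h : j ≡ k [MOD n]) :
    f j = f k := by
  have : ∀ j, f j = f (j % n) := fun j => by
    conv_lhs => rw [← Nat.mod_add_div j n]
    rw [per_mul hf]
  rw [this j, this k, h]

namespace CS
variable {V ι : Type*} {G : SimpleGraph V} {n : ι → ℕ} {v : ι → ℕ → V} {nb : V → V} {P : ι → ℕ → Bool}

theorem v_modEq (cs : CS G n v nb P) {i : ι} {j k : ℕ} (h : j ≡ k [MOD n i]) : v i j = v i k :=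
  per_modEq (cs.per i) h

theorem v_eq_iff (cs : CS G n v nb P) {i : ι} {j k : ℕ} : v i j = v i k ↔ j ≡ k [MOD n i] :=
  ⟨fun h => (cs.inj h).2, cs.v_modEq⟩

/-- every index is a successor -/
theorem succ (cs : CS G n v nb P) (i : ι) (j : ℕ) : ∃ j', v i j = v i (j' + 1) ∧ j' + 1 = j + n i :=
  ⟨j + n i - 1, by rw [← cs.per i j]; congr 1; have := cs.hn i; omega, by have := cs.hn i; omega⟩

theorem adj_next (cs : CS G n v nb P) (i : ι) (j : ℕ) : G.Adj (v i j) (v i (j + 1)) :=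
  ((cs.adj i j _).2 (Or.inl rfl)).symm

theorem adj_nb (cs : CS G n v nb P) (i : ι) (j : ℕ) : G.Adj (v i j) (nb (v i j)) := by
  obtain ⟨j', h, -⟩ := cs.succ i j
  rw [h]
  exact (cs.adj i j' _).2 (Or.inr (Or.inr rfl))

theorem modEq_lt {m d : ℕ} {a b : ℕ} (h : a ≡ b [MOD m]) (hd : b = a + d) (h0 : 0 < d) (hm : d < m) : False := by
  subst hd
  have h2 : a + 0 ≡ a + d [MOD m] := by simpa using h
  have := Nat.ModEq.add_left_cancel' a h2
  have := (Nat.modEq_zero_iff_dvd.1 this.symm)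
  exact absurd (Nat.le_of_dvd h0 this) (by omega)

theorem ne1 (cs : CS G n v nb P) (i : ι) (j : ℕ) : v i j ≠ v i (j + 1) := (cs.adj_next i j).ne
theorem ne2 (cs : CS G n v nb P) (i : ι) (j : ℕ) : v i j ≠ v i (j + 2) := fun h =>
  modEq_lt (cs.inj h).2 rfl (by omega) (by have := cs.hn i; omega)

theorem nb_ne_next (cs : CS G n v nb P) (i : ι) (j : ℕ) : nb (v i j) ≠ v i (j + 1) := by
  obtain ⟨j', h, h'⟩ := cs.succ i j
  have := cs.nb2 i j'
  rw [← h] at this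
  rwa [show j' + 2 = j + 1 + n i by omega, cs.per] at this

theorem nb_nb (cs : CS G n v nb P) {i j i' j' : _} (h : nb (v i j) = v i' j') : nb (v i' j') = v i j := by
  obtain ⟨k, hk, hk'⟩ := cs.succ i' j'
  have ha := (cs.adj_nb i j).symm
  rw [h, hk, cs.adj] at ha
  rcases ha with ha | ha | ha
  · obtain ⟨rfl, hm⟩ := cs.inj ha
    exfalso
    apply cs.nb_ne_next i j
    rw [h, hk]
    exact cs.v_modEq (hm.symm.add_right 1)
  · obtain ⟨rfl, hm⟩ := cs.inj ha
    exfalso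
    obtain ⟨l, hl, hl'⟩ := cs.succ i j
    have h1 := cs.nb1 i l
    rw [← hl, h, hk] at h1
    apply h1
    apply cs.v_modEq
    have : k + 1 + 1 ≡ l + 1 [MOD n i] := by
      rw [hl']
      refine hm.symm.trans ?_
      exact (by simp [Nat.ModEq] : j ≡ j + n i [MOD n i])
    exact Nat.ModEq.add_right_cancel' 1 this
  · rw [hk, ← ha]

theorem edge_inj (cs : CS G n v nb P) {i j i' j' : _} (h : s(v i j, v i (j+1)) = s(v i' j', v i' (j'+1))) :
    i = i' ∧ j ≡ j' [MOD n i] := by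
  rw [Sym2.eq_iff] at h
  rcases h with ⟨h, -⟩ | ⟨h1, h2⟩
  · exact cs.inj h
  · exfalso
    obtain ⟨rfl, hm⟩ := cs.inj h1
    obtain ⟨-, hm2⟩ := cs.inj h2
    have : j' ≡ j' + 2 [MOD n i] := by
      refine hm2.symm.trans ?_
      exact hm.add_right 1
    exact modEq_lt this rfl (by omega) (by have := cs.hn i; omega)

theorem nb_ne_edge (cs : CS G n v nb P) {i j i' j' : _} (h : s(v i j, nb (v i j)) = s(v i' j', v i' (j'+1))) : False := by
  rw [Sym2.eq_iff] at h
  rcases h with ⟨h, h'⟩ | ⟨h1, h2⟩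
  · obtain ⟨rfl, hm⟩ := cs.inj h
    apply cs.nb_ne_next i j
    rw [h']; exact cs.v_modEq (hm.symm.add_right 1)
  · obtain ⟨rfl, hm⟩ := cs.inj h1
    apply cs.nb1 i j'
    rw [← h1, h2]

theorem thc_per (cs : CS G n v nb P) (c : Sym2 V → Fin 5) (i : ι) (j : ℕ) :
    thc v nb c i (j + n i) = thc v nb c i j := by
  unfold thc; rw [cs.per]

theorem Sc_eq (cs : CS G n v nb P) (c : Sym2 V → Fin 5) (i : ι) (j : ℕ) :
    Sc G c (v i (j+1)) = {c s(v i j, v i (j+1)), c s(v i (j+1), v i (j+2)), c s(v i (j+1), nb (v i (j+1)))} := by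
  ext k
  simp only [mem_Sc, cs.adj, Finset.mem_insert, Finset.mem_singleton]
  constructor
  · rintro ⟨w, rfl | rfl | rfl, rfl⟩
    · left; rw [Sym2.eq_swap]
    · right; left; rfl
    · right; right; rfl
  · rintro (rfl | rfl | rfl)
    · exact ⟨_, Or.inl rfl, by rw [Sym2.eq_swap]⟩
    · exact ⟨_, Or.inr (Or.inl rfl), rfl⟩
    · exact ⟨_, Or.inr (Or.inr rfl), rfl⟩

open scoped Classical in
theorem final (cs : CS G n v nb P) (c : Sym2 V → Fin 5) (live : Finset ι) (β : ι → ℕ) (A : Finset (Sym2 V)) (k : ℕ)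
    (f1 : ∀ u, ¬ VO v live u → (Sc G c u).card = 3)
    (f2 : ∀ i ∈ live, ∀ j, (c s(v i j, nb (v i j))).val < 3)
    (f3 : ∀ u w, G.Adj u w → ¬ VO v live u → ¬ VO v live w → s(u,w) ∉ A → Nrm (Sc G c u) (Sc G c w))
    (f4 : ∀ u w, G.Adj u w → VO v live u → ¬ VO v live w → s(u,w) ∉ A → Pur (Sc G c w))
    (f5 : ∀ i ∈ live, Cyc (n i) (thc v nb c i) (β i))
    (f6 : A.card + ∑ i ∈ live, β i ≤ k) :
    ∃ c' : Sym2 V → Fin 5, (∀ u, (Sc G c' u).card = 3) ∧ ∃ B : Finset (Sym2 V), B.card ≤ k ∧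
      ∀ u w, G.Adj u w → s(u,w) ∉ B → Nrm (Sc G c' u) (Sc G c' w) := by
  choose! x hx1 hx2 hx3 using f5
  set c' : Sym2 V → Fin 5 := fun e => if h : ∃ i j, i ∈ live ∧ e = s(v i j, v i (j+1)) then
    Fin.ofNat 5 (x h.choose (h.choose_spec.choose + 1)) else c e with hc'
  have cO : ∀ i ∈ live, ∀ j, (c' s(v i j, v i (j+1))).val = x i (j+1) := by
    intro i hi j
    have h : ∃ i' j', i' ∈ live ∧ s(v i j, v i (j+1)) = s(v i' j', v i' (j'+1)) := ⟨i, j, hi, rfl⟩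
    have hs := h.choose_spec.choose_spec
    obtain ⟨e1, e2⟩ := cs.edge_inj hs.2
    simp only [hc']
    rw [dif_pos h]
    have : x h.choose (h.choose_spec.choose + 1) = x i (j + 1) := by
      have gen : ∀ i' j', i = i' → j ≡ j' [MOD n i] → x i' (j'+1) = x i (j+1) := by
        rintro _ j' rfl h
        exact (per_modEq (hx1 i hi) (h.add_right 1)).symm
      exact gen _ _ e1 e2
    rw [this]
    exact Nat.mod_eq_of_lt (hx2 i hi (j+1)).1
  have cN : ∀ u w, ¬ VO v live u → c' s(u, w) = c s(u, w) := by
    intro u w hu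
    simp only [hc']
    rw [dif_neg]
    rintro ⟨i, j, hi, h⟩
    rw [Sym2.eq_iff] at h
    rcases h with ⟨h, -⟩ | ⟨h, -⟩
    · exact hu ⟨i, hi, j, h⟩
    · exact hu ⟨i, hi, j+1, h⟩
  have cT : ∀ i j, c' s(v i j, nb (v i j)) = c s(v i j, nb (v i j)) := by
    intro i j
    simp only [hc']
    rw [dif_neg]
    rintro ⟨i', j', hi, h⟩
    exact cs.nb_ne_edge h
  have sN : ∀ u, ¬ VO v live u → Sc G c' u = Sc G c u := by
    intro u hu
    ext k
    simp only [mem_Sc, cN u _ hu]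
  have sO : ∀ i ∈ live, ∀ j, ∃ a b t : Fin 5, a.val = x i (j+1) ∧ b.val = x i (j+2) ∧ t.val = thc v nb c i (j+1) ∧
      a ≠ b ∧ a ≠ t ∧ b ≠ t ∧ t.val < 3 ∧ Sc G c' (v i (j+1)) = {a, b, t} := by
    intro i hi j
    have h := hx2 i hi (j+1)
    refine ⟨c' s(v i j, v i (j+1)), c' s(v i (j+1), v i (j+2)), c' s(v i (j+1), nb (v i (j+1))), cO i hi j, cO i hi (j+1),
      by rw [cT]; rfl, ?_, ?_, ?_, by rw [cT]; exact f2 i hi _, cs.Sc_eq c' i j⟩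
    · intro h'; apply h.2.2.2; rw [← cO i hi j, ← cO i hi (j+1), h']
    · intro h'; apply h.2.1; rw [← cO i hi j, h', cT]; rfl
    · intro h'; apply h.2.2.1; rw [← cO i hi (j+1)]; rw [show j + 1 + 1 = j + 2 by rfl, h', cT]; rfl
  refine ⟨c', ?_, ?_⟩
  · intro u
    by_cases hu : VO v live u
    · obtain ⟨i, hi, j, rfl⟩ := hu
      obtain ⟨j', hj', -⟩ := cs.succ i j
      rw [hj']
      obtain ⟨a, b, t, -, -, -, h1, h2, h3, -, h4⟩ := sO i hi j'
      rw [h4, Finset.card_eq_three]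
      exact ⟨a, b, t, h1, h2, h3, rfl⟩
    · rw [sN u hu]; exact f1 u hu
  · set Bi : ι → Finset (Sym2 V) := fun i =>
      ((Finset.range (n i)).filter fun j => badN (x i j) (thc v nb c i j) (thc v nb c i (j+1)) (x i (j+2)) ≠ 0).image
        (fun j => s(v i j, v i (j+1))) ∪
      ((Finset.range (n i)).filter fun j => mixN (x i (j+1)) (x i (j+2)) ≠ 0).image
        (fun j => s(v i (j+1), nb (v i (j+1)))) with hBi
    have hBc : ∀ i ∈ live, (Bi i).card ≤ β i := by
      intro i hi
      refine (Finset.card_union_le _ _).trans ((add_le_add Finset.card_image_le Finset.card_image_le).trans ?_)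
      refine le_trans ?_ (hx3 i hi)
      rw [Finset.sum_add_distrib, Finset.card_filter, Finset.card_filter]
      refine add_le_add (Finset.sum_le_sum fun j _ => ?_) (Finset.sum_le_sum fun j _ => ?_)
      · split_ifs <;> omega
      · split_ifs <;> omega
    refine ⟨A ∪ live.biUnion Bi, ?_, ?_⟩
    · refine (Finset.card_union_le _ _).trans (le_trans ?_ f6)
      refine add_le_add le_rfl ((Finset.card_biUnion_le).trans (Finset.sum_le_sum hBc))
    · have xm : ∀ i ∈ live, ∀ j k, x i (j % n i + k) = x i (j + k) := fun i hi j k =>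
        per_modEq (hx1 i hi) ((Nat.mod_modEq j (n i)).add_right k)
      have tm : ∀ i j k, thc v nb c i (j % n i + k) = thc v nb c i (j + k) := fun i j k =>
        per_modEq (cs.thc_per c i) ((Nat.mod_modEq j (n i)).add_right k)
      have vm : ∀ i j k, v i (j % n i + k) = v i (j + k) := fun i j k =>
        per_modEq (cs.per i) ((Nat.mod_modEq j (n i)).add_right k)
      have npos : ∀ i, 0 < n i := fun i => by have := cs.hn i; omega
      have memB : ∀ i ∈ live, ∀ e, e ∈ Bi i → e ∈ A ∪ live.biUnion Bi := fun i hi e he =>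
        Finset.mem_union_right _ (Finset.mem_biUnion.2 ⟨i, hi, he⟩)
      have key1 : ∀ i ∈ live, ∀ j, s(v i j, v i (j+1)) ∉ A ∪ live.biUnion Bi →
          badN (x i j) (thc v nb c i j) (thc v nb c i (j+1)) (x i (j+2)) = 0 := by
        intro i hi j h
        by_contra hb
        apply h
        apply memB i hi
        apply Finset.mem_union_left
        rw [Finset.mem_image]
        refine ⟨j % n i, ?_, ?_⟩
        · rw [Finset.mem_filter, Finset.mem_range]
          refine ⟨Nat.mod_lt _ (npos i), ?_⟩
          have a1 := xm i hi j 0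
          have a2 := tm i j 0
          simp only [add_zero] at a1 a2
          rw [a1, a2, tm, xm i hi]; exact hb
        · have a1 := vm i j 0
          simp only [add_zero] at a1
          rw [vm, a1]
      have key2 : ∀ i ∈ live, ∀ j, s(v i (j+1), nb (v i (j+1))) ∉ A ∪ live.biUnion Bi →
          mixN (x i (j+1)) (x i (j+2)) = 0 := by
        intro i hi j h
        by_contra hb
        apply h
        apply memB i hi
        apply Finset.mem_union_right
        rw [Finset.mem_image]
        refine ⟨j % n i, ?_, ?_⟩
        · rw [Finset.mem_filter, Finset.mem_range]
          exact ⟨Nat.mod_lt _ (npos i), by rw [xm i hi, xm i hi]; exact hb⟩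
        · rw [vm]
      have purO : ∀ i ∈ live, ∀ j, s(v i (j+1), nb (v i (j+1))) ∉ A ∪ live.biUnion Bi → Pur (Sc G c' (v i (j+1))) := by
        intro i hi j h
        have := key2 i hi j h
        obtain ⟨a, b, t, e1, e2, -, h1, h2, h3, h4, h5⟩ := sO i hi j
        rw [h5]
        exact pur_of_mix a b t h1 h2 h3 h4 (by rw [e1, e2]; exact this)
      have nO : ∀ i ∈ live, ∀ j, s(v i j, v i (j+1)) ∉ A ∪ live.biUnion Bi →
          Nrm (Sc G c' (v i j)) (Sc G c' (v i (j+1))) := by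
        intro i hi j h
        have hk := key1 i hi j h
        obtain ⟨j', hj', e⟩ := cs.succ i j
        obtain ⟨a, m, t, a1, a2, a3, a4, a5, a6, -, a7⟩ := sO i hi j'
        obtain ⟨m', b, t', b1, b2, b3, b4, b5, b6, -, b7⟩ := sO i hi j
        rw [hj', a7, b7]
        have xe : x i (j'+1) = x i j := by rw [e, hx1 i hi]
        have xe2 : x i (j'+2) = x i (j+1) := by rw [show j' + 2 = j + 1 + n i by omega, hx1 i hi]
        have te : thc v nb c i (j'+1) = thc v nb c i j := by rw [e, cs.thc_per]
        have hmm : m' = m := Fin.ext (by rw [a2, b1, xe2])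
        subst hmm
        refine nrm_of_bad a t m' t' b a5 a4 a6.symm b5 b4 b6.symm ?_
        rw [a1, a3, b2, b3, xe, te]; exact hk
      have sw : ∀ S S', Nrm S S' → Nrm S' S := fun S S' h => by unfold Nrm at *; rwa [Finset.union_comm]
      have half : ∀ u w, G.Adj u w → VO v live u → s(u, w) ∉ A ∪ live.biUnion Bi → Nrm (Sc G c' u) (Sc G c' w) := by
        intro u w huw hu h
        obtain ⟨i, hi, j, rfl⟩ := hu
        obtain ⟨j', hj', -⟩ := cs.succ i j
        rw [hj'] at huw h ⊢
        rcases (cs.adj i j' w).1 huw with rfl | rfl | rfl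
        · exact sw _ _ (nO i hi j' (by rwa [Sym2.eq_swap]))
        · exact nO i hi (j'+1) h
        · have p1 := purO i hi j' h
          have p2 : Pur (Sc G c' (nb (v i (j'+1)))) := by
            by_cases hw : VO v live (nb (v i (j'+1)))
            · obtain ⟨i2, hi2, j2, hw⟩ := hw
              obtain ⟨j3, hj3, -⟩ := cs.succ i2 j2
              have hw' := hw.trans hj3
              rw [hw']
              refine purO i2 hi2 j3 ?_
              rwa [cs.nb_nb hw', ← hw', Sym2.eq_swap]
            · rw [sN _ hw]
              exact f4 _ _ huw ⟨i, hi, _, rfl⟩ hw (fun hA => h (Finset.mem_union_left _ hA))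
          refine nrm_of_pur _ _ p1 p2 (c' s(v i (j'+1), nb (v i (j'+1)))) ?_ (mem_Sc.2 ⟨_, huw, rfl⟩)
            (mem_Sc.2 ⟨_, huw.symm, by rw [Sym2.eq_swap]⟩)
          rw [cT]; exact f2 i hi _
      intro u w huw h
      by_cases hu : VO v live u
      · exact half u w huw hu h
      · by_cases hw : VO v live w
        · exact sw _ _ (half w u huw.symm hw (by rwa [Sym2.eq_swap]))
        · rw [sN u hu, sN w hw]
          exact f3 u w huw hu hw (fun hA => h (Finset.mem_union_left _ hA))

end CS

/-- uniqueness of the other end of a path component -/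
theorem path_end {V : Type*} (K : SimpleGraph V)
    (h2 : ∀ u w1 w2 w3, K.Adj u w1 → K.Adj u w2 → K.Adj u w3 → w1 = w2 ∨ w1 = w3 ∨ w2 = w3)
    (y p q : V) (hy : ∀ w w', K.Adj y w → K.Adj y w' → w = w')
    (hp : ∀ w w', K.Adj p w → K.Adj p w' → w = w') (hq : ∀ w w', K.Adj q w → K.Adj q w' → w = w')
    (py : p ≠ y) (qy : q ≠ y) (rp : K.Reachable y p) (rq : K.Reachable y q) : p = q := by
  classical
  have main : ∀ (p q : V) (a : K.Walk y p) (b : K.Walk y q), a.IsPath → b.IsPath → a.length ≤ b.length →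
      p ≠ y → (∀ w w', K.Adj p w → K.Adj p w' → w = w') → p = q := by
    intro p q a b ha hb hl py hp
    have coin : ∀ k, k ≤ a.length → a.getVert k = b.getVert k ∧ (k + 1 ≤ a.length → a.getVert (k+1) = b.getVert (k+1)) := by
      intro k
      induction k with
      | zero =>
        intro _
        refine ⟨by simp, fun h => ?_⟩
        have e1 := a.adj_getVert_succ (i := 0) (by omega)
        have e2 := b.adj_getVert_succ (i := 0) (by omega)
        rw [SimpleGraph.Walk.getVert_zero] at e1 e2
        exact hy _ _ e1 e2
      | succ k ih =>
        intro hk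
        obtain ⟨i1, i2⟩ := ih (by omega)
        have i3 := i2 hk
        refine ⟨i3, fun h => ?_⟩
        have e0 := (a.adj_getVert_succ (i := k) (by omega)).symm
        have e1 := a.adj_getVert_succ (i := k + 1) (by omega)
        have e2 := b.adj_getVert_succ (i := k + 1) (by omega)
        rw [← i3] at e2
        rcases h2 _ _ _ _ e0 e1 e2 with h | h | h
        · have := ha.getVert_injOn (by simp; omega) (by simp; omega) h
          omega
        · rw [i1] at h
          have := hb.getVert_injOn (by simp; omega) (by simp; omega) h
          omega
        · exact h
    have hlen : a.length ≠ 0 := by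
      intro h
      apply py
      have := a.getVert_length
      rw [h, SimpleGraph.Walk.getVert_zero] at this
      exact this.symm
    have hpb : b.getVert a.length = p := by
      rw [← (coin _ le_rfl).1, a.getVert_length]
    by_cases hlt : a.length = b.length
    · rw [← hpb, hlt, b.getVert_length]
    · exfalso
      have e1 := b.adj_getVert_succ (i := a.length) (by omega)
      have e0 := (b.adj_getVert_succ (i := a.length - 1) (by omega)).symm
      rw [show a.length - 1 + 1 = a.length by omega] at e0
      rw [hpb] at e0 e1
      have := hb.getVert_injOn (by simp; omega) (by simp; omega) (hp _ _ e0 e1)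
      omega
  obtain ⟨a, ha⟩ := rp.exists_isPath
  obtain ⟨b, hb⟩ := rq.exists_isPath
  rcases le_total a.length b.length with h | h
  · exact main p q a b ha hb h py hp
  · exact (main q p b a hb ha h qy hq).symm

/-- the local setting of a kill -/
structure KH {V ι : Type*} (G : SimpleGraph V) (v : ι → ℕ → V) (nb : V → V) (live : Finset ι) (c : Sym2 V → Fin 5)
    (x y z w : V) : Prop where
  ax : ∀ u, G.Adj x u ↔ u = y ∨ u = z ∨ u = w
  ay : ∀ u, G.Adj y u ↔ u = x ∨ u = z ∨ u = nb y
  az : ∀ u, G.Adj z u ↔ u = x ∨ u = y ∨ u = nb z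
  vx : VO v live x
  vy : VO v live y
  vz : VO v live z
  vw : VO v live w
  nbx : nb x = w
  nbw : nb w = x
  xy : x ≠ y
  xz : x ≠ z
  yz : y ≠ z
  wx : w ≠ x
  wy : w ≠ y
  wz : w ≠ z
  nyx : nb y ≠ x
  nyz : nb y ≠ z
  nzx : nb z ≠ x
  nzy : nb z ≠ y
  nyw : nb y ≠ w
  nzw : nb z ≠ w
  vo : ∀ u, VO v live u → G.Adj u (nb u)
  vnb : ∀ u, VO v live u → VO v live (nb u) → nb (nb u) = u
  vadj : ∀ u w', VO v live u → ¬ VO v live w' → G.Adj u w' → w' = nb u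
  deg : ∀ u, ¬ VO v live u → Pur (Sc G c u)
  inj : ∀ u, ¬ VO v live u → ∀ w1 w2, G.Adj u w1 → G.Adj u w2 → c s(u, w1) = c s(u, w2) → w1 = w2
  th : ∀ u, VO v live u → (c s(u, nb u)).val < 3

def KG {V ι : Type*} (G : SimpleGraph V) (v : ι → ℕ → V) (nb : V → V) (live : Finset ι) (c : Sym2 V → Fin 5)
    (s a : Fin 5) : SimpleGraph V where
  Adj u w := G.Adj u w ∧ (c s(u, w) = s ∨ c s(u, w) = a) ∧ (VO v live u → w = nb u) ∧ (VO v live w → u = nb w)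
  symm := ⟨fun u w h => ⟨h.1.symm, by rw [Sym2.eq_swap]; exact h.2.1, h.2.2.2, h.2.2.1⟩⟩
  loopless := ⟨fun u h => h.1.ne rfl⟩

open scoped Classical in
noncomputable def kc {V : Type*} (c : Sym2 V → Fin 5) (R : V → Prop) (s a : Fin 5) (σ : Fin 5 → Fin 5) (x y z w : V)
    (cxy cxz cyz ce : Fin 5) : Sym2 V → Fin 5 := fun e =>
  if e = s(x, y) then cxy else if e = s(x, z) then cxz else if e = s(y, z) then cyz else if e = s(x, w) then ce else
    if (c e = s ∨ c e = a) ∧ ∃ u ∈ e, R u then σ (c e) else c e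

namespace KH
variable {V ι : Type*} {G : SimpleGraph V} {v : ι → ℕ → V} {nb : V → V} {live : Finset ι} {c : Sym2 V → Fin 5}
  {x y z w : V} {s a : Fin 5}

def R (G : SimpleGraph V) (v : ι → ℕ → V) (nb : V → V) (live : Finset ι) (c : Sym2 V → Fin 5) (s a : Fin 5) (y u : V) : Prop :=
  (KG G v nb live c s a).Reachable y u

theorem K_of_nonVO (h : KH G v nb live c x y z w) {u w' : V} (hu : ¬ VO v live u) (ha : G.Adj u w')
    (hc : c s(u, w') = s ∨ c s(u, w') = a) : (KG G v nb live c s a).Adj u w' :=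
  ⟨ha, hc, fun h' => absurd h' hu, fun h' => h.vadj _ _ h' hu ha.symm⟩

theorem K_third (h : KH G v nb live c x y z w) {u : V} (hu : VO v live u)
    (hc : c s(u, nb u) = s ∨ c s(u, nb u) = a) : (KG G v nb live c s a).Adj u (nb u) :=
  ⟨h.vo u hu, hc, fun _ => rfl, fun h' => (h.vnb u hu h').symm⟩

theorem R_adj {u w' : V} (hR : R G v nb live c s a y u) (h : (KG G v nb live c s a).Adj u w') : R G v nb live c s a y w' :=
  SimpleGraph.Reachable.trans hR h.reachable

theorem R_iff {u w' : V} (h : (KG G v nb live c s a).Adj u w') : R G v nb live c s a y u ↔ R G v nb live c s a y w' :=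
  ⟨fun hR => R_adj hR h, fun hR => R_adj hR h.symm⟩

theorem R_self : R G v nb live c s a y y := SimpleGraph.Reachable.refl _

theorem K_small (hu : VO v live u) : ∀ w w', (KG G v nb live c s a).Adj u w → (KG G v nb live c s a).Adj u w' → w = w' :=
  fun _ _ h1 h2 => (h1.2.2.1 hu).trans (h2.2.2.1 hu).symm

theorem K_small' (h : KH G v nb live c x y z w) (hs : s.val < 3) (ha : a.val < 3) {u : V} (hu : ¬ VO v live u)
    (hS : Sc G c u ≠ {0, 1, 2}) :
    ∀ w w', (KG G v nb live c s a).Adj u w → (KG G v nb live c s a).Adj u w' → w = w' := by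
  intro w1 w2 h1 h2
  rcases pur_cases _ (h.deg u hu) with h' | ⟨t, ht, h'⟩
  · exact absurd h' hS
  · apply h.inj u hu _ _ h1.1 h2.1
    have key : ∀ w, (KG G v nb live c s a).Adj u w → c s(u, w) = t := by
      intro w hw
      have m : c s(u, w) ∈ Sc G c u := mem_Sc.2 ⟨w, hw.1, rfl⟩
      rw [h'] at m
      simp only [Finset.mem_insert, Finset.mem_singleton] at m
      have lt : (c s(u, w)).val < 3 := by rcases hw.2.1 with e | e <;> rw [e] <;> assumption
      rcases m with m | m | m
      · exact m
      · rw [m] at lt; exact absurd lt (by decide)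
      · rw [m] at lt; exact absurd lt (by decide)
    rw [key _ h1, key _ h2]

theorem K_two (h : KH G v nb live c x y z w) : ∀ u w1 w2 w3, (KG G v nb live c s a).Adj u w1 → (KG G v nb live c s a).Adj u w2 →
    (KG G v nb live c s a).Adj u w3 → w1 = w2 ∨ w1 = w3 ∨ w2 = w3 := by
  intro u w1 w2 w3 h1 h2 h3
  by_cases hu : VO v live u
  · exact Or.inl (K_small hu _ _ h1 h2)
  · rcases h1.2.1 with e1 | e1 <;> rcases h2.2.1 with e2 | e2 <;> rcases h3.2.1 with e3 | e3 <;>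
    first
    | exact Or.inl (h.inj u hu _ _ h1.1 h2.1 (e1.trans e2.symm))
    | exact Or.inr (Or.inl (h.inj u hu _ _ h1.1 h3.1 (e1.trans e3.symm)))
    | exact Or.inr (Or.inr (h.inj u hu _ _ h2.1 h3.1 (e2.trans e3.symm)))

/-- small vertices -/
def Sm (G : SimpleGraph V) (v : ι → ℕ → V) (live : Finset ι) (c : Sym2 V → Fin 5) (u : V) : Prop :=
  VO v live u ∨ Sc G c u ≠ {0, 1, 2}

theorem one_end (h : KH G v nb live c x y z w) (hs : s.val < 3) (ha : a.val < 3) {p q : V}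
    (hp : Sm G v live c p) (hq : Sm G v live c q) (py : p ≠ y) (qy : q ≠ y) (rp : R G v nb live c s a y p)
    (rq : R G v nb live c s a y q) : p = q := by
  have sm : ∀ u, Sm G v live c u → ∀ w w', (KG G v nb live c s a).Adj u w → (KG G v nb live c s a).Adj u w' → w = w' := by
    intro u hu
    by_cases h' : VO v live u
    · exact K_small h'
    · exact h.K_small' hs ha h' (hu.resolve_left h')
  exact path_end _ h.K_two y p q (K_small h.vy) (sm p hp) (sm q hq) py qy rp rq

theorem iso (h : KH G v nb live c x y z w) {u : V} (hu : VO v live u) (hu' : VO v live (nb u)) (h1 : u ≠ y) (h2 : nb u ≠ y) :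
    ¬ R G v nb live c s a y u := by
  rintro ⟨p⟩
  have key : ∀ (t : V) (p : (KG G v nb live c s a).Walk t u), t = u ∨ t = nb u := by
    intro t p
    have : ∀ (t t' : V) (p : (KG G v nb live c s a).Walk t t'), t' = u → t = u ∨ t = nb u := by
      intro t t' p
      induction p with
      | nil => intro e; exact Or.inl e
      | cons hadj p ih =>
        intro e
        rcases ih e with rfl | rfl
        · exact Or.inr (hadj.symm.2.2.1 hu)
        · exact Or.inl ((hadj.symm.2.2.1 hu').trans (h.vnb u hu hu'))
    exact this t u p rfl
  rcases key y p with e | e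
  · exact h1 e.symm
  · exact h2 e.symm

theorem Rx (h : KH G v nb live c x y z w) : ¬ R G v nb live c s a y x :=
  h.iso h.vx (by rw [h.nbx]; exact h.vw) h.xy (by rw [h.nbx]; exact h.wy)

theorem Rw (h : KH G v nb live c x y z w) : ¬ R G v nb live c s a y w :=
  h.iso h.vw (by rw [h.nbw]; exact h.vx) h.wy (by rw [h.nbw]; exact h.xy)

end KH

theorem pur_swap : ∀ s a : Fin 5, s.val < 3 → a.val < 3 → ∀ S : Finset (Fin 5), Pur S → Pur (S.image (Equiv.swap s a)) := by
  decide +kernel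
theorem pur_3 : ∀ s a b : Fin 5, s.val < 3 → a.val < 3 → b.val < 3 → s ≠ a → s ≠ b → a ≠ b → Pur {s, a, b} := by
  have : ∀ s a b : Fin 5, (decide (s.val < 3) && decide (a.val < 3) && decide (b.val < 3) && decide (s ≠ a) && decide (s ≠ b) && decide (a ≠ b)) = true
     → Pur {s, a, b} := by decide +kernel
  intro s a b h1 h2 h3 h4 h5 h6
  exact this s a b (by simp [h1, h2, h3, h4, h5, h6])
theorem all_3 : ∀ s a b : Fin 5, s.val < 3 → a.val < 3 → b.val < 3 → s ≠ a → s ≠ b → a ≠ b → ∀ k : Fin 5, k.val < 3 → k = s ∨ k = a ∨ k = b := by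
  have : ∀ s a b k : Fin 5, (decide (s.val < 3) && decide (a.val < 3) && decide (b.val < 3) && decide (s ≠ a) && decide (s ≠ b) && decide (a ≠ b)
     && decide (k.val < 3)) = true → k = s ∨ k = a ∨ k = b := by decide +kernel
  intro s a b h1 h2 h3 h4 h5 h6 k h7
  exact this s a b k (by simp [h1, h2, h3, h4, h5, h6, h7])
theorem pur_34 : ∀ t : Fin 5, t.val < 3 → Pur {t, 3, 4} := by decide +kernel

def sg (s a k : Fin 5) : Fin 5 := if k = s then 3 else if k = a then 4 else k
theorem sg_img : ∀ s a b : Fin 5, s.val < 3 → a.val < 3 → b.val < 3 → s ≠ a → s ≠ b → a ≠ b →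
    Finset.image (sg s a) {0, 1, 2} = {b, 3, 4} := by
  have : ∀ s a b : Fin 5, (decide (s.val < 3) && decide (a.val < 3) && decide (b.val < 3) && decide (s ≠ a) && decide (s ≠ b) && decide (a ≠ b)) = true
     → Finset.image (sg s a) {0, 1, 2} = {b, 3, 4} := by decide +kernel
  intro s a b h1 h2 h3 h4 h5 h6
  exact this s a b (by simp [h1, h2, h3, h4, h5, h6])

namespace KH
variable {V ι : Type*} {G : SimpleGraph V} {v : ι → ℕ → V} {nb : V → V} {live : Finset ι} {c : Sym2 V → Fin 5}
  {x y z w : V} {s a : Fin 5} {σ : Fin 5 → Fin 5} {cxy cxz cyz ce : Fin 5}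

open scoped Classical in
theorem k1 (h : KH G v nb live c x y z w) {u w' : V} (hu : ¬ VO v live u) (ha : G.Adj u w') :
    kc c (R G v nb live c s a y) s a σ x y z w cxy cxz cyz ce s(u, w') =
      if (c s(u, w') = s ∨ c s(u, w') = a) ∧ R G v nb live c s a y u then σ (c s(u, w')) else c s(u, w') := by
  have ux : u ≠ x := fun e => hu (e ▸ h.vx)
  have uy : u ≠ y := fun e => hu (e ▸ h.vy)
  have uz : u ≠ z := fun e => hu (e ▸ h.vz)
  have uw : u ≠ w := fun e => hu (e ▸ h.vw)
  unfold kc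
  rw [if_neg (by simp [Sym2.eq_iff, ux, uy]), if_neg (by simp [Sym2.eq_iff, ux, uz]), if_neg (by simp [Sym2.eq_iff, uy, uz]),
    if_neg (by simp [Sym2.eq_iff, ux, uw])]
  congr 1
  apply propext
  refine and_congr_right fun hc => ?_
  have := R_iff (y := y) (h.K_of_nonVO hu ha hc)
  constructor
  · rintro ⟨u', hm, hR⟩
    rcases Sym2.mem_iff.1 hm with rfl | rfl
    · exact hR
    · exact this.2 hR
  · exact fun hR => ⟨u, Sym2.mem_mk_left _ _, hR⟩

theorem R_col (h : KH G v nb live c x y z w) (hy : c s(y, nb y) = s) {u : V} (hu : VO v live u)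
    (hR : R G v nb live c s a y u) : c s(u, nb u) = s ∨ c s(u, nb u) = a := by
  by_cases e : u = y
  · rw [e]; exact Or.inl hy
  · obtain ⟨p⟩ := hR
    have : ∀ (t u : V) (p : (KG G v nb live c s a).Walk t u), u ≠ t → ∃ w, (KG G v nb live c s a).Adj u w := by
      intro t u p ht
      cases p.reverse with
      | nil => exact absurd rfl ht
      | cons hadj _ => exact ⟨_, hadj⟩
    obtain ⟨w', hw⟩ := this y u p e
    have := hw.2.2.1 hu
    rw [← this]; exact hw.2.1

open scoped Classical in
theorem k2 (h : KH G v nb live c x y z w) (hy : c s(y, nb y) = s) {u : V} (hu : VO v live u) (hx : u ≠ x) (hw : u ≠ w) :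
    kc c (R G v nb live c s a y) s a σ x y z w cxy cxz cyz ce s(u, nb u) =
      if R G v nb live c s a y u then σ (c s(u, nb u)) else c s(u, nb u) := by
  unfold kc
  rw [if_neg, if_neg, if_neg, if_neg]
  · congr 1
    apply propext
    constructor
    · rintro ⟨hc, u', hm, hR⟩
      rcases Sym2.mem_iff.1 hm with rfl | rfl
      · exact hR
      · exact (R_iff (y := y) (h.K_third hu hc)).2 hR
    · intro hR
      exact ⟨h.R_col hy hu hR, u, Sym2.mem_mk_left _ _, hR⟩
  · rw [Sym2.eq_iff]; rintro (⟨e, -⟩ | ⟨e, -⟩)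
    · exact hx e
    · exact hw e
  · rw [Sym2.eq_iff]; rintro (⟨e, e'⟩ | ⟨e, e'⟩)
    · rw [e] at e'; exact h.nyz e'
    · rw [e] at e'; exact h.nzy e'
  · rw [Sym2.eq_iff]; rintro (⟨e, e'⟩ | ⟨e, e'⟩)
    · exact hx e
    · rw [e] at e'; exact h.nzx e'
  · rw [Sym2.eq_iff]; rintro (⟨e, e'⟩ | ⟨e, e'⟩)
    · exact hx e
    · rw [e] at e'; exact h.nyx e'

theorem kxy : kc c (R G v nb live c s a y) s a σ x y z w cxy cxz cyz ce s(x, y) = cxy := by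
  unfold kc; rw [if_pos rfl]
theorem kxz (h : KH G v nb live c x y z w) :
    kc c (R G v nb live c s a y) s a σ x y z w cxy cxz cyz ce s(x, z) = cxz := by
  unfold kc; rw [if_neg (by simp [h.yz.symm, h.xy]), if_pos rfl]
theorem kyz (h : KH G v nb live c x y z w) :
    kc c (R G v nb live c s a y) s a σ x y z w cxy cxz cyz ce s(y, z) = cyz := by
  unfold kc
  rw [if_neg (by simp [h.xy.symm, h.xz.symm]), if_neg (by simp [h.xy.symm, h.yz]), if_pos rfl]
theorem kxw (h : KH G v nb live c x y z w) :
    kc c (R G v nb live c s a y) s a σ x y z w cxy cxz cyz ce s(x, w) = ce := by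
  unfold kc
  rw [if_neg (by simp [h.wy, h.xy]), if_neg (by simp [h.wz, h.xz]), if_neg (by simp [h.xy, h.xz]), if_pos rfl]

theorem kSR (h : KH G v nb live c x y z w) {u : V} (hu : ¬ VO v live u) (hR : R G v nb live c s a y u)
    (hσ : ∀ k ∈ Sc G c u, k ≠ s → k ≠ a → σ k = k) :
    Sc G (kc c (R G v nb live c s a y) s a σ x y z w cxy cxz cyz ce) u = (Sc G c u).image σ := by
  have key : ∀ w', G.Adj u w' → kc c (R G v nb live c s a y) s a σ x y z w cxy cxz cyz ce s(u, w') = σ (c s(u, w')) := by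
    intro w' ha
    rw [h.k1 hu ha]
    by_cases hc : c s(u, w') = s ∨ c s(u, w') = a
    · rw [if_pos ⟨hc, hR⟩]
    · rw [if_neg (fun h' => hc h'.1)]
      push Not at hc
      rw [hσ _ (mem_Sc.2 ⟨_, ha, rfl⟩) hc.1 hc.2]
  ext k
  simp only [mem_Sc, Finset.mem_image]
  constructor
  · rintro ⟨w', ha, rfl⟩
    exact ⟨_, ⟨w', ha, rfl⟩, (key w' ha).symm⟩
  · rintro ⟨_, ⟨w', ha, rfl⟩, rfl⟩
    exact ⟨w', ha, key w' ha⟩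

theorem kSN (h : KH G v nb live c x y z w) {u : V} (hu : ¬ VO v live u) (hR : ¬ R G v nb live c s a y u) :
    Sc G (kc c (R G v nb live c s a y) s a σ x y z w cxy cxz cyz ce) u = Sc G c u := by
  ext k
  simp only [mem_Sc]
  refine exists_congr fun w' => and_congr_right fun ha => ?_
  rw [h.k1 hu ha, if_neg (fun h' => hR h'.2)]

theorem Sc3 {c : Sym2 V → Fin 5} {u p q r : V} (h : ∀ w, G.Adj u w ↔ w = p ∨ w = q ∨ w = r) :
    Sc G c u = {c s(u, p), c s(u, q), c s(u, r)} := by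
  ext k
  simp only [mem_Sc, h, Finset.mem_insert, Finset.mem_singleton]
  constructor
  · rintro ⟨w, rfl | rfl | rfl, rfl⟩ <;> simp
  · rintro (rfl | rfl | rfl)
    · exact ⟨p, by simp, rfl⟩
    · exact ⟨q, by simp, rfl⟩
    · exact ⟨r, by simp, rfl⟩

theorem kSx (h : KH G v nb live c x y z w) :
    Sc G (kc c (R G v nb live c s a y) s a σ x y z w cxy cxz cyz ce) x = {cxy, cxz, ce} := by
  rw [Sc3 h.ax, kxy, h.kxz, h.kxw]

open scoped Classical in
theorem kSy (h : KH G v nb live c x y z w) (hy : c s(y, nb y) = s) :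
    Sc G (kc c (R G v nb live c s a y) s a σ x y z w cxy cxz cyz ce) y = {cxy, cyz, σ s} := by
  rw [Sc3 h.ay, h.k2 hy h.vy h.xy.symm h.wy.symm, if_pos R_self, h.kyz, Sym2.eq_swap, kxy, hy]

open scoped Classical in
theorem kSz (h : KH G v nb live c x y z w) (hy : c s(y, nb y) = s) (hz : c s(z, nb z) = s) :
    Sc G (kc c (R G v nb live c s a y) s a σ x y z w cxy cxz cyz ce) z =
      {cxz, cyz, if R G v nb live c s a y z then σ s else s} := by
  rw [Sc3 h.az, h.k2 hy h.vz h.xz.symm h.wz.symm, Sym2.eq_swap, h.kxz, Sym2.eq_swap, h.kyz, hz]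

end KH

namespace KH
variable {V ι : Type*} {G : SimpleGraph V} {v : ι → ℕ → V} {nb : V → V} {live : Finset ι} {c : Sym2 V → Fin 5}
  {x y z w : V} {s a b : Fin 5}

/-- colours at dead vertices (dead after the kill) -/
def Dd (v : ι → ℕ → V) (live : Finset ι) (x y z u : V) : Prop := ¬ VO v live u ∨ u = x ∨ u = y ∨ u = z

theorem land (h : KH G v nb live c x y z w) (hs : s.val < 3) (ha : a.val < 3) (hb : b.val < 3) (sa : s ≠ a) (sb : s ≠ b) (ab : a ≠ b)
    (hy : c s(y, nb y) = s) (hz : c s(z, nb z) = s) (hR : ¬ R G v nb live c s a y z) :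
    ∃ c' : Sym2 V → Fin 5, (∀ u, Dd v live x y z u → Pur (Sc G c' u)) ∧
      (∀ u, VO v live u → u ≠ x → u ≠ w → R G v nb live c s a y u → (c' s(u, nb u)).val < 3 ∧ c' s(u, nb u) ≠ c s(u, nb u)) ∧
      (∀ u, VO v live u → u ≠ x → u ≠ w → ¬ R G v nb live c s a y u → c' s(u, nb u) = c s(u, nb u)) ∧
      c' s(w, nb w) = b ∧
      (∀ u w', G.Adj u w' → Dd v live x y z u → Dd v live x y z w' → 3 ≤ (c' s(u, w')).val →
        (¬ VO v live u ∧ ¬ VO v live w' ∧ 3 ≤ (c s(u, w')).val) ∧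
        (R G v nb live c s a y u ∨ R G v nb live c s a y w' ∨ (Sc G c' u = Sc G c u ∧ Sc G c' w' = Sc G c w'))) := by
  have swlt : ∀ k : Fin 5, k.val < 3 → (Equiv.swap s a k).val < 3 := by
    intro k hk
    rw [Equiv.swap_apply_def]
    split_ifs <;> assumption
  refine ⟨kc c (R G v nb live c s a y) s a (Equiv.swap s a) x y z w s a b b, ?_, ?_, ?_, ?_, ?_⟩
  · rintro u (hu | rfl | rfl | rfl)
    · by_cases hRu : R G v nb live c s a y u
      · rw [h.kSR hu hRu (fun k _ h1 h2 => Equiv.swap_apply_of_ne_of_ne h1 h2)]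
        exact pur_swap s a hs ha _ (h.deg u hu)
      · rw [h.kSN hu hRu]; exact h.deg u hu
    · rw [h.kSx]; exact pur_3 s a b hs ha hb sa sb ab
    · rw [h.kSy hy, Equiv.swap_apply_left]; exact pur_3 s b a hs hb ha sb sa ab.symm
    · rw [h.kSz hy hz, if_neg hR]; exact pur_3 a b s ha hb hs ab sa.symm sb.symm
  · intro u hu hx hw hRu
    rw [h.k2 hy hu hx hw, if_pos hRu]
    refine ⟨swlt _ (h.th u hu), ?_⟩
    rcases h.R_col hy hu hRu with e | e <;> rw [e]
    · rw [Equiv.swap_apply_left]; exact sa.symm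
    · rw [Equiv.swap_apply_right]; exact sa
  · intro u hu hx hw hRu
    rw [h.k2 hy hu hx hw, if_neg hRu]
  · rw [h.nbw, Sym2.eq_swap, h.kxw]
  · intro u w' hadj hu hw' h3
    have main : ∀ u w', G.Adj u w' → ¬ VO v live u → Dd v live x y z w' →
        3 ≤ (kc c (R G v nb live c s a y) s a (Equiv.swap s a) x y z w s a b b s(u, w')).val →
        (¬ VO v live u ∧ ¬ VO v live w' ∧ 3 ≤ (c s(u, w')).val) := by
      intro u w' hadj hu hw' h3
      rw [h.k1 hu hadj] at h3
      have h3' : 3 ≤ (c s(u, w')).val := by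
        by_contra hlt
        split_ifs at h3
        · have := swlt (c s(u, w')) (by omega); omega
        · omega
      refine ⟨hu, fun hv => ?_, h3'⟩
      have := h.vadj w' u hv hu hadj.symm
      have h4 := h.th w' hv
      rw [← this, Sym2.eq_swap] at h4
      omega
    have fin : ∀ u, ¬ VO v live u → ¬ R G v nb live c s a y u → Sc G (kc c (R G v nb live c s a y) s a (Equiv.swap s a) x y z w s a b b) u = Sc G c u :=
      fun u h1 h2 => h.kSN h1 h2
    have fin2 : (¬ VO v live u ∧ ¬ VO v live w' ∧ 3 ≤ (c s(u, w')).val) := by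
      by_cases hvu : VO v live u
      · by_cases hvw : VO v live w'
        · exfalso
          have hu' := hu.resolve_left (not_not.2 hvu)
          have hw'' := hw'.resolve_left (not_not.2 hvw)
          have e1 := h.kxz (s := s) (a := a) (σ := Equiv.swap s a) (cxy := s) (cxz := a) (cyz := b) (ce := b)
          have e2 := h.kyz (s := s) (a := a) (σ := Equiv.swap s a) (cxy := s) (cxz := a) (cyz := b) (ce := b)
          have e0 := kxy (G := G) (v := v) (nb := nb) (live := live) (c := c) (x := x) (y := y) (z := z) (w := w) (s := s) (a := a) (σ := Equiv.swap s a) (cxy := s) (cxz := a) (cyz := b) (ce := b)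
          rcases hu' with rfl | rfl | rfl <;> rcases hw'' with rfl | rfl | rfl
          · exact hadj.ne rfl
          · rw [e0] at h3; omega
          · rw [e1] at h3; omega
          · rw [Sym2.eq_swap, e0] at h3; omega
          · exact hadj.ne rfl
          · rw [e2] at h3; omega
          · rw [Sym2.eq_swap, e1] at h3; omega
          · rw [Sym2.eq_swap, e2] at h3; omega
          · exact hadj.ne rfl
        · have := main w' u hadj.symm hvw hu (by rwa [Sym2.eq_swap])
          exact absurd hvu this.2.1
      · exact main u w' hadj hvu hw' h3
    refine ⟨fin2, ?_⟩
    by_cases h1 : R G v nb live c s a y u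
    · exact Or.inl h1
    · by_cases h2 : R G v nb live c s a y w'
      · exact Or.inr (Or.inl h2)
      · exact Or.inr (Or.inr ⟨fin u fin2.1 h1, fin w' fin2.2.1 h2⟩)

theorem retn (h : KH G v nb live c x y z w) (hs : s.val < 3) (ha : a.val < 3) (hb : b.val < 3) (sa : s ≠ a) (sb : s ≠ b) (ab : a ≠ b)
    (hy : c s(y, nb y) = s) (hz : c s(z, nb z) = s) (hR : R G v nb live c s a y z)
    (q d : Fin 5) (hqd : (q = s ∧ d = a) ∨ (q = a ∧ d = s)) :
    ∃ c' : Sym2 V → Fin 5, (∀ u, Dd v live x y z u → Pur (Sc G c' u)) ∧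
      (∀ u, VO v live u → u ≠ x → u ≠ y → u ≠ z → u ≠ w → c' s(u, nb u) = c s(u, nb u)) ∧
      c' s(w, nb w) = d ∧
      (∀ u w', G.Adj u w' → Dd v live x y z u → Dd v live x y z w' → 3 ≤ (c' s(u, w')).val →
        s(u, w') = s(y, z) ∨ s(u, w') = s(z, nb z) ∨ Sc G c' u = Sc G c' w' ∨
        (¬ VO v live u ∧ ¬ VO v live w' ∧ 3 ≤ (c s(u, w')).val ∧ Sc G c' u = Sc G c u ∧ Sc G c' w' = Sc G c w')) := by
  have hq : q.val < 3 := by rcases hqd with ⟨rfl, rfl⟩ | ⟨rfl, rfl⟩ <;> assumption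
  have hd : d.val < 3 := by rcases hqd with ⟨rfl, rfl⟩ | ⟨rfl, rfl⟩ <;> assumption
  have bq : b ≠ q := by rcases hqd with ⟨rfl, rfl⟩ | ⟨rfl, rfl⟩; exacts [sb.symm, ab.symm]
  have bd : b ≠ d := by rcases hqd with ⟨rfl, rfl⟩ | ⟨rfl, rfl⟩; exacts [ab.symm, sb.symm]
  have qd : q ≠ d := by rcases hqd with ⟨rfl, rfl⟩ | ⟨rfl, rfl⟩; exacts [sa, sa.symm]
  have r0 : ∀ u, R G v nb live c s a y u → u ≠ y → u ≠ z → ¬ VO v live u ∧ Sc G c u = {0, 1, 2} := by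
    intro u hu uy uz
    by_contra hc
    apply uz
    refine h.one_end hs ha ?_ (Or.inl h.vz) uy h.yz.symm hu hR
    by_cases hv : VO v live u
    · exact Or.inl hv
    · exact Or.inr (fun e => hc ⟨hv, e⟩)
  have sgs : sg s a s = 3 := by simp [sg]
  have sga : sg s a a = 4 := by simp [sg, sa.symm]
  set c' := kc c (R G v nb live c s a y) s a (sg s a) x y z w b q 4 d with hc'
  have SR : ∀ u, R G v nb live c s a y u → ¬ VO v live u → Sc G c' u = {b, 3, 4} := by
    intro u hu hv
    rw [hc', h.kSR hv hu (fun k _ h1 h2 => by simp [sg, h1, h2]), (r0 u hu (fun e => hv (e ▸ h.vy)) (fun e => hv (e ▸ h.vz))).2]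
    exact sg_img s a b hs ha hb sa sb ab
  have SN : ∀ u, ¬ R G v nb live c s a y u → ¬ VO v live u → Sc G c' u = Sc G c u := fun u h1 h2 => h.kSN h2 h1
  have Sx : Sc G c' x = {b, q, d} := h.kSx
  have Sy : Sc G c' y = {b, 3, 4} := by rw [hc', h.kSy hy, sgs]; ext; simp [or_comm]
  have Sz : Sc G c' z = {q, 3, 4} := by rw [hc', h.kSz hy hz, if_pos hR, sgs]; ext; simp [or_comm]
  refine ⟨c', ?_, ?_, ?_, ?_⟩
  · rintro u (hu | rfl | rfl | rfl)
    · by_cases hRu : R G v nb live c s a y u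
      · rw [SR u hRu hu]; exact pur_34 b hb
      · rw [SN u hRu hu]; exact h.deg u hu
    · rw [Sx]; exact pur_3 _ _ _ hb hq hd bq bd qd
    · rw [Sy]; exact pur_34 b hb
    · rw [Sz]; exact pur_34 q hq
  · intro u hu hx huy huz hw
    rw [hc', h.k2 hy hu hx hw, if_neg]
    intro hRu
    exact (r0 u hRu huy huz).1 hu
  · rw [h.nbw, Sym2.eq_swap, hc', h.kxw]
  · intro u w' hadj hu hw' h3
    have main : ∀ u w', G.Adj u w' → ¬ VO v live u → Dd v live x y z w' → 3 ≤ (c' s(u, w')).val →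
        s(u, w') = s(y, z) ∨ s(u, w') = s(z, nb z) ∨ Sc G c' u = Sc G c' w' ∨
        (¬ VO v live u ∧ ¬ VO v live w' ∧ 3 ≤ (c s(u, w')).val ∧ Sc G c' u = Sc G c u ∧ Sc G c' w' = Sc G c w') := by
      intro u w' hadj hu hw' h3
      rw [hc', h.k1 hu hadj] at h3
      by_cases hc1 : (c s(u, w') = s ∨ c s(u, w') = a) ∧ R G v nb live c s a y u
      · have hRw := R_adj hc1.2 (h.K_of_nonVO hu hadj hc1.1)
        by_cases hz' : w' = z
        · have := h.vadj z u h.vz hu (by rw [← hz']; exact hadj.symm)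
          right; left; rw [hz', this, Sym2.eq_swap]
        · right; right; left
          rw [SR u hc1.2 hu]
          by_cases hy' : w' = y
          · rw [hy', Sy]
          · rw [SR w' hRw (r0 w' hRw hy' hz').1]
      · rw [if_neg hc1] at h3
        have hvw : ¬ VO v live w' := by
          intro hv
          have := h.vadj w' u hv hu hadj.symm
          have h4 := h.th w' hv
          rw [← this, Sym2.eq_swap] at h4
          omega
        have nR : ∀ u w', G.Adj u w' → ¬ VO v live u → 3 ≤ (c s(u, w')).val → ¬ R G v nb live c s a y u := by
          intro u w' hadj hu h3 hRu
          have m : c s(u, w') ∈ Sc G c u := mem_Sc.2 ⟨_, hadj, rfl⟩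
          rw [(r0 u hRu (fun e => hu (e ▸ h.vy)) (fun e => hu (e ▸ h.vz))).2] at m
          simp only [Finset.mem_insert, Finset.mem_singleton] at m
          rcases m with m | m | m <;> rw [m] at h3 <;> exact absurd h3 (by decide)
        right; right; right
        exact ⟨hu, hvw, h3, SN u (nR u w' hadj hu h3) hu, SN w' (nR w' u hadj.symm hvw (by rwa [Sym2.eq_swap])) hvw⟩
    by_cases hvu : VO v live u
    · by_cases hvw : VO v live w'
      · have hu' := hu.resolve_left (not_not.2 hvu)
        have hw'' := hw'.resolve_left (not_not.2 hvw)
        have e1 : c' s(x, z) = q := h.kxz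
        have e0 : c' s(x, y) = b := kxy
        rcases hu' with rfl | rfl | rfl <;> rcases hw'' with rfl | rfl | rfl
        · exact absurd rfl hadj.ne
        · rw [e0] at h3; omega
        · rw [e1] at h3; omega
        · rw [Sym2.eq_swap, e0] at h3; omega
        · exact absurd rfl hadj.ne
        · left; rfl
        · rw [Sym2.eq_swap, e1] at h3; omega
        · left; exact Sym2.eq_swap
        · exact absurd rfl hadj.ne
      · rcases main w' u hadj.symm hvw hu (by rwa [Sym2.eq_swap]) with e | e | e | ⟨e1, e2, e3, e4, e5⟩
        · left; rw [Sym2.eq_swap, e]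
        · right; left; rw [Sym2.eq_swap, e]
        · right; right; left; exact e.symm
        · exact absurd hvu e2
    · exact main u w' hadj hvu hw' h3

end KH

def TT (n : ℕ) (P : ℕ → Bool) : Prop := n = 3 ∧ ∃ j, P j = true
def Agr (P : ℕ → Bool) (th : ℕ → ℕ) : Prop := ∀ j, P j = true → th j = th (j + 1)

/-- admissible local states -/
def Ok4 (n : ℕ) (P : ℕ → Bool) (th : ℕ → ℕ) (β : ℕ) : Prop :=
  (TT n P → (β = 2 ∧ Agr P th) ∨ (4 ≤ β ∧ Cyc n th β)) ∧
  (¬ TT n P → (Agr P th ∧ β = bcount n P ∧ Cyc n th β) ∨ (2 * discount n P th + bcount n P ≤ β ∧ bcount n P + 2 ≤ β))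

/-- periodic data -/
structure PD (n : ℕ) (P : ℕ → Bool) : Prop where
  hn : 3 ≤ n
  hP : ∀ j, P (j + n) = P j
  hPP : ∀ j, P j = true → P (j + 1) = false

structure TD (n : ℕ) (th : ℕ → ℕ) : Prop where
  per : ∀ j, th (j + n) = th j
  lt : ∀ j, th j < 3

theorem notT {n : ℕ} {P : ℕ → Bool} (h : ¬ TT n P) : n = 3 → ∀ j, P j = false := by
  intro hn j
  by_contra hj
  exact h ⟨hn, j, by simpa using hj⟩

theorem ok_cyc {n : ℕ} {P : ℕ → Bool} {th : ℕ → ℕ} {β : ℕ} (hp : PD n P) (ht : TD n th) (hT : ¬ TT n P) (h : Ok4 n P th β) :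
    Cyc n th β := by
  rcases h.2 hT with ⟨-, -, h⟩ | ⟨h1, h2⟩
  · exact h
  · exact word_all n hp.hn th ht.per ht.lt P hp.hP hp.hPP (notT hT) β h1 h2

theorem P_prev {n : ℕ} {P : ℕ → Bool} (hp : PD n P) {p j : ℕ} (h0 : P p = false) (h1 : P (p + (n - 1)) = false)
    (hj : P j = true) : ¬ j ≡ p [MOD n] ∧ ¬ (j + 1) ≡ p [MOD n] := by
  constructor
  · intro h
    have := per_modEq hp.hP h
    rw [hj, h0] at this; cases this
  · intro h
    have := per_modEq hp.hP (h.add_right (n - 1))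
    have hn := hp.hn
    rw [show j + 1 + (n - 1) = j + n by omega, hp.hP, hj, h1] at this; cases this

theorem ok_w {n : ℕ} {P : ℕ → Bool} {th : ℕ → ℕ} {β : ℕ} (hp : PD n P) (ht : TD n th) (hT : ¬ TT n P) (h : Ok4 n P th β)
    (p : ℕ) (h0 : P p = false) (h1 : P (p + (n - 1)) = false) :
    ∃ g, ∀ th', TD n th' → (∀ j, ¬ j ≡ p [MOD n] → th' j = th j) → th' p ≠ g → Ok4 n P th' β := by
  rcases h.2 hT with ⟨a, b, e⟩ | ⟨a, b⟩
  · obtain ⟨g, hg⟩ := word_one n hp.hn th ht.per ht.lt P hp.hP hp.hPP a p h0 h1 (notT hT)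
    refine ⟨g, fun th' t' hc hne => ⟨fun h => absurd h hT, fun _ => Or.inl ⟨fun j hj => ?_, b, ?_⟩⟩⟩
    · obtain ⟨q1, q2⟩ := P_prev hp h0 h1 hj
      rw [hc _ q1, hc _ q2, a j hj]
    · rw [b]; exact hg th' t'.per hc (t'.lt p) hne
  · refine ⟨0, fun th' t' hc hne => ⟨fun h => absurd h hT, fun _ => Or.inr ⟨?_, b⟩⟩⟩
    have : discount n P th' = discount n P th := by
      unfold discount
      refine Finset.sum_congr rfl fun j _ => ?_
      cases hj : P j
      · simp
      · obtain ⟨q1, q2⟩ := P_prev hp h0 h1 hj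
        rw [hc _ q1, hc _ q2]
    rw [this]; exact a

theorem ok_hit {n : ℕ} {P : ℕ → Bool} {th th' : ℕ → ℕ} {β : ℕ} (hp : PD n P) (hT : ¬ TT n P) (h : Ok4 n P th β) (q : ℕ)
    (hq : ∀ j, P j = true → ¬ j ≡ q [MOD n] → ¬ (j + 1) ≡ q [MOD n] → th' j = th j ∧ th' (j + 1) = th (j + 1)) :
    Ok4 n P th' (β + 2) := by
  refine ⟨fun h => absurd h hT, fun _ => Or.inr ?_⟩
  have := discount_le hp.hP hp.hPP q hq
  rcases h.2 hT with ⟨a, b, e⟩ | ⟨a, b⟩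
  · rw [discount_zero a] at this
    omega
  · omega

theorem three_cases {n : ℕ} (hn : n = 3) (j k : ℕ) : k ≡ j [MOD n] ∨ k ≡ j + 1 [MOD n] ∨ k ≡ j + 2 [MOD n] := by
  subst hn; unfold Nat.ModEq; omega

theorem T_next {n : ℕ} {P : ℕ → Bool} (hp : PD n P) (hn : n = 3) {j : ℕ} (hj : P j = true) :
    P (j + 1) = false ∧ P (j + 2) = false := by
  refine ⟨hp.hPP j hj, ?_⟩
  by_contra h
  have := hp.hPP (j + 2) (by simpa using h)
  have h2 := hp.hP j
  rw [hn] at h2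
  rw [show j + 2 + 1 = j + 3 by rfl, h2, hj] at this; cases this

theorem cyc_tri {n : ℕ} (hn : n = 3) {th : ℕ → ℕ} (ht : TD n th) (j k : ℕ) (h : th j ≠ th k) : Cyc n th 3 := by
  subst hn
  refine tri_nonmono th ht.per ht.lt fun h' => h ?_
  have : ∀ j, th j = th 0 := by
    intro j
    rcases three_cases rfl 0 j with e | e | e <;> rw [per_modEq ht.per e]
    · exact h'.1.symm
    · exact (h'.1.trans h'.2).symm
  rw [this, this k]

theorem ok_hitT {n : ℕ} {P : ℕ → Bool} {th th' : ℕ → ℕ} {β : ℕ} (ht : TD n th') (hT : TT n P)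
    (h : Ok4 n P th β) (j : ℕ) (hj : P j = true)
    (hd : (th' j ≠ th j ∧ th' (j + 1) = th (j + 1)) ∨ (th' j = th j ∧ th' (j + 1) ≠ th (j + 1))) :
    Ok4 n P th' (β + 2) := by
  refine ⟨fun _ => Or.inr ?_, fun h => absurd hT h⟩
  rcases h.1 hT with ⟨a, b⟩ | ⟨a, b⟩
  · refine ⟨by omega, (cyc_tri hT.1 ht j (j + 1) ?_).mono (by omega)⟩
    have := b j hj
    rcases hd with ⟨h1, h2⟩ | ⟨h1, h2⟩
    · rw [h2, ← this]; exact h1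
    · rw [h1, this]; exact fun e => h2 e.symm
  · refine ⟨by omega, ?_⟩
    have hn := hT.1
    subst hn
    exact (tri_any th' ht.per ht.lt).mono (by omega)

def Kl {V ι : Type*} (n : ι → ℕ) (v : ι → ℕ → V) (nb : V → V) (P : ι → ℕ → Bool) (i : ι) : Prop :=
  ∃ j, n i = 3 ∧ P i j = true ∧ ∀ i' j', nb (v i (j + 2)) = v i' j' → ¬ TT (n i') (P i')

structure St {V ι : Type*} (G : SimpleGraph V) (n : ι → ℕ) (v : ι → ℕ → V) (nb : V → V) (P : ι → ℕ → Bool)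
    (k : ℕ) (c : Sym2 V → Fin 5) (live : Finset ι) (β : ι → ℕ) (A : Finset (Sym2 V)) : Prop where
  s1 : ∀ u, ¬ VO v live u → Pur (Sc G c u)
  s2 : ∀ i ∈ live, ∀ j, thc v nb c i j < 3
  s3 : ∀ u w, G.Adj u w → ¬ VO v live u → ¬ VO v live w → s(u, w) ∉ A → 3 ≤ (c s(u, w)).val → Sc G c u = Sc G c w
  s4 : ∀ i ∈ live, Ok4 (n i) (P i) (thc v nb c i) (β i)
  s5 : ∀ i, ¬ Kl n v nb P i → i ∈ live
  s6 : A.card + ∑ i ∈ live, β i ≤ k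

namespace CS
variable {V ι : Type*} {G : SimpleGraph V} {n : ι → ℕ} {v : ι → ℕ → V} {nb : V → V} {P : ι → ℕ → Bool}

theorem pd (cs : CS G n v nb P) (i : ι) : PD (n i) (P i) := ⟨cs.hn i, cs.Pper i, cs.PP i⟩

theorem td (cs : CS G n v nb P) {c : Sym2 V → Fin 5} {i : ι} (h : ∀ j, thc v nb c i j < 3) : TD (n i) (thc v nb c i) :=
  ⟨cs.thc_per c i, h⟩

theorem x_unique (cs : CS G n v nb P) {i : ι} {j j' : ℕ} (hn : n i = 3) (hj : P i j = true) (h1 : P i j' = false)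
    (h2 : P i (j' + 1) = false) : v i (j' + 1) = v i (j + 2) := by
  apply cs.v_modEq
  rcases three_cases hn j (j' + 1) with e | e | e
  · rw [per_modEq (cs.Pper i) e, hj] at h2; cases h2
  · have := Nat.ModEq.add_right_cancel' 1 e
    rw [per_modEq (cs.Pper i) this, hj] at h1; cases h1
  · exact e

theorem partner (cs : CS G n v nb P) {live : Finset ι} (hl : ∀ i, ¬ Kl n v nb P i → i ∈ live) {i : ι} {j : ℕ} (hn : n i = 3)
    (hj : P i j = true) : ∃ i' j', nb (v i (j + 2)) = v i' (j' + 1) ∧ P i' j' = false ∧ P i' (j' + 1) = false ∧ i' ∈ live := by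
  obtain ⟨h1, h2⟩ := T_next (cs.pd i) hn hj
  obtain ⟨i', j', e1, e2, e3⟩ := cs.E3 i (j + 1) h1 h2
  refine ⟨i', j', e1, e2, e3, hl i' ?_⟩
  rintro ⟨k, k1, k2, k3⟩
  have := cs.x_unique k1 k2 e2 e3
  rw [this] at e1
  exact k3 i (j + 2) (cs.nb_nb e1) ⟨hn, j, hj⟩

theorem inj_of_card {V : Type*} {G : SimpleGraph V} (hdeg : ∀ u, ∃ p q r, ∀ w, G.Adj u w ↔ w = p ∨ w = q ∨ w = r) {c : Sym2 V → Fin 5} {u : V} (h : (Sc G c u).card = 3) :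
    ∀ w1 w2, G.Adj u w1 → G.Adj u w2 → c s(u, w1) = c s(u, w2) → w1 = w2 := by
  obtain ⟨p, q, r, hd⟩ := hdeg u
  rw [KH.Sc3 hd] at h
  have key : ∀ a b d : Fin 5, ({a, b, d} : Finset (Fin 5)).card = 3 → a ≠ b ∧ a ≠ d ∧ b ≠ d := by decide +kernel
  obtain ⟨h1, h2, h3⟩ := key _ _ _ h
  intro w1 w2 a1 a2 e
  rw [hd] at a1 a2
  rcases a1 with rfl | rfl | rfl <;> rcases a2 with rfl | rfl | rfl <;> first | rfl | exact absurd e (by assumption) | exact absurd e.symm (by assumption)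

theorem kh (cs : CS G n v nb P) (hdeg : ∀ u, ∃ p q r, ∀ w, G.Adj u w ↔ w = p ∨ w = q ∨ w = r) {c : Sym2 V → Fin 5}
    {live : Finset ι} (s1 : ∀ u, ¬ VO v live u → Pur (Sc G c u)) (s2 : ∀ i ∈ live, ∀ j, thc v nb c i j < 3) {i : ι} (hi : i ∈ live) {j : ℕ} (hn : n i = 3) (hj : P i j = true)
    {i' j' : _} (hw : nb (v i (j + 2)) = v i' j') (hi' : i' ∈ live) (hii : i' ≠ i) :
    KH G v nb live c (v i (j + 2)) (v i j) (v i (j + 1)) (v i' j') := by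
  have v3 : ∀ k, v i (k + 3) = v i k := fun k => by rw [← hn, cs.per]
  have a0 := cs.ne1 i j
  have a1 := cs.ne2 i j
  have a2 := cs.ne1 i (j+1)
  have a3 : ∀ k, v i' j' ≠ v i k := fun k e => hii (cs.inj e).1
  have nw := cs.nb_nb hw
  have nbne : ∀ k k', nb (v i k) ≠ v i k' := by
    intro k k' e
    rcases three_cases hn k k' with h | h | h <;> rw [cs.v_modEq h] at e
    · exact (cs.adj_nb i k).ne e.symm
    · exact cs.nb_ne_next i k e
    · apply cs.nb1 i (k + 2); rw [v3]; exact e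
  have nbw : ∀ k, v i k ≠ v i (j + 2) → nb (v i k) ≠ v i' j' := by
    intro k hk e
    apply hk
    rw [← cs.nb_nb e, nw]
  refine { ax := ?_, ay := ?_, az := ?_, vx := ⟨i, hi, _, rfl⟩, vy := ⟨i, hi, _, rfl⟩, vz := ⟨i, hi, _, rfl⟩, vw := ⟨i', hi', _, rfl⟩,
           nbx := hw, nbw := nw, xy := a1.symm, xz := a2.symm, yz := a0, wx := a3 _, wy := a3 _, wz := a3 _, nyx := nbne _ _, nyz := nbne _ _,
           nzx := nbne _ _, nzy := nbne _ _, nyw := nbw _ a1, nzw := nbw _ a2, vo := ?_, vnb := ?_, vadj := ?_, deg := s1, inj := ?_, th := ?_ }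
  · intro u
    rw [cs.adj i (j + 1) u, show j + 1 + 2 = j + 3 by rfl, v3, show j + 1 + 1 = j + 2 by rfl, hw]
    tauto
  · intro u
    have := cs.adj i (j + 2) u
    rw [show j + 2 + 1 = j + 3 by rfl, show j + 2 + 2 = j + 1 + 3 by rfl, v3, v3] at this
    exact this
  · intro u
    rw [cs.adj i j u]; tauto
  · rintro u ⟨i1, h1, j1, rfl⟩; exact cs.adj_nb _ _
  · rintro u ⟨i1, h1, j1, rfl⟩ ⟨i2, h2, j2, h⟩
    rw [h, cs.nb_nb h]
  · rintro u w' ⟨i1, h1, j1, rfl⟩ h ha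
    obtain ⟨j2, hj2, -⟩ := cs.succ i1 j1
    rw [hj2] at ha ⊢
    rcases (cs.adj i1 j2 w').1 ha with rfl | rfl | rfl
    · exact absurd ⟨i1, h1, _, rfl⟩ h
    · exact absurd ⟨i1, h1, _, rfl⟩ h
    · rfl
  · intro u hu; exact inj_of_card hdeg (s1 u hu).1
  · rintro u ⟨i1, h1, j1, rfl⟩; exact s2 i1 h1 j1

end CS

theorem two_others : ∀ s : Fin 5, s.val < 3 → ∃ p q : Fin 5, p.val < 3 ∧ q.val < 3 ∧ p ≠ q ∧ s ≠ p ∧ s ≠ q := by decide +kernel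

theorem pick (s : Fin 5) (hs : s.val < 3) (g : ℕ) : ∃ a b : Fin 5, a.val < 3 ∧ b.val < 3 ∧ s ≠ a ∧ s ≠ b ∧ a ≠ b ∧ b.val ≠ g := by
  obtain ⟨p, q, h1, h2, h3, h4, h5⟩ := two_others s hs
  by_cases hp : p.val = g
  · exact ⟨p, q, h1, h2, h4, h5, h3, fun e => h3 (Fin.ext (hp.trans e.symm))⟩
  · exact ⟨q, p, h2, h1, h5, h4, h3.symm, hp⟩

namespace CS
variable {V ι : Type*} {G : SimpleGraph V} {n : ι → ℕ} {v : ι → ℕ → V} {nb : V → V} {P : ι → ℕ → Bool}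

open scoped Classical in
theorem kill (cs : CS G n v nb P) (hdeg : ∀ u, ∃ p q r, ∀ w, G.Adj u w ↔ w = p ∨ w = q ∨ w = r) {k : ℕ} {c : Sym2 V → Fin 5}
    {live : Finset ι} {β : ι → ℕ} {A : Finset (Sym2 V)} (st : St G n v nb P k c live β A) {i : ι} (hi : i ∈ live)
    (hk : Kl n v nb P i) (hβ : β i = 2) (hag : Agr (P i) (thc v nb c i)) :
    ∃ c' β' A', St G n v nb P k c' (live.erase i) β' A' := by
  have hKl := hk
  obtain ⟨j, hn, hj, hnT⟩ := hk
  obtain ⟨i', j', hw, hP0, hP1, hi'⟩ := cs.partner st.s5 hn hj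
  have hT' := hnT _ _ hw
  have hii : i' ≠ i := fun e => hT' (e ▸ ⟨hn, j, hj⟩)
  have h := cs.kh hdeg st.s1 st.s2 hi hn hj hw hi' hii
  have hwn : nb (v i' (j' + 1)) = v i (j + 2) := cs.nb_nb hw
  obtain ⟨s, hs'⟩ : ∃ s, s = c s(v i j, nb (v i j)) := ⟨_, rfl⟩
  have hy := hs'.symm
  have hz : c s(v i (j + 1), nb (v i (j + 1))) = s := by
    rw [hs']; exact (Fin.ext (hag j hj)).symm
  have hs : s.val < 3 := by rw [hs']; exact st.s2 i hi j
  have hw1 : P i' (j' + 1 + (n i' - 1)) = false := by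
    have := cs.hn i'
    rw [show j' + 1 + (n i' - 1) = j' + n i' by omega, cs.Pper, hP0]
  obtain ⟨g, hg⟩ := ok_w (cs.pd i') (cs.td (st.s2 i' hi')) hT' (st.s4 i' hi') (j' + 1) hP1 hw1
  obtain ⟨a, b, ha, hb, sa, sb, ab, hbg⟩ := pick s hs g
  -- live vertices
  have vo' : ∀ i1 ∈ live.erase i, ∀ k, VO v live (v i1 k) ∧ ∀ l, v i1 k ≠ v i l := by
    intro i1 h1 k
    rw [Finset.mem_erase] at h1
    exact ⟨⟨i1, h1.2, k, rfl⟩, fun l e => h1.1 (cs.inj e).1⟩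
  have dd : ∀ u, ¬ VO v (live.erase i) u → KH.Dd v live (v i (j + 2)) (v i j) (v i (j + 1)) u := by
    intro u hu
    by_cases hv : VO v live u
    · obtain ⟨i1, h1, j1, rfl⟩ := hv
      have : i1 = i := by
        by_contra hne
        exact hu ⟨i1, Finset.mem_erase.2 ⟨hne, h1⟩, j1, rfl⟩
      subst this
      right
      rcases three_cases hn j j1 with e | e | e <;> rw [cs.v_modEq e] <;> tauto
    · exact Or.inl hv
  have hsum : ∑ i1 ∈ live.erase i, β i1 + 2 = ∑ i1 ∈ live, β i1 := by
    rw [← hβ]; exact Finset.sum_erase_add _ _ hi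
  have s5' : ∀ i1, ¬ Kl n v nb P i1 → i1 ∈ live.erase i := fun i1 h1 =>
    Finset.mem_erase.2 ⟨fun e => h1 (e ▸ hKl), st.s5 i1 h1⟩
  have ok_no : ∀ (c' : Sym2 V → Fin 5), (∀ i1 ∈ live.erase i, ∀ j, thc v nb c' i1 j < 3) →
      (c' s(v i' (j' + 1), nb (v i' (j' + 1)))).val ≠ g → ∀ i1 ∈ live.erase i,
      (∀ j1, v i1 j1 ≠ v i' (j' + 1) → thc v nb c' i1 j1 = thc v nb c i1 j1) →
      Ok4 (n i1) (P i1) (thc v nb c' i1) (β i1) := by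
    intro c' h2 hcg i1 h1 hsame
    by_cases e : i1 = i'
    · subst e
      refine hg _ (cs.td (h2 i1 h1)) (fun l hl => hsame l (fun e => hl (cs.v_eq_iff.1 e))) hcg
    · have : thc v nb c' i1 = thc v nb c i1 := funext fun l => hsame l (fun e' => e (cs.inj e').1)
      rw [this]
      exact st.s4 i1 (Finset.mem_of_mem_erase h1)
  by_cases hR : KH.R G v nb live c s a (v i j) (v i (j + 1))
  · -- returning
    obtain ⟨q, d, hqd, hdg⟩ : ∃ q d, ((q = s ∧ d = a) ∨ (q = a ∧ d = s)) ∧ d.val ≠ g := by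
      by_cases e : s.val = g
      · exact ⟨s, a, Or.inl ⟨rfl, rfl⟩, fun e' => sa (Fin.ext (e.trans e'.symm))⟩
      · exact ⟨a, s, Or.inr ⟨rfl, rfl⟩, e⟩
    have hd3 : d.val < 3 := by rcases hqd with ⟨-, rfl⟩ | ⟨-, rfl⟩ <;> assumption
    obtain ⟨c', r1, r2, r3, r4⟩ := h.retn hs ha hb sa sb ab hy hz hR q d hqd
    have same : ∀ i1 ∈ live.erase i, ∀ j1, v i1 j1 ≠ v i' (j' + 1) → thc v nb c' i1 j1 = thc v nb c i1 j1 := by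
      intro i1 h1 j1 hne
      obtain ⟨a1, a2⟩ := vo' i1 h1 j1
      unfold thc
      rw [r2 _ a1 (a2 _) (a2 _) (a2 _) hne]
    have s2' : ∀ i1 ∈ live.erase i, ∀ j, thc v nb c' i1 j < 3 := by
      intro i1 h1 j1
      by_cases e : v i1 j1 = v i' (j' + 1)
      · unfold thc; rw [e, r3]; exact hd3
      · rw [same i1 h1 j1 e]; exact st.s2 i1 (Finset.mem_of_mem_erase h1) j1
    refine ⟨c', β, A ∪ {s(v i j, v i (j + 1)), s(v i (j + 1), nb (v i (j + 1)))}, ⟨fun u hu => r1 u (dd u hu), s2', ?_, ?_, s5', ?_⟩⟩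
    · intro u w ha hu hw' hA h3
      rw [Finset.mem_union, Finset.mem_insert, Finset.mem_singleton] at hA
      push Not at hA
      rcases r4 u w ha (dd u hu) (dd w hw') h3 with e | e | e | ⟨e1, e2, e3, e4, e5⟩
      · exact absurd e hA.2.1
      · exact absurd e hA.2.2
      · exact e
      · rw [e4, e5]; exact st.s3 u w ha e1 e2 hA.1 e3
    · intro i1 h1
      exact ok_no c' s2' (by rw [r3]; exact hdg) i1 h1 (same i1 h1)
    · have c1 := Finset.card_union_le A {s(v i j, v i (j + 1)), s(v i (j + 1), nb (v i (j + 1)))}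
      have c2 := Finset.card_le_two (a := s(v i j, v i (j + 1))) (b := s(v i (j + 1), nb (v i (j + 1))))
      have := st.s6
      omega
  · -- landing
    obtain ⟨c', l1, l2, l3, l4, l5⟩ := h.land hs ha hb sa sb ab hy hz hR
    have s2' : ∀ i1 ∈ live.erase i, ∀ j, thc v nb c' i1 j < 3 := by
      intro i1 h1 j1
      unfold thc
      obtain ⟨a1, a2⟩ := vo' i1 h1 j1
      by_cases e : v i1 j1 = v i' (j' + 1)
      · rw [e, l4]; exact hb
      · by_cases hr : KH.R G v nb live c s a (v i j) (v i1 j1)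
        · exact (l2 _ a1 (a2 _) e hr).1
        · rw [l3 _ a1 (a2 _) e hr]; exact st.s2 i1 (Finset.mem_of_mem_erase h1) j1
    have finish : ∀ (A' : Finset (Sym2 V)) (β' : ι → ℕ), A ⊆ A' →
        (∀ u w', G.Adj u w' → ¬ VO v live u → KH.R G v nb live c s a (v i j) u → 3 ≤ (c s(u, w')).val → s(u, w') ∈ A') →
        (∀ i1 ∈ live.erase i, Ok4 (n i1) (P i1) (thc v nb c' i1) (β' i1)) → (A'.card + ∑ i1 ∈ live.erase i, β' i1 ≤ k) →
        ∃ c' β' A', St G n v nb P k c' (live.erase i) β' A' := by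
      intro A' β' q1 q2 q3 q4
      refine ⟨c', β', A', ⟨fun u hu => l1 u (dd u hu), s2', ?_, q3, s5', q4⟩⟩
      intro u w ha hu hw' hA h3
      obtain ⟨⟨e1, e2, e3⟩, e | e | ⟨e4, e5⟩⟩ := l5 u w ha (dd u hu) (dd w hw') h3
      · exact absurd (q2 u w ha e1 e e3) hA
      · exact absurd (q2 w u ha.symm e2 e (by rwa [Sym2.eq_swap])) (by rwa [Sym2.eq_swap])
      · rw [e4, e5]; exact st.s3 u w ha e1 e2 (fun hh => hA (q1 hh)) e3
    by_cases hit : ∃ i1 ∈ live.erase i, ∃ q1, KH.R G v nb live c s a (v i j) (v i1 q1)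
    · obtain ⟨i1, h1, q1, hr⟩ := hit
      have b1 := vo' i1 h1 q1
      have uniq : ∀ i2 ∈ live.erase i, ∀ q2, KH.R G v nb live c s a (v i j) (v i2 q2) → v i2 q2 = v i1 q1 := by
        intro i2 h2 q2 hr2
        have b2 := vo' i2 h2 q2
        exact h.one_end hs ha (Or.inl b2.1) (Or.inl b1.1) (b2.2 _) (b1.2 _) hr2 hr
      refine finish A (Function.update β i1 (β i1 + 2)) (Finset.Subset.refl _) ?_ ?_ ?_
      · intro u w' ha' hu hRu h3
        exfalso
        have hS : Sc G c u = {0, 1, 2} := by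
          by_contra hS
          have := h.one_end hs ha (Or.inr hS) (Or.inl b1.1) (fun e => hu (e ▸ h.vy)) (b1.2 _) hRu hr
          exact hu (this ▸ b1.1)
        have m : c s(u, w') ∈ Sc G c u := mem_Sc.2 ⟨_, ha', rfl⟩
        rw [hS] at m
        simp only [Finset.mem_insert, Finset.mem_singleton] at m
        rcases m with m | m | m <;> rw [m] at h3 <;> exact absurd h3 (by decide)
      · intro i2 h2
        by_cases e : i2 = i1
        · subst e
          rw [Function.update_self]
          have st4 := st.s4 i2 (Finset.mem_of_mem_erase h2)
          have nR : ∀ l, ¬ l ≡ q1 [MOD n i2] → ¬ KH.R G v nb live c s a (v i j) (v i2 l) := fun l hl hrl =>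
            hl (cs.v_eq_iff.1 (uniq i2 h2 l hrl))
          have sm : ∀ l, ¬ l ≡ q1 [MOD n i2] → v i2 l ≠ v i' (j' + 1) → thc v nb c' i2 l = thc v nb c i2 l := by
            intro l hl hne
            have b2 := vo' i2 h2 l
            unfold thc
            rw [l3 _ b2.1 (b2.2 _) hne (nR l hl)]
          by_cases hT : TT (n i2) (P i2)
          · obtain ⟨j2, hj2⟩ := hT.2
            have hne : ∀ l, v i2 l ≠ v i' (j' + 1) := fun l e => hT' ((cs.inj e).1 ▸ hT)
            have ch : ∀ l, l ≡ q1 [MOD n i2] → thc v nb c' i2 l ≠ thc v nb c i2 l := by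
              intro l hl
              have b2 := vo' i2 h2 l
              have := (l2 _ b2.1 (b2.2 _) (hne l) (by rw [cs.v_modEq hl]; exact hr)).2
              exact fun e => this (Fin.ext e)
            refine ok_hitT (cs.td (s2' i2 h2)) hT st4 j2 hj2 ?_
            rcases three_cases hT.1 j2 q1 with e | e | e
            · left
              refine ⟨ch j2 e.symm, sm _ (fun e' => ?_) (hne _)⟩
              exact modEq_lt (e'.trans e).symm rfl (by omega) (by rw [hT.1]; omega)
            · right
              refine ⟨sm _ (fun e' => ?_) (hne _), ch _ e.symm⟩
              exact modEq_lt (e'.trans e) rfl (by omega) (by rw [hT.1]; omega)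
            · exfalso
              obtain ⟨i3, j3, f1, f2, f3, f4⟩ := cs.partner st.s5 hT.1 hj2
              have b2 := vo' i2 h2 (j2 + 2)
              refine h.iso (s := s) (a := a) b2.1 ?_ (b2.2 _) ?_ ?_
              · rw [f1]; exact ⟨i3, f4, _, rfl⟩
              · rw [f1]
                intro e'
                obtain ⟨e1, e2⟩ := cs.inj e'
                subst e1
                rw [per_modEq (cs.Pper i3) e2, hj] at f3; cases f3
              · rw [← cs.v_modEq e]; exact hr
          · refine ok_hit (cs.pd i2) hT st4 q1 ?_
            intro l hl hl1 hl2
            have : ∀ l', (l' = l ∨ l' = l + 1) → v i2 l' ≠ v i' (j' + 1) := by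
              rintro l' hl' e
              obtain ⟨e1, e2⟩ := cs.inj e
              subst e1
              have := P_prev (cs.pd i2) hP1 hw1 hl
              rcases hl' with rfl | rfl
              · exact this.1 e2
              · exact this.2 e2
            exact ⟨sm l hl1 (this _ (Or.inl rfl)), sm _ hl2 (this _ (Or.inr rfl))⟩
        · rw [Function.update_of_ne e]
          refine ok_no c' s2' (by rw [l4]; exact hbg) i2 h2 fun l hl => ?_
          have b2 := vo' i2 h2 l
          unfold thc
          rw [l3 _ b2.1 (b2.2 _) hl (fun hrl => e (cs.inj (uniq i2 h2 l hrl)).1)]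
      · rw [Finset.sum_update_of_mem h1]
        have := Finset.add_sum_erase _ β h1
        rw [Finset.sdiff_singleton_eq_erase]
        have := st.s6
        omega
    · push Not at hit
      have okk : ∀ i1 ∈ live.erase i, Ok4 (n i1) (P i1) (thc v nb c' i1) (β i1) := by
        intro i1 h1
        refine ok_no c' s2' (by rw [l4]; exact hbg) i1 h1 fun l hl => ?_
        have b2 := vo' i1 h1 l
        unfold thc
        rw [l3 _ b2.1 (b2.2 _) hl (hit i1 h1 l)]
      obtain ⟨AA, hA1, hA2⟩ : ∃ AA : Finset (Sym2 V), AA.card ≤ 2 ∧ ∀ u w', G.Adj u w' → ¬ VO v live u → KH.R G v nb live c s a (v i j) u →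
          3 ≤ (c s(u, w')).val → s(u, w') ∈ AA := by
        by_cases hq : ∃ q, ¬ VO v live q ∧ KH.R G v nb live c s a (v i j) q ∧ Sc G c q ≠ {0, 1, 2}
        · obtain ⟨q, q1, q2, q3⟩ := hq
          obtain ⟨t, ht, hSt⟩ := (pur_cases _ (h.deg q q1)).resolve_left q3
          obtain ⟨p3, p3a, p3c⟩ := mem_Sc.1 (show (3 : Fin 5) ∈ Sc G c q by rw [hSt]; simp)
          obtain ⟨p4, p4a, p4c⟩ := mem_Sc.1 (show (4 : Fin 5) ∈ Sc G c q by rw [hSt]; simp)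
          refine ⟨{s(q, p3), s(q, p4)}, Finset.card_le_two, ?_⟩
          intro u w' hadj hu hRu h3
          have m : c s(u, w') ∈ Sc G c u := mem_Sc.2 ⟨_, hadj, rfl⟩
          have hSu : Sc G c u ≠ {0, 1, 2} := by
            intro hS
            rw [hS] at m
            simp only [Finset.mem_insert, Finset.mem_singleton] at m
            rcases m with m | m | m <;> rw [m] at h3 <;> exact absurd h3 (by decide)
          have : u = q := h.one_end hs ha (Or.inr hSu) (Or.inr q3) (fun e => hu (e ▸ h.vy)) (fun e => q1 (e ▸ h.vy)) hRu q2
          subst this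
          have h34 : ∀ k : Fin 5, 3 ≤ k.val → k = 3 ∨ k = 4 := by decide
          rw [Finset.mem_insert, Finset.mem_singleton]
          rcases h34 _ h3 with e | e
          · left; rw [h.inj u hu w' p3 hadj p3a (e.trans p3c.symm)]
          · right; rw [h.inj u hu w' p4 hadj p4a (e.trans p4c.symm)]
        · refine ⟨∅, by simp, ?_⟩
          intro u w' hadj hu hRu h3
          exfalso
          apply hq
          refine ⟨u, hu, hRu, fun hS => ?_⟩
          have m : c s(u, w') ∈ Sc G c u := mem_Sc.2 ⟨_, hadj, rfl⟩
          rw [hS] at m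
          simp only [Finset.mem_insert, Finset.mem_singleton] at m
          rcases m with m | m | m <;> rw [m] at h3 <;> exact absurd h3 (by decide)
      refine finish (A ∪ AA) β Finset.subset_union_left (fun u w' a1 a2 a3 a4 => Finset.mem_union_right _ (hA2 u w' a1 a2 a3 a4)) okk ?_
      have c1 := Finset.card_union_le A AA
      have := st.s6
      omega

end CS

namespace CS
variable {V ι : Type*} {G : SimpleGraph V} {n : ι → ℕ} {v : ι → ℕ → V} {nb : V → V} {P : ι → ℕ → Bool}

theorem phase1 (cs : CS G n v nb P) (hdeg : ∀ u, ∃ p q r, ∀ w, G.Adj u w ↔ w = p ∨ w = q ∨ w = r) {k : ℕ} :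
    ∀ (m : ℕ) {c : Sym2 V → Fin 5} {live : Finset ι} {β : ι → ℕ} {A : Finset (Sym2 V)}, live.card ≤ m →
    St G n v nb P k c live β A →
    ∃ c live β A, St G n v nb P k c live β A ∧ ∀ i ∈ live, Kl n v nb P i → ¬ (β i = 2 ∧ Agr (P i) (thc v nb c i)) := by
  classical
  intro m
  induction m with
  | zero =>
    intro c live β A hm st
    refine ⟨c, live, β, A, st, fun i hi => ?_⟩
    rw [Finset.card_eq_zero.1 (Nat.le_zero.1 hm)] at hi
    simp at hi
  | succ m ih =>
    intro c live β A hm st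
    by_cases h : ∀ i ∈ live, Kl n v nb P i → ¬ (β i = 2 ∧ Agr (P i) (thc v nb c i))
    · exact ⟨c, live, β, A, st, h⟩
    · push Not at h
      obtain ⟨i, hi, hk, hb, ha⟩ := h
      obtain ⟨c', β', A', st'⟩ := cs.kill hdeg st hi hk hb ha
      exact ih (by have := Finset.card_erase_of_mem hi; have h2 : (live.erase i).card ≤ m := by omega
                   convert h2) st'

end CS

structure TR {V : Type*} (G : SimpleGraph V) (nb : V → V) (x y z w : V) : Prop where
  ax : ∀ u, G.Adj x u ↔ u = y ∨ u = z ∨ u = w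
  ay : ∀ u, G.Adj y u ↔ u = x ∨ u = z ∨ u = nb y
  az : ∀ u, G.Adj z u ↔ u = x ∨ u = y ∨ u = nb z
  nbx : nb x = w
  xy : x ≠ y
  xz : x ≠ z
  yz : y ≠ z
  wx : w ≠ x
  wy : w ≠ y
  wz : w ≠ z
  nyx : nb y ≠ x
  nyy : nb y ≠ y
  nyz : nb y ≠ z
  nzx : nb z ≠ x
  nzy : nb z ≠ y
  nzz : nb z ≠ z

theorem CS.tri {V ι : Type*} {G : SimpleGraph V} {n : ι → ℕ} {v : ι → ℕ → V} {nb : V → V} {P : ι → ℕ → Bool}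
    (cs : CS G n v nb P) {i : ι} {j : ℕ} (hn : n i = 3) {w : V} (hw : nb (v i (j + 2)) = w) :
    TR G nb (v i (j + 2)) (v i j) (v i (j + 1)) w := by
  have v3 : ∀ k, v i (k + 3) = v i k := fun k => by rw [← hn, cs.per]
  have a0 := cs.ne1 i j
  have a1 := cs.ne2 i j
  have a2 := cs.ne1 i (j+1)
  have nbne : ∀ k k', nb (v i k) ≠ v i k' := by
    intro k k' e
    rcases three_cases hn k k' with h | h | h <;> rw [cs.v_modEq h] at e
    · exact (cs.adj_nb i k).ne e.symm
    · exact cs.nb_ne_next i k e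
    · apply cs.nb1 i (k + 2); rw [v3]; exact e
  subst hw
  refine { ax := ?_, ay := ?_, az := ?_, nbx := rfl, xy := a1.symm, xz := a2.symm, yz := a0, wx := nbne _ _, wy := nbne _ _, wz := nbne _ _,
           nyx := nbne _ _, nyy := nbne _ _, nyz := nbne _ _, nzx := nbne _ _, nzy := nbne _ _, nzz := nbne _ _ }
  · intro u
    rw [cs.adj i (j + 1) u, show j + 1 + 2 = j + 3 by rfl, v3, show j + 1 + 1 = j + 2 by rfl]
    tauto
  · intro u
    have := cs.adj i (j + 2) u
    rw [show j + 2 + 1 = j + 3 by rfl, show j + 2 + 2 = j + 1 + 3 by rfl, v3, v3] at this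
    exact this
  · intro u
    rw [cs.adj i j u]; tauto

open scoped Classical in
noncomputable def tc {V : Type*} (c : Sym2 V → Fin 5) (x y z : V) (k m r : Fin 5) : Sym2 V → Fin 5 := fun e =>
  if e = s(x, y) then k else if e = s(x, z) then m else if e = s(y, z) then r else c e

theorem tc_ne {V : Type*} {c : Sym2 V → Fin 5} {x y z : V} {k m r : Fin 5} {u w : V} (h1 : u ≠ x) (h2 : u ≠ y) (h3 : u ≠ z) :
    tc c x y z k m r s(u, w) = c s(u, w) := by
  unfold tc
  rw [if_neg (by simp [h1, h2]), if_neg (by simp [h1, h3]), if_neg (by simp [h2, h3])]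

theorem tc_ne' {V : Type*} {c : Sym2 V → Fin 5} {x y z : V} {k m r : Fin 5} {u w : V} (h1 : w ≠ x) (h2 : w ≠ y) (h3 : w ≠ z) :
    tc c x y z k m r s(u, w) = c s(u, w) := by
  rw [Sym2.eq_swap, tc_ne h1 h2 h3]

def Good (s d k m r : Fin 5) : Prop := s.val < 3 ∧ d.val < 3 ∧ k.val < 3 ∧ d ≠ k ∧ d ≠ s ∧ k ≠ s ∧ ((m = 3 ∧ r = 4) ∨ (m = 4 ∧ r = 3))
instance (s d k m r : Fin 5) : Decidable (Good s d k m r) := inferInstanceAs (Decidable (_ ∧ _))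

theorem good_col : ∀ s d k m r : Fin 5, Good s d k m r → ({k, m, d} : Finset (Fin 5)).card = 3 ∧ ({k, r, s} : Finset (Fin 5)).card = 3 ∧
    Pur {m, r, s} ∧ Nrm {k, m, d} {k, r, s} ∧ Nrm {k, m, d} {m, r, s} := by decide +kernel

theorem good_pick (s s' : Fin 5) (hs : s.val < 3) (hs' : s'.val < 3) : ∃ d k m r k' m' r', Good s d k m r ∧ Good s' d k' m' r' ∧
    Nrm {k, m, d} {k', m', d} := by
  by_cases h : s = s'
  · subst h
    obtain ⟨p, q, h1, h2, h3, h4, h5⟩ := two_others s hs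
    have g : Good s p q 4 3 := ⟨hs, h1, h2, h3, h4.symm, h5.symm, Or.inr ⟨rfl, rfl⟩⟩
    exact ⟨p, q, 4, 3, q, 4, 3, g, g, Or.inl (by rw [Finset.union_self]; exact (good_col _ _ _ _ _ g).1)⟩
  · have : ∀ s s' : Fin 5, (decide (s.val < 3) && decide (s'.val < 3) && decide (s ≠ s')) = true → ∃ d : Fin 5, Good s d s' 4 3 ∧ Good s' d s 3 4 ∧
      Nrm {s', 4, d} {s, 3, d} := by decide +kernel
    obtain ⟨d, h1, h2, h3⟩ := this s s' (by simp [hs, hs', h])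
    exact ⟨d, s', 4, 3, s, 3, 4, h1, h2, h3⟩

namespace TR
variable {V : Type*} {G : SimpleGraph V} {nb : V → V} {x y z w : V} {c' : Sym2 V → Fin 5} {s d k m r : Fin 5}

/-- values on the triangle -/
structure Val (c' : Sym2 V → Fin 5) (nb : V → V) (x y z w : V) (s d k m r : Fin 5) : Prop where
  xy : c' s(x, y) = k
  xz : c' s(x, z) = m
  yz : c' s(y, z) = r
  xw : c' s(x, w) = d
  y : c' s(y, nb y) = s
  z : c' s(z, nb z) = s

theorem Sx (h : TR G nb x y z w) (hv : Val c' nb x y z w s d k m r) : Sc G c' x = {k, m, d} := by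
  rw [KH.Sc3 h.ax, hv.xy, hv.xz, hv.xw]
theorem Sy (h : TR G nb x y z w) (hv : Val c' nb x y z w s d k m r) : Sc G c' y = {k, r, s} := by
  rw [KH.Sc3 h.ay, hv.yz, hv.y, Sym2.eq_swap, hv.xy]
theorem Sz (h : TR G nb x y z w) (hv : Val c' nb x y z w s d k m r) : Sc G c' z = {m, r, s} := by
  rw [KH.Sc3 h.az, hv.z, Sym2.eq_swap, hv.xz, Sym2.eq_swap, hv.yz]

theorem nrm_symm {S S' : Finset (Fin 5)} (h : Nrm S S') : Nrm S' S := by unfold Nrm at *; rwa [Finset.union_comm]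

theorem card (h : TR G nb x y z w) (hv : Val c' nb x y z w s d k m r) (g : Good s d k m r) {u : V} (hu : u = x ∨ u = y ∨ u = z) :
    (Sc G c' u).card = 3 := by
  obtain ⟨g1, g2, g3, g4, g5⟩ := good_col _ _ _ _ _ g
  rcases hu with rfl | rfl | rfl
  · rw [h.Sx hv]; exact g1
  · rw [h.Sy hv]; exact g2
  · rw [h.Sz hv]; exact g3.1

/-- edges at the triangle -/
theorem edges (h : TR G nb x y z w) (hv : Val c' nb x y z w s d k m r) (g : Good s d k m r) {u u' : V} (hu : u = x ∨ u = y ∨ u = z)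
    (ha : G.Adj u u') : Nrm (Sc G c' u) (Sc G c' u') ∨ s(u, u') = s(y, z) ∨ s(u, u') = s(y, nb y) ∨ (u = x ∧ u' = w) ∨
      (u = z ∧ u' = nb z) := by
  obtain ⟨g1, g2, g3, g4, g5⟩ := good_col _ _ _ _ _ g
  rcases hu with rfl | rfl | rfl
  · rcases (h.ax u').1 ha with rfl | rfl | rfl
    · left; rw [h.Sx hv, h.Sy hv]; exact g4
    · left; rw [h.Sx hv, h.Sz hv]; exact g5
    · simp
  · rcases (h.ay u').1 ha with rfl | rfl | rfl
    · left; rw [h.Sx hv, h.Sy hv]; exact nrm_symm g4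
    · right; left; rfl
    · right; right; left; rfl
  · rcases (h.az u').1 ha with rfl | rfl | rfl
    · left; rw [h.Sx hv, h.Sz hv]; exact nrm_symm g5
    · right; left; exact Sym2.eq_swap
    · simp
end TR

theorem tc_xy {V : Type*} {c : Sym2 V → Fin 5} {x y z : V} {k m r : Fin 5} : tc c x y z k m r s(x, y) = k := by
  unfold tc; rw [if_pos rfl]
theorem tc_xz {V : Type*} {c : Sym2 V → Fin 5} {x y z : V} {k m r : Fin 5} (h : y ≠ z) : tc c x y z k m r s(x, z) = m := by
  unfold tc; rw [if_neg (by simp only [Sym2.eq_iff]; grind), if_pos rfl]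
theorem tc_yz {V : Type*} {c : Sym2 V → Fin 5} {x y z : V} {k m r : Fin 5} (h : x ≠ z) (h2 : x ≠ y) : tc c x y z k m r s(y, z) = r := by
  unfold tc; rw [if_neg (by simp only [Sym2.eq_iff]; grind), if_neg (by simp only [Sym2.eq_iff]; grind), if_pos rfl]

namespace TR
variable {V : Type*} {G : SimpleGraph V} {nb : V → V} {x y z x' y' z' : V} {c' : Sym2 V → Fin 5} {s s' d k m r k' m' r' : Fin 5}

theorem half (t : TR G nb x y z x') (t' : TR G nb x' y' z' x) (hv : Val c' nb x y z x' s d k m r) (hv' : Val c' nb x' y' z' x s' d k' m' r')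
    (g : Good s d k m r) (g' : Good s' d k' m' r') (hN : Nrm {k, m, d} {k', m', d}) {A : Finset (Sym2 V)}
    (h1 : s(y, z) ∈ A) (h2 : s(y, nb y) ∈ A) (h3 : s(y', nb y') ∈ A) (hx : nb z ≠ x') (hy : nb z = y' → nb y' = z)
    {u u' : V} (ho : u' = nb z → nb z ≠ x' → nb z ≠ y' → nb z ≠ z' → s(z, nb z) ∉ A → Pur (Sc G c' (nb z)))
    (hu : u = x ∨ u = y ∨ u = z) (ha : G.Adj u u') (hA : s(u, u') ∉ A) : Nrm (Sc G c' u) (Sc G c' u') := by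
  rcases t.edges hv g hu ha with h | h | h | ⟨rfl, rfl⟩ | ⟨rfl, rfl⟩
  · exact h
  · rw [h] at hA; exact absurd h1 hA
  · rw [h] at hA; exact absurd h2 hA
  · rw [t.Sx hv, t'.Sx hv']; exact hN
  · have hy' : nb u ≠ y' := fun e => by
      apply hA; rw [e, Sym2.eq_swap]; rw [hy e] at h3; exact h3
    have p1 : Pur (Sc G c' u) := by rw [t.Sz hv]; exact (good_col _ _ _ _ _ g).2.2.1
    have p2 : Pur (Sc G c' (nb u)) := by
      by_cases hz : nb u = z'
      · rw [hz, t'.Sz hv']; exact (good_col _ _ _ _ _ g').2.2.1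
      · exact ho rfl hx hy' hz hA
    exact nrm_of_pur _ _ p1 p2 s g.1 (mem_Sc.2 ⟨_, ha, hv.z⟩) (mem_Sc.2 ⟨_, ha.symm, by rw [Sym2.eq_swap]; exact hv.z⟩)
end TR

/-- pairing defect -/
def Bd {V ι : Type*} (n : ι → ℕ) (v : ι → ℕ → V) (nb : V → V) (P : ι → ℕ → Bool) (c : Sym2 V → Fin 5) (live : Finset ι) (β : ι → ℕ) (i : ι) : Prop :=
  ∃ j i' j', n i = 3 ∧ n i' = 3 ∧ P i j = true ∧ P i' j' = true ∧ nb (v i (j + 2)) = v i' (j' + 2) ∧ i' ∈ live ∧ β i = 2 ∧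
    thc v nb c i j = thc v nb c i (j + 1) ∧ ((β i' = 2 ∧ thc v nb c i' j' = thc v nb c i' (j' + 1)) ∨ 4 ≤ β i')

structure PS {V ι : Type*} (G : SimpleGraph V) (n : ι → ℕ) (v : ι → ℕ → V) (nb : V → V) (P : ι → ℕ → Bool)
    (k : ℕ) (c : Sym2 V → Fin 5) (live : Finset ι) (β : ι → ℕ) (A : Finset (Sym2 V)) : Prop where
  f1 : ∀ u, ¬ VO v live u → (Sc G c u).card = 3
  f2 : ∀ i ∈ live, ∀ j, (c s(v i j, nb (v i j))).val < 3
  f3 : ∀ u w, G.Adj u w → ¬ VO v live u → ¬ VO v live w → s(u,w) ∉ A → Nrm (Sc G c u) (Sc G c w)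
  f4 : ∀ u w, G.Adj u w → VO v live u → ¬ VO v live w → s(u,w) ∉ A → Pur (Sc G c w)
  f5 : ∀ i ∈ live, Cyc (n i) (thc v nb c i) (β i) ∨ Bd n v nb P c live β i
  f6 : A.card + ∑ i ∈ live, β i ≤ k

namespace CS
variable {V ι : Type*} {G : SimpleGraph V} {n : ι → ℕ} {v : ι → ℕ → V} {nb : V → V} {P : ι → ℕ → Bool}

theorem xu (cs : CS G n v nb P) {i : ι} {j j' : ℕ} (hn : n i = 3) (hj : P i j = true) (hj' : P i j' = true) : v i (j' + 2) = v i (j + 2) := by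
  refine cs.x_unique (j' := j' + 1) hn hj (cs.PP i _ hj') ?_
  by_contra h
  have h := cs.PP i _ (Bool.not_eq_false _ ▸ h : P i (j' + 1 + 1) = true)
  have := cs.Pper i j'
  rw [hn] at this
  rw [this, hj'] at h; simp at h

theorem tri_mem (cs : CS G n v nb P) {i : ι} (hn : n i = 3) (j l : ℕ) : v i l = v i (j + 2) ∨ v i l = v i j ∨ v i l = v i (j + 1) := by
  rcases three_cases hn j l with h | h | h
  · right; left; exact cs.v_modEq h
  · right; right; exact cs.v_modEq h
  · left; exact cs.v_modEq h

theorem Bd_ne (cs : CS G n v nb P) {i i' i2 i3 : ι} {j j' j2 j3 : ℕ} (hn : n i = 3) (hn' : n i' = 3) (hP : P i j = true) (hP' : P i' j' = true)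
    (hb : nb (v i (j + 2)) = v i' (j' + 2)) (hn2 : n i2 = 3) (hn3 : n i3 = 3) (hP3 : P i3 j3 = true)
    (hb2 : nb (v i2 (j2 + 2)) = v i3 (j3 + 2)) (h1 : i2 ≠ i) (h2 : i2 ≠ i') : i3 ≠ i ∧ i3 ≠ i' := by
  have h := cs.nb_nb hb2
  constructor
  · rintro rfl
    rw [cs.xu hn hP hP3, hb] at h
    exact h2 (cs.inj h).1.symm
  · rintro rfl
    rw [cs.xu hn' hP' hP3, cs.nb_nb hb] at h
    exact h1 (cs.inj h).1.symm

open scoped Classical in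
theorem pair_step (cs : CS G n v nb P) {k : ℕ} {c : Sym2 V → Fin 5} {live : Finset ι} {β : ι → ℕ} {A : Finset (Sym2 V)}
    (st : PS G n v nb P k c live β A) {i : ι} (hi : i ∈ live) (hc : ¬ Cyc (n i) (thc v nb c i) (β i)) :
    ∃ c' live' β' A', PS G n v nb P k c' live' β' A' ∧
      (live'.filter fun i => ¬ Cyc (n i) (thc v nb c' i) (β' i)) ⊂ (live.filter fun i => ¬ Cyc (n i) (thc v nb c i) (β i)) := by
  obtain ⟨j, i', j', hn, hn', hP, hP', hb, hi', hβ, ht, hor⟩ := (st.f5 i hi).resolve_left hc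
  have hne : i ≠ i' := by
    rintro rfl
    rw [cs.xu hn hP hP'] at hb
    exact (cs.adj_nb i (j+2)).ne hb.symm
  have hb' := cs.nb_nb hb
  have t := cs.tri hn hb
  have t' := cs.tri hn' hb'
  have dis : ∀ l l', v i l ≠ v i' l' := fun l l' e => hne (cs.inj e).1
  have dis' : ∀ l l', v i' l' ≠ v i l := fun l l' e => hne (cs.inj e).1.symm
  rcases hor with ⟨hβ', ht'⟩ | h4
  · -- both fresh
    have hs := st.f2 i hi j
    have hs' := st.f2 i' hi' j'
    have hss : c s(v i (j+1), nb (v i (j+1))) = c s(v i j, nb (v i j)) := Fin.ext ht.symm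
    have hss' : c s(v i' (j'+1), nb (v i' (j'+1))) = c s(v i' j', nb (v i' j')) := Fin.ext ht'.symm
    obtain ⟨d, k1, m1, r1, k2, m2, r2, g, g', hN⟩ := good_pick _ _ hs hs'
    have tm := cs.tri_mem hn j
    have tm' := cs.tri_mem hn' j'
    have lives : ∀ l, VO v live (v i l) := fun l => ⟨i, hi, l, rfl⟩
    have lives' : ∀ l, VO v live (v i' l) := fun l => ⟨i', hi', l, rfl⟩
    have notl : ∀ i2 ∈ live, i2 ≠ i → ∀ a l, v i2 a ≠ v i l := fun i2 _ h a l e => h (cs.inj e).1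
    have notl' : ∀ i2 ∈ live, i2 ≠ i' → ∀ a l, v i2 a ≠ v i' l := fun i2 _ h a l e => h (cs.inj e).1
    have hzx : nb (v i (j+1)) ≠ v i' (j'+2) := fun e => by
      have := cs.nb_nb e; rw [hb'] at this; exact t.xz this
    have hzx' : nb (v i' (j'+1)) ≠ v i (j+2) := fun e => by
      have := cs.nb_nb e; rw [hb] at this; exact t'.xz this
    have hzy : nb (v i (j+1)) = v i' j' → nb (v i' j') = v i (j+1) := cs.nb_nb
    have hzy' : nb (v i' (j'+1)) = v i j → nb (v i j) = v i' (j'+1) := cs.nb_nb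
    have az : G.Adj (v i (j+1)) (nb (v i (j+1))) := cs.adj_nb _ _
    have az' : G.Adj (v i' (j'+1)) (nb (v i' (j'+1))) := cs.adj_nb _ _
    have d1 := dis (j+2)
    have d2 := dis j
    have d3 := dis (j+1)
    have d1' := dis' (j+2)
    have d2' := dis' j
    have d3' := dis' (j+1)
    generalize hX : v i (j+2) = x at *
    generalize hY : v i j = y at *
    generalize hZ : v i (j+1) = z at *
    generalize hX' : v i' (j'+2) = x' at *
    generalize hY' : v i' j' = y' at *
    generalize hZ' : v i' (j'+1) = z' at *
    generalize hS : c s(y, nb y) = s at *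
    generalize hS' : c s(y', nb y') = s' at *
    have e1 := hX' ▸ d1 (j'+2); have e2 := hY' ▸ d1 j'; have e3 := hZ' ▸ d1 (j'+1)
    have e4 := hX' ▸ d2 (j'+2); have e5 := hY' ▸ d2 j'; have e6 := hZ' ▸ d2 (j'+1)
    have e7 := hX' ▸ d3 (j'+2); have e8 := hY' ▸ d3 j'; have e9 := hZ' ▸ d3 (j'+1)
    set c1 : Sym2 V → Fin 5 := Function.update c s(x, x') d with hc1
    set c' := tc (tc c1 x y z k1 m1 r1) x' y' z' k2 m2 r2 with hc'
    have c1n : ∀ u w, u ≠ x → u ≠ x' → c1 s(u, w) = c s(u, w) := by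
      intro u w h1 h2
      rw [hc1, Function.update_of_ne]
      simp [h1, h2]
    have cv : TR.Val c' nb x y z x' s d k1 m1 r1 := by
      constructor
      · rw [hc', tc_ne e1 e2 e3, tc_xy]
      · rw [hc', tc_ne e1 e2 e3, tc_xz t.yz]
      · rw [hc', tc_ne e4 e5 e6, tc_yz t.xz t.xy]
      · rw [hc', tc_ne e1 e2 e3, tc_ne' e1.symm e4.symm e7.symm, hc1, Function.update_self]
      · rw [hc', tc_ne e4 e5 e6, tc_ne' t.nyx t.nyy t.nyz, c1n _ _ t.xy.symm e4, hS]
      · rw [hc', tc_ne e7 e8 e9, tc_ne' t.nzx t.nzy t.nzz, c1n _ _ t.xz.symm e7, hss]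
    have cv' : TR.Val c' nb x' y' z' x s' d k2 m2 r2 := by
      constructor
      · rw [hc', tc_xy]
      · rw [hc', tc_xz t'.yz]
      · rw [hc', tc_yz t'.xz t'.xy]
      · rw [hc', tc_ne' e1 e2 e3, tc_ne e1.symm e4.symm e7.symm, hc1, Sym2.eq_swap, Function.update_self]
      · rw [hc', tc_ne' t'.nyx t'.nyy t'.nyz, tc_ne e2.symm e5.symm e8.symm, c1n _ _ e2.symm t'.xy.symm, hS']
      · rw [hc', tc_ne' t'.nzx t'.nzy t'.nzz, tc_ne e3.symm e6.symm e9.symm, c1n _ _ e3.symm t'.xz.symm, hss']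
    have cO : ∀ u w, ¬ (u = x ∨ u = y ∨ u = z) → ¬ (u = x' ∨ u = y' ∨ u = z') → c' s(u, w) = c s(u, w) := by
      intro u w h h'
      push Not at h h'
      rw [hc', tc_ne h'.1 h'.2.1 h'.2.2, tc_ne h.1 h.2.1 h.2.2, c1n _ _ h.1 h'.1]
    have sO : ∀ u, ¬ (u = x ∨ u = y ∨ u = z) → ¬ (u = x' ∨ u = y' ∨ u = z') → Sc G c' u = Sc G c u := by
      intro u h h'
      ext l
      simp only [mem_Sc, cO u _ h h']
    have nolive : ∀ u, ¬ (u = x ∨ u = y ∨ u = z) → ¬ (u = x' ∨ u = y' ∨ u = z') → ¬ VO v ((live.erase i).erase i') u → ¬ VO v live u := by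
      rintro u h h' hu ⟨i2, hi2, l, rfl⟩
      refine hu ⟨i2, ?_, l, rfl⟩
      rw [Finset.mem_erase, Finset.mem_erase]
      refine ⟨?_, ?_, hi2⟩
      · rintro rfl; exact h' (tm' l)
      · rintro rfl; exact h (tm l)
    have live_out : ∀ u, VO v ((live.erase i).erase i') u → ¬ (u = x ∨ u = y ∨ u = z) ∧ ¬ (u = x' ∨ u = y' ∨ u = z') ∧ VO v live u := by
      rintro u ⟨i2, hi2, l, rfl⟩
      rw [Finset.mem_erase, Finset.mem_erase] at hi2
      have a := notl i2 hi2.2.2 hi2.2.1 l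
      have a' := notl' i2 hi2.2.2 hi2.1 l
      refine ⟨?_, ?_, i2, hi2.2.2, l, rfl⟩
      · rintro (e | e | e)
        · exact a (j+2) (e.trans hX.symm)
        · exact a j (e.trans hY.symm)
        · exact a (j+1) (e.trans hZ.symm)
      · rintro (e | e | e)
        · exact a' (j'+2) (e.trans hX'.symm)
        · exact a' j' (e.trans hY'.symm)
        · exact a' (j'+1) (e.trans hZ'.symm)
    have thO : ∀ i2 ∈ (live.erase i).erase i', thc v nb c' i2 = thc v nb c i2 := by
      intro i2 hi2
      funext l
      obtain ⟨a, a', -⟩ := live_out (v i2 l) ⟨i2, hi2, l, rfl⟩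
      unfold thc
      rw [cO _ _ a a']
    set A' : Finset (Sym2 V) := A ∪ {s(y, z), s(y, nb y), s(y', z'), s(y', nb y')} with hA'
    have lz : VO v live z := ⟨i, hi, _, hZ.symm⟩
    have lz' : VO v live z' := ⟨i', hi', _, hZ'.symm⟩
    have sub : ∀ {e}, e ∉ A' → e ∉ A := fun h h' => h (Finset.mem_union_left _ h')
    have nl : ∀ u, ¬ VO v ((live.erase i).erase i') u → ¬ (u = x ∨ u = y ∨ u = z) → ¬ (u = x' ∨ u = y' ∨ u = z') → ¬ VO v live u := fun u h h1 h2 => nolive u h1 h2 h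
    refine ⟨c', (live.erase i).erase i', β, A', ⟨?_, ?_, ?_, ?_, ?_, ?_⟩, ?_⟩
    · intro u hu
      by_cases h1 : u = x ∨ u = y ∨ u = z
      · exact t.card cv g h1
      by_cases h2 : u = x' ∨ u = y' ∨ u = z'
      · exact t'.card cv' g' h2
      rw [sO u h1 h2]
      exact st.f1 u (nl u hu h1 h2)
    · intro i2 hi2 l
      have := congrFun (thO i2 hi2) l
      unfold thc at this
      rw [this]
      exact st.f2 i2 (Finset.mem_of_mem_erase (Finset.mem_of_mem_erase hi2)) l
    · -- f3
      have key : ∀ u w, G.Adj u w → ¬ VO v ((live.erase i).erase i') w → s(u,w) ∉ A' → (u = x ∨ u = y ∨ u = z) → Nrm (Sc G c' u) (Sc G c' w) := by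
        intro u w ha hw hA hu
        refine t.half t' cv cv' g g' hN (A := A') (by simp [hA']) (by simp [hA']) (by simp [hA']) hzx hzy ?_ hu ha hA
        intro e a1 a2 a3 a4
        have q1 : ¬ (nb z = x ∨ nb z = y ∨ nb z = z) := by rintro (e | e | e); exacts [t.nzx e, t.nzy e, t.nzz e]
        have q2 : ¬ (nb z = x' ∨ nb z = y' ∨ nb z = z') := by rintro (e | e | e) <;> contradiction
        rw [sO _ q1 q2]
        exact st.f4 z _ az lz (nl _ (e ▸ hw) q1 q2) (sub a4)
      have key' : ∀ u w, G.Adj u w → ¬ VO v ((live.erase i).erase i') w → s(u,w) ∉ A' → (u = x' ∨ u = y' ∨ u = z') → Nrm (Sc G c' u) (Sc G c' w) := by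
        intro u w ha hw hA hu
        refine t'.half t cv' cv g' g (TR.nrm_symm hN) (A := A') (by simp [hA']) (by simp [hA']) (by simp [hA']) hzx' hzy' ?_ hu ha hA
        intro e a1 a2 a3 a4
        have q1 : ¬ (nb z' = x' ∨ nb z' = y' ∨ nb z' = z') := by rintro (e | e | e); exacts [t'.nzx e, t'.nzy e, t'.nzz e]
        have q2 : ¬ (nb z' = x ∨ nb z' = y ∨ nb z' = z) := by rintro (e | e | e) <;> contradiction
        rw [sO _ q2 q1]
        exact st.f4 z' _ az' lz' (nl _ (e ▸ hw) q2 q1) (sub a4)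
      intro u w ha hu hw hA
      have hA2 : s(w, u) ∉ A' := by rwa [Sym2.eq_swap]
      by_cases h1 : u = x ∨ u = y ∨ u = z
      · exact key u w ha hw hA h1
      by_cases h2 : u = x' ∨ u = y' ∨ u = z'
      · exact key' u w ha hw hA h2
      by_cases h3 : w = x ∨ w = y ∨ w = z
      · exact TR.nrm_symm (key w u ha.symm hu hA2 h3)
      by_cases h4 : w = x' ∨ w = y' ∨ w = z'
      · exact TR.nrm_symm (key' w u ha.symm hu hA2 h4)
      rw [sO u h1 h2, sO w h3 h4]
      exact st.f3 u w ha (nl u hu h1 h2) (nl w hw h3 h4) (sub hA)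
    · -- f4
      intro u w ha hu hw hA
      obtain ⟨o1, o2, ol⟩ := live_out u hu
      by_cases h1 : w = x ∨ w = y ∨ w = z
      · rcases h1 with rfl | rfl | rfl
        · rcases (t.ax u).1 ha.symm with e | e | e
          · exact absurd (Or.inr (Or.inl e)) o1
          · exact absurd (Or.inr (Or.inr e)) o1
          · exact absurd (Or.inl e) o2
        · rcases (t.ay u).1 ha.symm with e | e | e
          · exact absurd (Or.inl e) o1
          · exact absurd (Or.inr (Or.inr e)) o1
          · exfalso; apply hA; rw [e, Sym2.eq_swap]; simp [hA']
        · rw [t.Sz cv]; exact (good_col _ _ _ _ _ g).2.2.1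
      by_cases h2 : w = x' ∨ w = y' ∨ w = z'
      · rcases h2 with rfl | rfl | rfl
        · rcases (t'.ax u).1 ha.symm with e | e | e
          · exact absurd (Or.inr (Or.inl e)) o2
          · exact absurd (Or.inr (Or.inr e)) o2
          · exact absurd (Or.inl e) o1
        · rcases (t'.ay u).1 ha.symm with e | e | e
          · exact absurd (Or.inl e) o2
          · exact absurd (Or.inr (Or.inr e)) o2
          · exfalso; apply hA; rw [e, Sym2.eq_swap]; simp [hA']
        · rw [t'.Sz cv']; exact (good_col _ _ _ _ _ g').2.2.1
      rw [sO w h1 h2]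
      exact st.f4 u w ha ol (nl w hw h1 h2) (sub hA)
    · -- f5
      intro i2 hi2
      rw [thO i2 hi2]
      have hi2' := Finset.mem_of_mem_erase (Finset.mem_of_mem_erase hi2)
      rcases st.f5 i2 hi2' with h | ⟨j2, i3, j3, b1, b2, b3, b4, b5, b6, b7, b8, b9⟩
      · exact Or.inl h
      · right
        rw [Finset.mem_erase, Finset.mem_erase] at hi2
        obtain ⟨n1, n2⟩ := cs.Bd_ne hn hn' hP hP' (by rw [hX, hX']; exact hb) b1 b2 b4 b5 hi2.2.1 hi2.1
        have hi3 : i3 ∈ (live.erase i).erase i' := by simp [n1, n2, b6]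
        refine ⟨j2, i3, j3, b1, b2, b3, b4, b5, hi3, b7, ?_, ?_⟩
        · rw [thO i2 (by simp [hi2])]; exact b8
        · rw [thO i3 hi3]; exact b9
    · have h1 := Finset.add_sum_erase live β hi
      have h2 := Finset.add_sum_erase (live.erase i) β (a := i') (by simp [hi', hne.symm])
      have h3 : A'.card ≤ A.card + 4 := by
        refine (Finset.card_union_le _ _).trans (Nat.add_le_add_left (Finset.card_le_four) _)
      have := st.f6
      omega
    · rw [Finset.ssubset_iff_of_subset]
      · refine ⟨i, by simp [hi, hc], by simp⟩
      · intro i2 hi2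
        rw [Finset.mem_filter] at hi2 ⊢
        rw [thO i2 hi2.1] at hi2
        exact ⟨Finset.mem_of_mem_erase (Finset.mem_of_mem_erase hi2.1), hi2.2⟩
  · -- recolour the joining edge
    have hs := st.f2 i hi j
    obtain ⟨_, d, -, hd, -, hsd, -, hdg⟩ := pick _ hs (thc v nb c i' j')
    set c' : Sym2 V → Fin 5 := Function.update c s(v i (j+2), v i' (j'+2)) d with hc'
    have cO : ∀ u w, u ≠ v i (j+2) → u ≠ v i' (j'+2) → c' s(u, w) = c s(u, w) := by
      intro u w h1 h2
      rw [hc', Function.update_of_ne]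
      simp [h1, h2]
    have nV : ∀ u, ¬ VO v live u → u ≠ v i (j+2) ∧ u ≠ v i' (j'+2) := by
      intro u hu
      constructor
      · rintro rfl; exact hu ⟨i, hi, _, rfl⟩
      · rintro rfl; exact hu ⟨i', hi', _, rfl⟩
    have sO : ∀ u, ¬ VO v live u → Sc G c' u = Sc G c u := by
      intro u h
      ext l
      simp only [mem_Sc, cO u _ (nV u h).1 (nV u h).2]
    have cx : c' s(v i (j+2), nb (v i (j+2))) = d := by rw [hb, hc', Function.update_self]
    have cx' : c' s(v i' (j'+2), nb (v i' (j'+2))) = d := by rw [hb', hc', Sym2.eq_swap, Function.update_self]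
    have thO : ∀ i2, i2 ≠ i → i2 ≠ i' → thc v nb c' i2 = thc v nb c i2 := by
      intro i2 h1 h2
      funext l
      unfold thc
      rw [cO _ _ (fun e => h1 (cs.inj e).1) (fun e => h2 (cs.inj e).1)]
    have f2' : ∀ i2 ∈ live, ∀ l, (c' s(v i2 l, nb (v i2 l))).val < 3 := by
      intro i2 hi2 l
      by_cases e1 : v i2 l = v i (j+2)
      · rw [e1, cx]; exact hd
      by_cases e2 : v i2 l = v i' (j'+2)
      · rw [e2, cx']; exact hd
      rw [cO _ _ e1 e2]
      exact st.f2 i2 hi2 l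
    have cy1 : Cyc (n i) (thc v nb c' i) 3 := by
      refine cyc_tri hn (cs.td (f2' i hi)) (j+2) j ?_
      unfold thc
      rw [cx, cO _ _ t.xy.symm (dis _ _)]
      intro e
      exact hsd (Fin.ext e.symm)
    have cy2 : Cyc (n i') (thc v nb c' i') 3 := by
      refine cyc_tri hn' (cs.td (f2' i' hi')) (j'+2) j' ?_
      unfold thc
      rw [cx', cO _ _ (dis' _ _) t'.xy.symm]
      exact hdg
    set β' : ι → ℕ := Function.update (Function.update β i 3) i' 3 with hβ'
    have bi : β' i = 3 := by rw [hβ', Function.update_of_ne hne, Function.update_self]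
    have bi' : β' i' = 3 := by rw [hβ', Function.update_self]
    have bO : ∀ i2, i2 ≠ i → i2 ≠ i' → β' i2 = β i2 := by
      intro i2 h1 h2
      rw [hβ', Function.update_of_ne h2, Function.update_of_ne h1]
    refine ⟨c', live, β', A, ⟨?_, f2', ?_, ?_, ?_, ?_⟩, ?_⟩
    · intro u hu
      rw [sO u hu]; exact st.f1 u hu
    · intro u w ha hu hw hA
      rw [sO u hu, sO w hw]; exact st.f3 u w ha hu hw hA
    · intro u w ha hu hw hA
      rw [sO w hw]; exact st.f4 u w ha hu hw hA
    · intro i2 hi2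
      by_cases e1 : i2 = i
      · subst e1; left; rw [bi]; exact cy1
      by_cases e2 : i2 = i'
      · subst e2; left; rw [bi']; exact cy2
      rw [thO i2 e1 e2, bO i2 e1 e2]
      rcases st.f5 i2 hi2 with h | ⟨j2, i3, j3, b1, b2, b3, b4, b5, b6, b7, b8, b9⟩
      · exact Or.inl h
      · right
        obtain ⟨n1, n2⟩ := cs.Bd_ne hn hn' hP hP' hb b1 b2 b4 b5 e1 e2
        refine ⟨j2, i3, j3, b1, b2, b3, b4, b5, b6, ?_, ?_, ?_⟩
        · rw [bO i2 e1 e2]; exact b7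
        · rw [thO i2 e1 e2]; exact b8
        · rw [thO i3 n1 n2, bO i3 n1 n2]; exact b9
    · have h1 := Finset.add_sum_erase live β hi
      have h2 := Finset.add_sum_erase (live.erase i) β (a := i') (by simp [hi', hne.symm])
      have h1' := Finset.add_sum_erase live β' hi
      have h2' := Finset.add_sum_erase (live.erase i) β' (a := i') (by simp [hi', hne.symm])
      have h3 : ∑ x ∈ (live.erase i).erase i', β' x = ∑ x ∈ (live.erase i).erase i', β x := by
        refine Finset.sum_congr rfl fun a ha => ?_
        rw [Finset.mem_erase, Finset.mem_erase] at ha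
        exact bO a ha.2.1 ha.1
      have := st.f6
      omega
    · rw [Finset.ssubset_iff_of_subset]
      · refine ⟨i, by simp [hi, hc], by simp [bi, cy1]⟩
      · intro i2 hi2
        rw [Finset.mem_filter] at hi2 ⊢
        by_cases e1 : i2 = i
        · subst e1; exact absurd (bi ▸ cy1) hi2.2
        by_cases e2 : i2 = i'
        · subst e2; exact absurd (bi' ▸ cy2) hi2.2
        rw [thO i2 e1 e2, bO i2 e1 e2] at hi2
        exact hi2

open scoped Classical in
theorem pair_all (cs : CS G n v nb P) {k : ℕ} : ∀ (m : ℕ) {c : Sym2 V → Fin 5} {live : Finset ι} {β : ι → ℕ} {A : Finset (Sym2 V)},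
    (live.filter fun i => ¬ Cyc (n i) (thc v nb c i) (β i)).card ≤ m → PS G n v nb P k c live β A →
    ∃ c' : Sym2 V → Fin 5, (∀ u, (Sc G c' u).card = 3) ∧ ∃ B : Finset (Sym2 V), B.card ≤ k ∧
      ∀ u w, G.Adj u w → s(u,w) ∉ B → Nrm (Sc G c' u) (Sc G c' w) := by
  intro m
  induction m with
  | zero =>
    intro c live β A hm st
    refine cs.final c live β A k st.f1 st.f2 st.f3 st.f4 ?_ st.f6
    intro i hi
    by_contra h
    have := Finset.card_eq_zero.1 (Nat.le_zero.1 hm)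
    exact Finset.notMem_empty i (this ▸ Finset.mem_filter.2 ⟨hi, h⟩)
  | succ m ih =>
    intro c live β A hm st
    by_cases h : ∃ i ∈ live, ¬ Cyc (n i) (thc v nb c i) (β i)
    · obtain ⟨i, hi, hc⟩ := h
      obtain ⟨c', live', β', A', st', hss⟩ := cs.pair_step st hi hc
      refine ih ?_ st'
      have := Finset.card_lt_card hss
      omega
    · push Not at h
      exact cs.final c live β A k st.f1 st.f2 st.f3 st.f4 h st.f6

/-- from the end of phase one to the end -/
theorem phase2 (cs : CS G n v nb P) {k : ℕ} {c : Sym2 V → Fin 5} {live : Finset ι} {β : ι → ℕ} {A : Finset (Sym2 V)}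
    (st : St G n v nb P k c live β A) (hk : ∀ i ∈ live, Kl n v nb P i → ¬ (β i = 2 ∧ Agr (P i) (thc v nb c i))) :
    ∃ c' : Sym2 V → Fin 5, (∀ u, (Sc G c' u).card = 3) ∧ ∃ B : Finset (Sym2 V), B.card ≤ k ∧
      ∀ u w, G.Adj u w → s(u,w) ∉ B → Nrm (Sc G c' u) (Sc G c' w) := by
  classical
  refine cs.pair_all _ le_rfl (c := c) (live := live) (β := β) (A := A) ⟨fun u hu => (st.s1 u hu).1, ?_, ?_, ?_, ?_, st.s6⟩
  · exact st.s2
  · intro u w ha hu hw hA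
    by_cases h3 : (c s(u, w)).val < 3
    · exact nrm_of_pur _ _ (st.s1 u hu) (st.s1 w hw) _ h3 (mem_Sc.2 ⟨w, ha, rfl⟩) (mem_Sc.2 ⟨u, ha.symm, by rw [Sym2.eq_swap]⟩)
    · left
      rw [st.s3 u w ha hu hw hA (by omega), Finset.union_self]
      exact (st.s1 w hw).1
  · intro u w ha hu hw hA
    exact st.s1 w hw
  · intro i hi
    have ho := st.s4 i hi
    by_cases hT : TT (n i) (P i)
    · rcases ho.1 hT with ⟨hb, hag⟩ | ⟨hb, hc⟩
      · right
        have hnk : ¬ Kl n v nb P i := fun h => hk i hi h ⟨hb, hag⟩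
        obtain ⟨hn, j, hj⟩ := hT
        obtain ⟨i', j', h1, h2, h3, h4⟩ := cs.partner st.s5 hn hj
        have hT' : TT (n i') (P i') := by
          by_contra hT'
          apply hnk
          refine ⟨j, hn, hj, fun i2 j2 e => ?_⟩
          rw [h1] at e
          rw [← (cs.inj e).1]; exact hT'
        obtain ⟨hn', l, hl⟩ := hT'
        rw [cs.x_unique hn' hl h2 h3] at h1
        refine ⟨j, i', l, hn, hn', hj, hl, h1, h4, hb, hag j hj, ?_⟩
        rcases (st.s4 i' h4).1 ⟨hn', l, hl⟩ with ⟨a, b⟩ | ⟨a, b⟩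
        · exact Or.inl ⟨a, b l hl⟩
        · exact Or.inr a
      · exact Or.inl hc
    · left
      exact ok_cyc (cs.pd i) (cs.td (st.s2 i hi)) hT ho
end CS

theorem bcount_tri {n : ℕ} {P : ℕ → Bool} (hp : PD n P) (hT : TT n P) : bcount n P = 2 := by
  obtain ⟨hn, j, hj⟩ := hT
  subst hn
  have hr : P (j % 3) = true := by rw [← hj]; exact per_modEq hp.hP (Nat.mod_modEq j 3)
  obtain ⟨h1, h2⟩ := T_next hp rfl hr
  have hlt := Nat.mod_lt j (show 0 < 3 by omega)
  have e0 := hp.hP 0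
  have e1 := hp.hP 1
  unfold bcount
  simp only [Finset.sum_range_succ, Finset.sum_range_zero]
  generalize j % 3 = r at *
  interval_cases r <;> simp_all

theorem parity {n : ℕ} {P : ℕ → Bool} (hp : PD n P) (hn : n % 2 = 1) (f : ℕ → ℕ)
    (hf : ∀ j < n, P j = false → P (j + 1) = false → f j < n ∧ P (f j) = false ∧ P (f j + 1) = false ∧ f j ≠ j ∧ f (f j) = j) : False := by
  set F := (Finset.range n).filter fun j => P j = false ∧ P (j + 1) = false with hF
  have h0 : (F.card : ZMod 2) = 0 := by
    rw [Finset.card_eq_sum_ones, Nat.cast_sum]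
    refine Finset.sum_involution (fun a _ => f a) ?_ ?_ ?_ ?_
    · intro a ha; decide
    · intro a ha _
      simp only [hF, Finset.mem_filter, Finset.mem_range] at ha
      exact (hf a ha.1 ha.2.1 ha.2.2).2.2.2.1
    · intro a ha
      simp only [hF, Finset.mem_filter, Finset.mem_range] at ha ⊢
      have := hf a ha.1 ha.2.1 ha.2.2
      exact ⟨this.1, this.2.1, this.2.2.1⟩
    · intro a ha
      simp only [hF, Finset.mem_filter, Finset.mem_range] at ha
      exact (hf a ha.1 ha.2.1 ha.2.2).2.2.2.2
  have h1 : ∑ j ∈ Finset.range n, (if P (j + 1) = true then 1 else 0) = ∑ j ∈ Finset.range n, (if P j = true then 1 else 0) :=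
    sum_periodic_shift n (fun j => if P j = true then 1 else 0) (fun j => by simp only [hp.hP]) 1
  have h2 : ∑ j ∈ Finset.range n, ((if P j = true then 1 else 0) + (if P (j + 1) = true then 1 else 0) + (if P j = false ∧ P (j + 1) = false then 1 else 0)) = n := by
    conv_rhs => rw [← Finset.card_range n, Finset.card_eq_sum_ones]
    refine Finset.sum_congr rfl fun j _ => ?_
    have := hp.hPP j
    cases hj : P j <;> cases hj' : P (j+1) <;> simp_all
  rw [Finset.sum_add_distrib, Finset.sum_add_distrib, h1, ← Finset.card_filter, ← Finset.card_filter, ← hF] at h2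
  rw [ZMod.natCast_eq_zero_iff] at h0
  omega

theorem avoid2 (g g' : ℕ) : ∃ d : Fin 5, d.val < 3 ∧ d.val ≠ g ∧ d.val ≠ g' := by
  by_cases h0 : 0 ≠ g ∧ 0 ≠ g'
  · exact ⟨0, by decide, h0.1, h0.2⟩
  by_cases h1 : 1 ≠ g ∧ 1 ≠ g'
  · exact ⟨1, by decide, h1.1, h1.2⟩
  refine ⟨2, by decide, ?_, ?_⟩
  · show 2 ≠ g; omega
  · show 2 ≠ g'; omega

structure In {V ι : Type*} [Fintype ι] (G : SimpleGraph V) (v : ι → ℕ → V) (nb : V → V) (P : ι → ℕ → Bool)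
    (c : Sym2 V → Fin 5) : Prop where
  i1 : ∀ u, ¬ VO v (Finset.univ : Finset ι) u → Sc G c u = {0, 1, 2}
  i2 : ∀ i j, thc v nb c i j < 3
  i3 : ∀ i, Agr (P i) (thc v nb c i)

namespace CS
variable {V ι : Type*} {G : SimpleGraph V} {n : ι → ℕ} {v : ι → ℕ → V} {nb : V → V} {P : ι → ℕ → Bool}

theorem nonchord (cs : CS G n v nb P) {i : ι} (hn : n i % 2 = 1) : ∃ p i' q, i' ≠ i ∧ P i p = false ∧ P i (p + 1) = false ∧
    nb (v i (p + 1)) = v i' (q + 1) ∧ P i' q = false ∧ P i' (q + 1) = false := by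
  by_contra hcon
  push Not at hcon
  have hall : ∀ j, ∃ q, P i j = false → P i (j + 1) = false → nb (v i (j+1)) = v i (q+1) ∧ P i q = false ∧ P i (q+1) = false := by
    intro j
    by_cases h : P i j = false ∧ P i (j+1) = false
    · obtain ⟨i', q, h1, h2, h3⟩ := cs.E3 i j h.1 h.2
      by_cases e : i' = i
      · subst e; exact ⟨q, fun _ _ => ⟨h1, h2, h3⟩⟩
      · exact absurd h3 (hcon j i' q e h.1 h.2 h1 h2)
    · exact ⟨0, fun a b => absurd ⟨a, b⟩ h⟩
  choose f hf using hall
  have npos : 0 < n i := by have := cs.hn i; omega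
  refine parity (cs.pd i) hn (fun j => f j % n i) ?_
  have Pm : ∀ j k, P i (j % n i + k) = P i (j + k) := fun j k => per_modEq (cs.Pper i) ((Nat.mod_modEq j (n i)).add_right k)
  have vm : ∀ j k, v i (j % n i + k) = v i (j + k) := fun j k => per_modEq (cs.per i) ((Nat.mod_modEq j (n i)).add_right k)
  have Pm0 : ∀ j, P i (j % n i) = P i j := fun j => Pm j 0
  intro j hj h0 h1
  obtain ⟨a1, a2, a3⟩ := hf j h0 h1
  have b0 : P i (f j % n i) = false := by rw [Pm0]; exact a2
  have b1 : P i (f j % n i + 1) = false := by rw [Pm]; exact a3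
  refine ⟨Nat.mod_lt _ npos, b0, b1, ?_, ?_⟩
  · intro e
    have e' : f j % n i = j := e
    have := vm (f j) 1
    rw [e', ← a1] at this
    exact (cs.adj_nb i (j+1)).ne this
  · show f (f j % n i) % n i = j
    obtain ⟨d1, d2, d3⟩ := hf _ b0 b1
    rw [vm, cs.nb_nb a1] at d1
    have := Nat.ModEq.add_right_cancel' 1 (cs.inj d1).2
    rw [← this]; exact Nat.mod_eq_of_lt hj

open scoped Classical in
noncomputable def bad [Fintype ι] (n : ι → ℕ) (v : ι → ℕ → V) (nb : V → V) (P : ι → ℕ → Bool) (c : Sym2 V → Fin 5) : Finset ι :=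
  Finset.univ.filter fun i => ¬ TT (n i) (P i) ∧ ¬ Cyc (n i) (thc v nb c i) (bcount (n i) (P i))

theorem init_step [Fintype ι] (cs : CS G n v nb P) {c : Sym2 V → Fin 5} (hI : In G v nb P c) {i : ι} (hi : i ∈ bad n v nb P c) :
    ∃ c', In G v nb P c' ∧ bad n v nb P c' ⊂ bad n v nb P c := by
  classical
  have hi0 := hi
  simp only [bad, Finset.mem_filter, Finset.mem_univ, true_and] at hi
  obtain ⟨hT, hC⟩ := hi
  have hodd : n i % 2 = 1 := by
    rcases Nat.mod_two_eq_zero_or_one (n i) with h | h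
    · exact absurd (even_word (n i) h (cs.hn i) _ (hI.i2 i) (P i) _ (by rw [discount_zero (hI.i3 i), add_zero])) hC
    · exact h
  obtain ⟨p, i', q, hne, hp0, hp1, hb, hq0, hq1⟩ := cs.nonchord hodd
  have hb' := cs.nb_nb hb
  have W : ∀ i p, P i p = false → P i (p+1) = false → ¬ TT (n i) (P i) → ∃ g, ∀ th' : ℕ → ℕ, (∀ j, th' (j + n i) = th' j) →
      (∀ j, ¬ (j ≡ p + 1 [MOD n i]) → th' j = thc v nb c i j) → th' (p+1) < 3 → th' (p+1) ≠ g → Cyc (n i) th' (bcount (n i) (P i)) := by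
    intro i p h0 h1 hT
    refine word_one (n i) (cs.hn i) _ (cs.thc_per c i) (hI.i2 i) (P i) (cs.Pper i) (cs.PP i) (hI.i3 i) (p+1) h1 ?_ (notT hT)
    rw [show p + 1 + (n i - 1) = p + n i by have := cs.hn i; omega, cs.Pper]; exact h0
  obtain ⟨g, hg⟩ := W i p hp0 hp1 hT
  have hg' : ∃ g, ¬ TT (n i') (P i') → ∀ th' : ℕ → ℕ, (∀ j, th' (j + n i') = th' j) →
      (∀ j, ¬ (j ≡ q + 1 [MOD n i']) → th' j = thc v nb c i' j) → th' (q+1) < 3 → th' (q+1) ≠ g → Cyc (n i') th' (bcount (n i') (P i')) := by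
    by_cases h : TT (n i') (P i')
    · exact ⟨0, fun h' => absurd h h'⟩
    · obtain ⟨g, hg⟩ := W i' q hq0 hq1 h
      exact ⟨g, fun _ => hg⟩
  obtain ⟨g', hg'⟩ := hg'
  obtain ⟨d, hd, hdg, hdg'⟩ := avoid2 g g'
  set c' : Sym2 V → Fin 5 := Function.update c s(v i (p+1), v i' (q+1)) d with hc'
  have cO : ∀ u w, u ≠ v i (p+1) → u ≠ v i' (q+1) → c' s(u, w) = c s(u, w) := by
    intro u w h1 h2
    rw [hc', Function.update_of_ne]
    simp [h1, h2]
  have cx : c' s(v i (p+1), nb (v i (p+1))) = d := by rw [hb, hc', Function.update_self]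
  have cx' : c' s(v i' (q+1), nb (v i' (q+1))) = d := by rw [hb', hc', Sym2.eq_swap, Function.update_self]
  have thO : ∀ i2 l, v i2 l ≠ v i (p+1) → v i2 l ≠ v i' (q+1) → thc v nb c' i2 l = thc v nb c i2 l := by
    intro i2 l h1 h2
    unfold thc
    rw [cO _ _ h1 h2]
  have thO' : ∀ i2, i2 ≠ i → i2 ≠ i' → thc v nb c' i2 = thc v nb c i2 := by
    intro i2 h1 h2
    funext l
    exact thO i2 l (fun e => h1 (cs.inj e).1) (fun e => h2 (cs.inj e).1)
  have nP : ∀ i2 l i p, P i2 l = true → P i p = false → P i (p+1) = false → v i2 l ≠ v i (p+1) ∧ v i2 (l+1) ≠ v i (p+1) := by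
    intro i2 l i p hl h0 h1
    constructor
    · intro e
      obtain ⟨rfl, e'⟩ := cs.inj e
      rw [per_modEq (cs.Pper i2) e', h1] at hl; cases hl
    · intro e
      obtain ⟨rfl, e'⟩ := cs.inj e
      rw [per_modEq (cs.Pper i2) (Nat.ModEq.add_right_cancel' 1 e'), h0] at hl; cases hl
  have c1 : Cyc (n i) (thc v nb c' i) (bcount (n i) (P i)) := by
    refine hg _ (cs.thc_per c' i) ?_ ?_ ?_
    · intro j hj
      exact thO i j (fun e => hj (cs.inj e).2) (fun e => hne (cs.inj e).1.symm)
    · unfold thc; rw [cx]; exact hd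
    · unfold thc; rw [cx]; exact hdg
  have c2 : ¬ TT (n i') (P i') → Cyc (n i') (thc v nb c' i') (bcount (n i') (P i')) := by
    intro h
    refine hg' h _ (cs.thc_per c' i') ?_ ?_ ?_
    · intro j hj
      exact thO i' j (fun e => hne (cs.inj e).1) (fun e => hj (cs.inj e).2)
    · unfold thc; rw [cx']; exact hd
    · unfold thc; rw [cx']; exact hdg'
  refine ⟨c', ⟨?_, ?_, ?_⟩, ?_⟩
  · intro u hu
    rw [← hI.i1 u hu]
    have h1 : u ≠ v i (p+1) := fun e => hu ⟨i, Finset.mem_univ _, _, e⟩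
    have h2 : u ≠ v i' (q+1) := fun e => hu ⟨i', Finset.mem_univ _, _, e⟩
    ext l
    simp only [mem_Sc, cO u _ h1 h2]
  · intro i2 l
    by_cases e1 : v i2 l = v i (p+1)
    · unfold thc; rw [e1, cx]; exact hd
    by_cases e2 : v i2 l = v i' (q+1)
    · unfold thc; rw [e2, cx']; exact hd
    rw [thO _ _ e1 e2]; exact hI.i2 i2 l
  · intro i2 l hl
    obtain ⟨h1, h2⟩ := nP i2 l i p hl hp0 hp1
    obtain ⟨h3, h4⟩ := nP i2 l i' q hl hq0 hq1
    rw [thO _ _ h1 h3, thO _ _ h2 h4]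
    exact hI.i3 i2 l hl
  · rw [Finset.ssubset_iff_of_subset]
    · refine ⟨i, hi0, by simp [bad, c1]⟩
    · intro i2 hi2
      simp only [bad, Finset.mem_filter, Finset.mem_univ, true_and] at hi2 ⊢
      by_cases e1 : i2 = i
      · subst e1; exact absurd c1 hi2.2
      by_cases e2 : i2 = i'
      · subst e2; exact absurd (c2 hi2.1) hi2.2
      rw [thO' i2 e1 e2] at hi2; exact hi2

theorem init_all [Fintype ι] (cs : CS G n v nb P) : ∀ (m : ℕ) {c : Sym2 V → Fin 5}, (bad n v nb P c).card ≤ m → In G v nb P c →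
    ∃ c', In G v nb P c' ∧ bad n v nb P c' = ∅ := by
  intro m
  induction m with
  | zero => intro c h hI; exact ⟨c, hI, Finset.card_eq_zero.1 (Nat.le_zero.1 h)⟩
  | succ m ih =>
    intro c h hI
    rcases (bad n v nb P c).eq_empty_or_nonempty with e | ⟨i, hi⟩
    · exact ⟨c, hI, e⟩
    · obtain ⟨c', hI', hs⟩ := cs.init_step hI hi
      have := Finset.card_lt_card hs
      exact ih (by omega) hI'

theorem main [Fintype ι] (cs : CS G n v nb P) (hdeg : ∀ u, ∃ p q r, ∀ w, G.Adj u w ↔ w = p ∨ w = q ∨ w = r)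
    {c0 : Sym2 V → Fin 5} (hI : In G v nb P c0) {k : ℕ} (hk : ∑ i, bcount (n i) (P i) ≤ k) :
    ∃ c' : Sym2 V → Fin 5, (∀ u, (Sc G c' u).card = 3) ∧ ∃ B : Finset (Sym2 V), B.card ≤ k ∧
      ∀ u w, G.Adj u w → s(u,w) ∉ B → Nrm (Sc G c' u) (Sc G c' w) := by
  classical
  obtain ⟨c, hI, hbad⟩ := cs.init_all _ le_rfl hI
  have pur : Pur ({0, 1, 2} : Finset (Fin 5)) := by decide +kernel
  have st : St G n v nb P k c Finset.univ (fun i => bcount (n i) (P i)) ∅ := by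
    refine ⟨fun u hu => by rw [hI.i1 u hu]; exact pur, fun i _ => hI.i2 i, ?_, ?_, fun i _ => Finset.mem_univ i, by simpa using hk⟩
    · intro u w _ hu hw _ _
      rw [hI.i1 u hu, hI.i1 w hw]
    · intro i _
      refine ⟨fun hT => Or.inl ⟨bcount_tri (cs.pd i) hT, hI.i3 i⟩, fun hT => Or.inl ⟨hI.i3 i, rfl, ?_⟩⟩
      by_contra h
      have : i ∈ bad n v nb P c := by simp only [bad, Finset.mem_filter, Finset.mem_univ, true_and]; exact ⟨hT, h⟩
      rw [hbad] at this; simp at this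
  obtain ⟨c, live, β, A, st, h⟩ := cs.phase1 hdeg _ le_rfl st
  exact cs.phase2 st h
end CS

theorem cyc_dec {V : Type*} [Finite V] (H : SimpleGraph V) (hH : H.IsCycles) :
    ∃ (n : {C : H.ConnectedComponent // ∃ u w, u ∈ C.supp ∧ H.Adj u w} → ℕ) (v : {C : H.ConnectedComponent // ∃ u w, u ∈ C.supp ∧ H.Adj u w} → ℕ → V), (∀ i, 3 ≤ n i) ∧
      (∀ {i j i' j'}, v i j = v i' j' → i = i' ∧ j ≡ j' [MOD n i]) ∧ (∀ i j, v i (j + n i) = v i j) ∧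
      (∀ i j w, H.Adj (v i (j+1)) w ↔ w = v i j ∨ w = v i (j+2)) ∧ (∀ u w, H.Adj u w → ∃ i j, u = v i j) := by
  have ex : ∀ i : {C : H.ConnectedComponent // ∃ u w, u ∈ C.supp ∧ H.Adj u w}, ∃ (u : V) (p : H.Walk u u), p.IsCycle ∧ p.toSubgraph.verts = i.1.supp := by
    rintro ⟨C, u, w, hu, ha⟩
    obtain ⟨p, hp⟩ := hH.exists_cycle_toSubgraph_verts_eq_connectedComponentSupp hu ⟨w, ha⟩
    exact ⟨u, p, hp⟩
  choose b p hp hs using ex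
  have sup : ∀ i j, (p i).getVert j ∈ i.1.supp := fun i j => by
    rw [← hs, SimpleGraph.Walk.mem_verts_toSubgraph]; exact (p i).getVert_mem_support j
  have h3 : ∀ i, 3 ≤ (p i).length := fun i => (hp i).three_le_length
  have inj : ∀ {i j i' j'}, (p i).getVert (j % (p i).length) = (p i').getVert (j' % (p i').length) → i = i' ∧ j ≡ j' [MOD (p i).length] := by
    intro i j i' j' h
    have h1 := sup i (j % (p i).length)
    have h2 := sup i' (j' % (p i').length)
    rw [h] at h1
    have e : i = i' := Subtype.ext (h1.symm.trans h2)
    subst e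
    refine ⟨rfl, (hp i).getVert_injOn' ?_ ?_ h⟩
    · have := Nat.mod_lt j (show 0 < (p i).length by have := h3 i; omega)
      rw [Set.mem_setOf_eq]; omega
    · have := Nat.mod_lt j' (show 0 < (p i).length by have := h3 i; omega)
      rw [Set.mem_setOf_eq]; omega
  have nxt : ∀ i j, H.Adj ((p i).getVert (j % (p i).length)) ((p i).getVert ((j+1) % (p i).length)) := by
    intro i j
    have hl := Nat.mod_lt j (show 0 < (p i).length by have := h3 i; omega)
    have ha := (p i).adj_getVert_succ hl
    by_cases h : j % (p i).length + 1 = (p i).length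
    · have : (j + 1) % (p i).length = 0 := by
        rw [Nat.add_mod, Nat.mod_eq_of_lt (show 1 < (p i).length by have := h3 i; omega), h, Nat.mod_self]
      rw [this, SimpleGraph.Walk.getVert_zero]
      rw [h, SimpleGraph.Walk.getVert_length] at ha
      exact ha
    · have : (j + 1) % (p i).length = j % (p i).length + 1 := by
        rw [Nat.add_mod, Nat.mod_eq_of_lt (show 1 < (p i).length by have := h3 i; omega), Nat.mod_eq_of_lt (by omega)]
      rw [this]; exact ha
  refine ⟨fun i => (p i).length, fun i j => (p i).getVert (j % (p i).length), h3, inj, ?_, ?_, ?_⟩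
  · intro i j; simp
  · intro i j w
    dsimp only
    have a1 := (nxt i j).symm
    have a2 := nxt i (j+1)
    have ne : (p i).getVert (j % (p i).length) ≠ (p i).getVert ((j+2) % (p i).length) := by
      intro e
      have := (inj e).2
      have h4 : j + 0 ≡ j + 2 [MOD (p i).length] := this
      have := Nat.ModEq.add_left_cancel' j h4
      have := Nat.le_of_dvd (by omega) (Nat.modEq_zero_iff_dvd.1 this.symm)
      have := h3 i
      omega
    have hc := hH ⟨_, a1⟩
    have : H.neighborSet ((p i).getVert ((j+1) % (p i).length)) = {(p i).getVert (j % (p i).length), (p i).getVert ((j+2) % (p i).length)} := by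
      symm
      apply Set.eq_of_subset_of_ncard_le
      · rintro x (rfl | rfl)
        · exact a1
        · exact a2
      · rw [hc, Set.ncard_pair ne]
      · exact Set.toFinite _
    rw [← SimpleGraph.mem_neighborSet, this]; simp
  · intro u w ha
    refine ⟨⟨H.connectedComponentMk u, u, w, rfl, ha⟩, ?_⟩
    generalize hi : (⟨H.connectedComponentMk u, u, w, rfl, ha⟩ : {C : H.ConnectedComponent // ∃ u w, u ∈ C.supp ∧ H.Adj u w}) = i
    have hu : u ∈ (p i).toSubgraph.verts := by rw [hs, ← hi]; rfl
    rw [SimpleGraph.Walk.mem_verts_toSubgraph, SimpleGraph.Walk.mem_support_iff_exists_getVert] at hu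
    obtain ⟨m, hm, hml⟩ := hu
    by_cases e : m = (p i).length
    · refine ⟨0, ?_⟩
      rw [e, SimpleGraph.Walk.getVert_length] at hm
      simp [hm]
    · exact ⟨m, by dsimp only; rw [Nat.mod_eq_of_lt (by omega), hm]⟩

section MT
variable {V : Type*} [Fintype V] [DecidableEq V] {G : SimpleGraph V} [DecidableRel G.Adj] {M : Fin 3 → Finset (Sym2 V)}

theorem mt_loc (hM : ∀ i, IsPerfectMatchingFinset G (M i)) (u : V) : ∃ m : Fin 3 → V, ∀ i w, s(u, w) ∈ M i ↔ w = m i := by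
  have : ∀ i, ∃ x, ∀ w, s(u, w) ∈ M i ↔ w = x := by
    intro i
    obtain ⟨e, he⟩ := Finset.card_eq_one.1 ((hM i).2 u)
    have h1 : e ∈ (M i).filter (fun e => u ∈ e) := by rw [he]; simp
    rw [Finset.mem_filter] at h1
    obtain ⟨x, rfl⟩ := Sym2.mem_iff_exists.1 h1.2
    refine ⟨x, fun w => ⟨fun h => ?_, fun h => h ▸ h1.1⟩⟩
    have h2 : s(u, w) ∈ (M i).filter (fun e => u ∈ e) := by simp [h]
    rw [he, Finset.mem_singleton] at h2
    exact Sym2.congr_right.1 h2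
  choose m hm using this
  exact ⟨m, hm⟩

theorem mt_eq {u : V} {m : Fin 3 → V} (hm : ∀ i w, s(u, w) ∈ M i ↔ w = m i) (w : V) :
    edgeMult M s(u, w) = (if w = m 0 then 1 else 0) + (if w = m 1 then 1 else 0) + (if w = m 2 then 1 else 0) := by
  unfold edgeMult
  rw [Finset.card_filter, Fin.sum_univ_three]
  simp only [hm]

theorem mt_type (hcubic : ∀ v : V, G.degree v = 3) (hM : ∀ i, IsPerfectMatchingFinset G (M i)) (u : V) :
    (∃ m : Fin 3 → V, (∀ i w, s(u, w) ∈ M i ↔ w = m i) ∧ (∀ w, G.Adj u w ↔ ∃ i, w = m i) ∧ ∀ i, edgeMult M s(u, m i) = 1) ∨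
    ∃ p q r, p ≠ q ∧ p ≠ r ∧ q ≠ r ∧ (∀ w, G.Adj u w ↔ w = p ∨ w = q ∨ w = r) ∧ edgeMult M s(u, p) = 0 ∧
      ((edgeMult M s(u, q) = 2 ∧ edgeMult M s(u, r) = 1) ∨ (edgeMult M s(u, q) = 0 ∧ edgeMult M s(u, r) = 3)) := by
  obtain ⟨m, hm⟩ := mt_loc hM u
  have ha : ∀ i, m i ∈ G.neighborFinset u := fun i => by
    rw [SimpleGraph.mem_neighborFinset]
    exact (hM i).1 _ ((hm i _).2 rfl)
  have hN : (G.neighborFinset u).card = 3 := by rw [SimpleGraph.card_neighborFinset_eq_degree]; exact hcubic u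
  have three : ∀ a b d, a ∈ G.neighborFinset u → b ∈ G.neighborFinset u → d ∈ G.neighborFinset u → a ≠ b → a ≠ d → b ≠ d →
      ∀ w, G.Adj u w ↔ w = a ∨ w = b ∨ w = d := by
    intro a b d h1 h2 h3 n1 n2 n3 w
    have : ({a, b, d} : Finset V) = G.neighborFinset u := by
      apply Finset.eq_of_subset_of_card_le
      · intro x hx
        simp only [Finset.mem_insert, Finset.mem_singleton] at hx
        rcases hx with rfl | rfl | rfl <;> assumption
      · rw [hN, Finset.card_eq_three.2 ⟨a, b, d, n1, n2, n3, rfl⟩]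
    rw [← SimpleGraph.mem_neighborFinset, ← this]; simp
  have two : ∀ q r : V, q ≠ r → (∀ w, edgeMult M s(u, w) = if w = q then 2 else if w = r then 1 else 0) → q ∈ G.neighborFinset u → r ∈ G.neighborFinset u →
      ∃ p q r, p ≠ q ∧ p ≠ r ∧ q ≠ r ∧ (∀ w, G.Adj u w ↔ w = p ∨ w = q ∨ w = r) ∧ edgeMult M s(u, p) = 0 ∧
      ((edgeMult M s(u, q) = 2 ∧ edgeMult M s(u, r) = 1) ∨ (edgeMult M s(u, q) = 0 ∧ edgeMult M s(u, r) = 3)) := by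
    intro q r hqr hw hq hr
    have : ∃ p ∈ G.neighborFinset u, p ∉ ({q, r} : Finset V) := by
      apply Finset.exists_mem_notMem_of_card_lt_card
      have := Finset.card_le_two (a := q) (b := r)
      omega
    obtain ⟨p, hp, hp'⟩ := this
    simp only [Finset.mem_insert, Finset.mem_singleton, not_or] at hp'
    refine ⟨p, q, r, hp'.1, hp'.2, hqr, three p q r hp hq hr hp'.1 hp'.2 hqr, ?_, Or.inl ⟨?_, ?_⟩⟩
    · rw [hw, if_neg hp'.1, if_neg hp'.2]
    · rw [hw, if_pos rfl]
    · rw [hw, if_neg hqr.symm, if_pos rfl]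
  by_cases h01 : m 0 = m 1
  · right
    by_cases h12 : m 1 = m 2
    · have : ∃ p ∈ G.neighborFinset u, p ∉ ({m 0} : Finset V) := by
        apply Finset.exists_mem_notMem_of_card_lt_card
        rw [hN, Finset.card_singleton]; omega
      obtain ⟨p, hp, hp'⟩ := this
      have : ∃ q ∈ G.neighborFinset u, q ∉ ({p, m 0} : Finset V) := by
        apply Finset.exists_mem_notMem_of_card_lt_card
        have := Finset.card_le_two (a := p) (b := m 0)
        omega
      obtain ⟨q, hq, hq'⟩ := this
      simp only [Finset.mem_insert, Finset.mem_singleton, not_or] at hp' hq'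
      refine ⟨p, q, m 0, Ne.symm hq'.1, hp', hq'.2, three _ _ _ hp hq (ha 0) (Ne.symm hq'.1) hp' hq'.2, ?_, Or.inr ⟨?_, ?_⟩⟩
      · rw [mt_eq hm, ← h12, ← h01]; simp [hp']
      · rw [mt_eq hm, ← h12, ← h01]; simp [hq']
      · rw [mt_eq hm, ← h12, ← h01]; simp
    · refine two (m 0) (m 2) (h01 ▸ h12) (fun w => ?_) (ha 0) (ha 2)
      rw [mt_eq hm]
      grind
  by_cases h12 : m 1 = m 2
  · right
    refine two (m 1) (m 0) (Ne.symm h01) (fun w => ?_) (ha 1) (ha 0)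
    rw [mt_eq hm]
    grind
  by_cases h02 : m 0 = m 2
  · right
    refine two (m 0) (m 1) h01 (fun w => ?_) (ha 0) (ha 1)
    rw [mt_eq hm]
    grind
  left
  refine ⟨m, hm, fun w => ?_, fun i => ?_⟩
  · rw [three _ _ _ (ha 0) (ha 1) (ha 2) h01 h02 h12, Fin.exists_fin_succ, Fin.exists_fin_succ, Fin.exists_fin_succ]
    simp
  · rw [mt_eq hm]
    fin_cases i <;> simp <;> grind

end MT

section MT
variable {V : Type*} [Fintype V] [DecidableEq V] {G : SimpleGraph V} [DecidableRel G.Adj] {M : Fin 3 → Finset (Sym2 V)}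

/-- edges of even multiplicity -/
def HG (G : SimpleGraph V) (M : Fin 3 → Finset (Sym2 V)) : SimpleGraph V where
  Adj u w := G.Adj u w ∧ (edgeMult M s(u, w) = 0 ∨ edgeMult M s(u, w) = 2)
  symm := ⟨fun u w h => ⟨h.1.symm, by rw [Sym2.eq_swap]; exact h.2⟩⟩
  loopless := ⟨fun u h => h.1.ne rfl⟩

theorem HG_adj {u w : V} : (HG G M).Adj u w ↔ G.Adj u w ∧ (edgeMult M s(u, w) = 0 ∨ edgeMult M s(u, w) = 2) := Iff.rfl

theorem HG_type (hcubic : ∀ v : V, G.degree v = 3) (hM : ∀ i, IsPerfectMatchingFinset G (M i)) {u w0 : V} (hw : (HG G M).Adj u w0) :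
    ∃ p q r, p ≠ q ∧ p ≠ r ∧ q ≠ r ∧ (∀ w, G.Adj u w ↔ w = p ∨ w = q ∨ w = r) ∧ edgeMult M s(u, p) = 0 ∧
      ((edgeMult M s(u, q) = 2 ∧ edgeMult M s(u, r) = 1) ∨ (edgeMult M s(u, q) = 0 ∧ edgeMult M s(u, r) = 3)) ∧
      (∀ w, (HG G M).Adj u w ↔ w = p ∨ w = q) := by
  rcases mt_type hcubic hM u with ⟨m, h1, h2, h3⟩ | ⟨p, q, r, n1, n2, n3, h1, h2, h3⟩
  · obtain ⟨a, b⟩ := HG_adj.1 hw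
    obtain ⟨i, rfl⟩ := (h2 w0).1 a
    rw [h3 i] at b
    omega
  · refine ⟨p, q, r, n1, n2, n3, h1, h2, h3, fun w => ?_⟩
    rw [HG_adj, h1]
    constructor
    · rintro ⟨rfl | rfl | rfl, h⟩
      · simp
      · simp
      · omega
    · rintro (rfl | rfl)
      · exact ⟨Or.inl rfl, Or.inl h2⟩
      · exact ⟨Or.inr (Or.inl rfl), by omega⟩

theorem HG_cycles (hcubic : ∀ v : V, G.degree v = 3) (hM : ∀ i, IsPerfectMatchingFinset G (M i)) : (HG G M).IsCycles := by
  rintro u ⟨w, hw⟩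
  obtain ⟨p, q, r, n1, n2, n3, h1, h2, h3, h4⟩ := HG_type hcubic hM hw
  have : (HG G M).neighborSet u = {p, q} := by ext w; simp [h4]
  rw [this, Set.ncard_pair n1]

open scoped Classical in
noncomputable def nbr (G : SimpleGraph V) (M : Fin 3 → Finset (Sym2 V)) (u : V) : V :=
  if h : ∃ w, G.Adj u w ∧ ¬ (HG G M).Adj u w then h.choose else u

theorem nbr_eq (hcubic : ∀ v : V, G.degree v = 3) (hM : ∀ i, IsPerfectMatchingFinset G (M i)) {u w0 : V} (hw : (HG G M).Adj u w0) :
    ∃ p q, p ≠ q ∧ p ≠ nbr G M u ∧ q ≠ nbr G M u ∧ (∀ w, G.Adj u w ↔ w = p ∨ w = q ∨ w = nbr G M u) ∧ edgeMult M s(u, p) = 0 ∧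
      ((edgeMult M s(u, q) = 2 ∧ edgeMult M s(u, nbr G M u) = 1) ∨ (edgeMult M s(u, q) = 0 ∧ edgeMult M s(u, nbr G M u) = 3)) ∧
      (∀ w, (HG G M).Adj u w ↔ w = p ∨ w = q) := by
  obtain ⟨p, q, r, n1, n2, n3, h1, h2, h3, h4⟩ := HG_type hcubic hM hw
  have hr : nbr G M u = r := by
    have hex : ∃ w, G.Adj u w ∧ ¬ (HG G M).Adj u w := ⟨r, by rw [h1]; simp, by rw [h4]; simp [n2.symm, n3.symm]⟩
    have hs := hex.choose_spec
    unfold nbr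
    rw [dif_pos hex]
    rw [h1, h4] at hs
    tauto
  rw [hr]
  exact ⟨p, q, n1, n2, n3, h1, h2, h3, h4⟩

/-- initial colouring -/
noncomputable def ccol (M : Fin 3 → Finset (Sym2 V)) (e : Sym2 V) : Fin 5 :=
  if edgeMult M e = 1 then (if e ∈ M 0 then 0 else if e ∈ M 1 then 1 else 2) else 0

theorem ccol_lt (e : Sym2 V) : (ccol M e).val < 3 := by
  unfold ccol; split_ifs <;> decide

theorem ccol_two {u w r : V} (hM : ∀ i, IsPerfectMatchingFinset G (M i)) (h2 : edgeMult M s(u, w) = 2) (hr : edgeMult M s(u, r) = 1) (hne : w ≠ r) :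
    ccol M s(u, r) = if s(u, w) ∉ M 0 then 0 else if s(u, w) ∉ M 1 then 1 else 2 := by
  obtain ⟨m, hm⟩ := mt_loc hM u
  rw [ccol, if_pos hr]
  rw [mt_eq hm] at h2 hr
  simp only [hm]
  grind

theorem ccol_one {u : V} {m : Fin 3 → V} (hm : ∀ i w, s(u, w) ∈ M i ↔ w = m i) (h : ∀ i, edgeMult M s(u, m i) = 1) (i : Fin 3) :
    (ccol M s(u, m i)).val = i.val := by
  have h' := h i
  rw [ccol, if_pos h']
  rw [mt_eq hm] at h'
  simp only [hm]
  fin_cases i <;> simp at h' ⊢ <;> grind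

theorem build (hcubic : ∀ v : V, G.degree v = 3) (hM : ∀ i, IsPerfectMatchingFinset G (M i)) :
    ∃ c' : Sym2 V → Fin 5, (∀ u, (Sc G c' u).card = 3) ∧ ∃ B : Finset (Sym2 V), B.card ≤ (matchClass G M 0).card ∧
      ∀ u w, G.Adj u w → s(u,w) ∉ B → Nrm (Sc G c' u) (Sc G c' w) := by
  classical
  obtain ⟨n, v, h3, inj, per, hadj, hcov⟩ := cyc_dec (HG G M) (HG_cycles hcubic hM)
  haveI : Fintype {C : (HG G M).ConnectedComponent // ∃ u w, u ∈ C.supp ∧ (HG G M).Adj u w} := Fintype.ofFinite _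
  have hA : ∀ i j, (HG G M).Adj (v i (j+1)) (v i j) := fun i j => (hadj i j _).2 (Or.inl rfl)
  have hA2 : ∀ i j, (HG G M).Adj (v i (j+1)) (v i (j+2)) := fun i j => (hadj i j _).2 (Or.inr rfl)
  set P : {C : (HG G M).ConnectedComponent // ∃ u w, u ∈ C.supp ∧ (HG G M).Adj u w} → ℕ → Bool :=
    fun i j => decide (edgeMult M s(v i j, v i (j+1)) = 2) with hP
  have Pf : ∀ i j, P i j = false → edgeMult M s(v i j, v i (j+1)) = 0 := by
    intro i j h
    have := (hA i j).2
    rw [Sym2.eq_swap] at this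
    simp only [hP, decide_eq_false_iff_not] at h
    omega
  have Pt : ∀ i j, P i j = true → edgeMult M s(v i j, v i (j+1)) = 2 := by
    intro i j h
    simpa [hP] using h
  have dat := fun i j => nbr_eq hcubic hM (hA i j)
  have ne2 : ∀ i j, v i j ≠ v i (j+2) := by
    intro i j e
    have h4 : j + 0 ≡ j + 2 [MOD n i] := (inj e).2
    have := Nat.ModEq.add_left_cancel' j h4
    have := Nat.le_of_dvd (by omega) (Nat.modEq_zero_iff_dvd.1 this.symm)
    have := h3 i
    omega
  have cs : CS G n v (nbr G M) P := by
    refine ⟨h3, inj, per, ?_, ?_, ?_, ?_, ?_, ?_⟩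
    · intro i j w
      obtain ⟨p, q, n1, n2, n3, h1, h2, h3, h4⟩ := dat i j
      have := hadj i j w
      rw [h4] at this
      rw [h1]; tauto
    · intro i j e
      obtain ⟨p, q, n1, n2, n3, h1, h2, h3, h4⟩ := dat i j
      have := (h4 _).1 (hA i j)
      rw [← e] at this
      rcases this with h | h
      · exact n2 h.symm
      · exact n3 h.symm
    · intro i j e
      obtain ⟨p, q, n1, n2, n3, h1, h2, h3, h4⟩ := dat i j
      have := (h4 _).1 (hA2 i j)
      rw [← e] at this
      rcases this with h | h
      · exact n2 h.symm
      · exact n3 h.symm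
    · intro i j
      simp only [hP]
      rw [per, show j + n i + 1 = j + 1 + n i by omega, per]
    · intro i j hj
      by_contra hcon
      have hj2 := Pt i (j+1) (by simpa using hcon)
      have hj1 := Pt i j hj
      rw [Sym2.eq_swap] at hj1
      obtain ⟨p, q, n1, n2, n3, h1, h2, h3, h4⟩ := dat i j
      have e1 := (h4 _).1 (hA i j)
      have e2 := (h4 _).1 (hA2 i j)
      have ne := ne2 i j
      rcases e1 with e1 | e1 <;> rcases e2 with e2 | e2
      · exact ne (e1.trans e2.symm)
      · rw [e1] at hj1; omega
      · rw [show j + 1 + 1 = j + 2 by rfl, e2] at hj2; omega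
      · exact ne (e1.trans e2.symm)
    · intro i j hj0 hj1
      have hj0 := Pf i j hj0
      have hj1 := Pf i (j+1) hj1
      rw [Sym2.eq_swap] at hj0
      obtain ⟨p, q, n1, n2, n3, h1, h2, h3', h4⟩ := dat i j
      have e1 := (h4 _).1 (hA i j)
      have e2 := (h4 _).1 (hA2 i j)
      have ne := ne2 i j
      have hq0 : edgeMult M s(v i (j+1), q) = 0 := by
        rcases e1 with e1 | e1 <;> rcases e2 with e2 | e2
        · exact absurd (e1.trans e2.symm) ne
        · rw [← e2]; exact hj1
        · rw [← e1]; exact hj0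
        · exact absurd (e1.trans e2.symm) ne
      have hr3 : edgeMult M s(v i (j+1), nbr G M (v i (j+1))) = 3 := by omega
      have hra : G.Adj (nbr G M (v i (j+1))) (v i (j+1)) := ((h1 _).2 (Or.inr (Or.inr rfl))).symm
      generalize nbr G M (v i (j+1)) = w at *
      rw [Sym2.eq_swap] at hr3
      rcases mt_type hcubic hM w with ⟨m, g1, g2, g3⟩ | ⟨p', q', r', m1, m2, m3, g1, g2, g3⟩
      · obtain ⟨l, hl⟩ := (g2 _).1 hra
        rw [hl, g3] at hr3; omega
      · have hre : v i (j+1) = r' := by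
          rcases (g1 _).1 hra with e | e | e
          · rw [e] at hr3; omega
          · rw [e] at hr3; omega
          · exact e
        rw [hre] at hr3
        have hH : (HG G M).Adj w p' := HG_adj.2 ⟨by rw [g1]; simp, Or.inl g2⟩
        obtain ⟨i', j', hj'⟩ := hcov w p' hH
        have hs : w = v i' (j' + n i' - 1 + 1) := by
          rw [hj', ← per i' j']; congr 1; have := h3 i'; omega
        generalize j' + n i' - 1 = l at hs
        subst hs
        have zero : ∀ x, (HG G M).Adj (v i' (l+1)) x → edgeMult M s(v i' (l+1), x) = 0 := by
          intro x hx
          obtain ⟨a, b⟩ := HG_adj.1 hx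
          rcases (g1 _).1 a with e | e | e
          · rw [e]; exact g2
          · rw [e]; omega
          · rw [e] at b; omega
        refine ⟨i', l, rfl, ?_, ?_⟩
        · have := zero _ (hA i' l)
          rw [Sym2.eq_swap] at this
          simp only [hP, this]; rfl
        · have := zero _ (hA2 i' l)
          simp only [hP, this]; rfl
  have hdeg : ∀ u, ∃ p q r, ∀ w, G.Adj u w ↔ w = p ∨ w = q ∨ w = r := by
    intro u
    rcases mt_type hcubic hM u with ⟨m, g1, g2, g3⟩ | ⟨p', q', r', m1, m2, m3, g1, g2, g3⟩
    · refine ⟨m 0, m 1, m 2, fun w => ?_⟩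
      rw [g2, Fin.exists_fin_succ, Fin.exists_fin_succ, Fin.exists_fin_succ]
      simp
    · exact ⟨p', q', r', g1⟩
  refine cs.main hdeg (c0 := ccol M) ⟨?_, ?_, ?_⟩ ?_
  · intro u hu
    rcases mt_type hcubic hM u with ⟨m, g1, g2, g3⟩ | ⟨p', q', r', m1, m2, m3, g1, g2, g3⟩
    · have hk := ccol_one g1 g3
      ext k
      rw [mem_Sc]
      constructor
      · rintro ⟨w, hw, rfl⟩
        obtain ⟨i, rfl⟩ := (g2 _).1 hw
        have := ccol_lt (M := M) s(u, m i)
        generalize ccol M s(u, m i) = x at this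
        revert x; decide +kernel
      · intro hk'
        have hlt : k.val < 3 := by revert k; decide +kernel
        exact ⟨m ⟨k.val, hlt⟩, (g2 _).2 ⟨_, rfl⟩, Fin.ext (hk _)⟩
    · exfalso
      have hH : (HG G M).Adj u p' := HG_adj.2 ⟨by rw [g1]; simp, Or.inl g2⟩
      obtain ⟨i', j', hj'⟩ := hcov u p' hH
      exact hu ⟨i', Finset.mem_univ _, j', hj'⟩
  · intro i j
    exact ccol_lt _
  · intro i j hj
    have h2 := Pt i j hj
    have key : ∀ u w, (HG G M).Adj u w → edgeMult M s(u, w) = 2 → edgeMult M s(u, nbr G M u) = 1 ∧ w ≠ nbr G M u := by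
      intro u w ha hw
      obtain ⟨p, q, n1, n2, n3, h1, h2, h3, h4⟩ := nbr_eq hcubic hM ha
      rcases (h4 _).1 ha with e | e
      · subst e; omega
      · subst e; exact ⟨by omega, n3⟩
    obtain ⟨a1, a2⟩ := key _ _ (hA i j).symm h2
    have h2' := h2
    rw [Sym2.eq_swap] at h2'
    obtain ⟨b1, b2⟩ := key _ _ (hA i j) h2'
    unfold thc
    rw [ccol_two hM h2 a1 a2, ccol_two hM h2' b1 b2, Sym2.eq_swap]
  · have : ∀ i, bcount (n i) (P i) = ((Finset.range (n i)).filter fun j => P i j = false).card := by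
      intro i
      unfold bcount
      rw [Finset.card_filter]
      refine Finset.sum_congr rfl fun j _ => ?_
      cases P i j <;> rfl
    simp only [this]
    rw [← Finset.card_sigma]
    refine Finset.card_le_card_of_injOn (fun x => s(v x.1 x.2, v x.1 (x.2+1))) ?_ ?_
    · rintro ⟨i, j⟩ hx
      simp only [Finset.coe_sigma, Set.mem_sigma_iff, Finset.mem_coe, Finset.mem_filter] at hx
      simp only [matchClass, Finset.mem_coe, Finset.mem_filter, SimpleGraph.mem_edgeFinset, SimpleGraph.mem_edgeSet]
      exact ⟨(hA i j).1.symm, Pf i j hx.2.2⟩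
    · rintro ⟨i, j⟩ hx ⟨i', j'⟩ hx' e
      simp only [Finset.coe_sigma, Set.mem_sigma_iff, Finset.mem_coe, Finset.mem_filter, Finset.mem_range] at hx hx'
      obtain ⟨rfl, hm⟩ := cs.edge_inj e
      have : j = j' := by
        rw [Nat.ModEq, Nat.mod_eq_of_lt hx.2.1, Nat.mod_eq_of_lt hx'.2.1] at hm; exact hm
      rw [this]

end MT

section FinalSec
variable {V : Type*} [Fintype V] [DecidableEq V] {G : SimpleGraph V} [DecidableRel G.Adj]

theorem image_edgeNbhd (c : Sym2 V → Fin 5) {u w : V} (h : G.Adj u w) :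
    (edgeNbhd G s(u, w)).image c = Sc G c u ∪ Sc G c w := by
  ext k
  rw [Finset.mem_union, mem_Sc, mem_Sc, Finset.mem_image]
  constructor
  · rintro ⟨f, hf, rfl⟩
    rw [edgeNbhd, Finset.mem_filter, SimpleGraph.mem_edgeFinset] at hf
    obtain ⟨hf, v, hv, hv2⟩ := hf
    obtain ⟨x, rfl⟩ := Sym2.mem_iff_exists.1 hv2
    rw [SimpleGraph.mem_edgeSet] at hf
    rcases Sym2.mem_iff.1 hv with rfl | rfl
    · exact Or.inl ⟨x, hf, rfl⟩
    · exact Or.inr ⟨x, hf, rfl⟩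
  · rintro (⟨x, hx, rfl⟩ | ⟨x, hx, rfl⟩)
    · refine ⟨_, ?_, rfl⟩
      rw [edgeNbhd, Finset.mem_filter, SimpleGraph.mem_edgeFinset]
      exact ⟨hx, u, by simp, by simp⟩
    · refine ⟨_, ?_, rfl⟩
      rw [edgeNbhd, Finset.mem_filter, SimpleGraph.mem_edgeFinset]
      exact ⟨hx, w, by simp, by simp⟩

theorem proper_of_Sc (hcubic : ∀ v : V, G.degree v = 3) {c : Sym2 V → Fin 5} (hc : ∀ u, (Sc G c u).card = 3) :
    IsProperEdgeColoring G c := by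
  have hdeg : ∀ u, ∃ p q r, ∀ w, G.Adj u w ↔ w = p ∨ w = q ∨ w = r := by
    intro u
    have := hcubic u
    rw [← SimpleGraph.card_neighborFinset_eq_degree, Finset.card_eq_three] at this
    obtain ⟨p, q, r, -, -, -, h⟩ := this
    refine ⟨p, q, r, fun w => ?_⟩
    rw [← SimpleGraph.mem_neighborFinset, h]; simp
  rintro e he f hf hne ⟨v, hv, hv2⟩ heq
  obtain ⟨x, rfl⟩ := Sym2.mem_iff_exists.1 hv
  obtain ⟨y, rfl⟩ := Sym2.mem_iff_exists.1 hv2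
  exact hne (by rw [CS.inj_of_card hdeg (hc v) x y he hf heq])

end FinalSec

open scoped Classical in
/-- If `μ₃(G) ≤ |E(G)|/5` for a bridgeless cubic graph `G`, then `G` has a
proper 5-edge-coloring in which at least `(4/5)|E(G)|` edges are normal. -/
theorem stmt13 {V : Type*} [Fintype V] [DecidableEq V]
    (G : SimpleGraph V) [DecidableRel G.Adj]
    (hcubic : ∀ v : V, G.degree v = 3)
    (hbridgeless : ∀ e ∈ G.edgeSet, ¬ G.IsBridge e)
    (hmu : 5 * sInf {k : ℕ | ∃ M : Fin 3 → Finset (Sym2 V),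
        (∀ i, IsPerfectMatchingFinset G (M i)) ∧ (matchClass G M 0).card = k} ≤
      G.edgeFinset.card) :
    ∃ c : Sym2 V → Fin 5, IsProperEdgeColoring G c ∧
      4 * G.edgeFinset.card ≤
        5 * (G.edgeFinset.filter fun e => IsNormalEdge G c e).card := by
  have hne : {k : ℕ | ∃ M : Fin 3 → Finset (Sym2 V),
        (∀ i, IsPerfectMatchingFinset G (M i)) ∧ (matchClass G M 0).card = k}.Nonempty := by
    obtain ⟨M, h1, h2⟩ := petersen' G (fun v => by convert hcubic v) hbridgeless
    refine ⟨_, fun _ => M, fun _ => ⟨h1, fun v => ?_⟩, rfl⟩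
    convert h2 v
  obtain ⟨M, hM, hk⟩ := Nat.sInf_mem hne
  rw [← hk] at hmu
  obtain ⟨c, hc, B, hB, hn⟩ := build hcubic hM
  refine ⟨c, proper_of_Sc hcubic hc, ?_⟩
  have hs : G.edgeFinset ⊆ (G.edgeFinset.filter fun e => IsNormalEdge G c e) ∪ B := by
    intro e he
    by_cases hb : e ∈ B
    · exact Finset.mem_union_right _ hb
    · refine Finset.mem_union_left _ (Finset.mem_filter.2 ⟨he, ?_⟩)
      induction e using Sym2.ind with
      | _ u w =>
        have ha : G.Adj u w := by simpa using he
        have := hn u w ha hb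
        unfold IsNormalEdge IsPoorEdge IsRichEdge
        rw [image_edgeNbhd c ha]
        exact this
  have h1 := (Finset.card_le_card hs).trans (Finset.card_union_le _ _)
  omega
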